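/- Let T be a normal combinatorially two-orbit LFC tiling of ℝ³. Then the face poset of T is order-isomorphic to the face poset of the tetrahedral–octahedral honeycomb or to the face poset of the rhombic dodecahedral honeycomb. -/

import Mathlib

/-! Generic definitions about flags, flag orbits, and abstract polytopes. -/

variable {α : Type*} [PartialOrder α]

/-- Two flags (maximal chains) are in the same orbit of the automorphism group
(the group of order automorphisms) if some order automorphism maps one onto the other. -/
def SameFlagOrbit (Φ Ψ : Flag α) : Prop :=
  ∃ γ : α ≃o α, γ '' (Φ : Set α) = (Ψ : Set α)

/-- The automorphism group has exactly two orbits on the flags. -/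
def TwoFlagOrbits (α : Type*) [PartialOrder α] : Prop :=
  ∃ Φ Ψ : Flag α, ¬ SameFlagOrbit Φ Ψ ∧
    ∀ Ω : Flag α, SameFlagOrbit Ω Φ ∨ SameFlagOrbit Ω Ψ

/-- `Ψ` is the flag `Φ^i`: it differs from `Φ` in exactly the rank-`i` element
(with respect to the rank function `rk`). -/
def IsIAdjacent (rk : α → ℤ) (i : ℤ) (Φ Ψ : Flag α) : Prop :=
  Φ ≠ Ψ ∧ ∀ x : α, rk x ≠ i → (x ∈ Φ ↔ x ∈ Ψ)

/-- A two-orbit polytope (with rank function `rk`, adjacency indices `0, …, n-1`)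
is in class `2_I` if, for every flag `Φ` and every `i < n`, the `i`-adjacent flag `Φ^i`
lies in the same orbit as `Φ` exactly when `i ∈ I`. -/
def InClass (rk : α → ℤ) (n : ℕ) (I : Set ℕ) : Prop :=
  TwoFlagOrbits α ∧
    ∀ (Φ Ψ : Flag α) (i : ℕ), i < n → IsIAdjacent rk i Φ Ψ →
      (SameFlagOrbit Φ Ψ ↔ i ∈ I)

/-- An abstract polytope of rank `d`: a bounded poset, graded by a rank function `rk`
taking values `-1, 0, …, d`, in which every flag (maximal chain) has exactly one element
of each rank, satisfying the diamond condition and strong flag-connectivity. -/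
structure IsAbstractPolytope (α : Type*) [PartialOrder α] [BoundedOrder α]
    (rk : α → ℤ) (d : ℕ) : Prop where
  rk_bot : rk ⊥ = -1
  rk_top : rk ⊤ = d
  rk_strictMono : StrictMono rk
  rk_cover : ∀ x y : α, x ⋖ y → rk y = rk x + 1
  flag_ranks : ∀ (Φ : Flag α) (i : ℤ), -1 ≤ i → i ≤ d → ∃! x, x ∈ Φ ∧ rk x = i
  diamond : ∀ x y : α, x < y → rk y = rk x + 2 →
    ∃ a b : α, a ≠ b ∧ ∀ z : α, (x < z ∧ z < y) ↔ (z = a ∨ z = b)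
  connected : ∀ Φ Ψ : Flag α, ∃ (n : ℕ) (c : Fin (n + 1) → Flag α),
    c 0 = Φ ∧ c (Fin.last n) = Ψ ∧
    (∀ k : Fin n, ∃ i : ℤ, IsIAdjacent rk i (c k.castSucc) (c k.succ)) ∧
    (∀ k, (Φ : Set α) ∩ (Ψ : Set α) ⊆ (c k : Set α))
/-! Definitions about convex polytopes and their face lattices. -/

/-- Euclidean `d`-space. -/
abbrev EucSp (d : ℕ) : Type := EuclideanSpace ℝ (Fin d)

/-- A convex `d`-polytope: the convex hull of a finite set of points of `ℝ^d`,
with nonempty interior. -/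
def IsConvexPolytope {d : ℕ} (P : Set (EucSp d)) : Prop :=
  (∃ S : Finset (EucSp d), P = convexHull ℝ (S : Set (EucSp d))) ∧ (interior P).Nonempty

/-- The face lattice of `P`: the exposed faces of `P` (intersections of `P` with supporting
hyperplanes, together with `∅` and `P` itself), ordered by inclusion. -/
def Faces {d : ℕ} (P : Set (EucSp d)) : Type := {F : Set (EucSp d) // IsExposed ℝ P F}

noncomputable instance {d : ℕ} (P : Set (EucSp d)) : PartialOrder (Faces P) :=
  Subtype.partialOrder _

open scoped Classical

/-- The rank of a face: `-1` for the empty face, and otherwise its affine dimension. -/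
noncomputable def faceRank {d : ℕ} {P : Set (EucSp d)} (F : Faces P) : ℤ :=
  if F.1 = ∅ then -1
  else (Module.finrank ℝ (affineSpan ℝ F.1).direction : ℤ)
/-! Definitions about locally finite face-to-face tilings of Euclidean space by convex
polytopes (LFC tilings) and their face posets. -/

/-- An LFC tiling of `ℝ^d`: a face-to-face, locally finite tiling of `ℝ^d` by convex
`d`-polytopes. -/
structure IsLFCTiling {d : ℕ} (T : Set (Set (EucSp d))) : Prop where
  /-- Every tile is a convex `d`-polytope. -/
  polytope : ∀ t ∈ T, IsConvexPolytope t
  /-- The tiles cover all of `ℝ^d`. -/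
  covers : ⋃₀ T = Set.univ
  /-- The tiling is face-to-face: the intersection of any two tiles is a
  (possibly empty) face of each. -/
  face_to_face : ∀ t ∈ T, ∀ s ∈ T, IsExposed ℝ t (t ∩ s) ∧ IsExposed ℝ s (t ∩ s)
  /-- The tiling is locally finite: every bounded set meets only finitely many tiles. -/
  locally_finite : ∀ B : Set (EucSp d), Bornology.IsBounded B →
    {t ∈ T | (t ∩ B).Nonempty}.Finite

/-- The faces of the tiling `T`: all faces of all tiles (the empty face included). -/
def TFace {d : ℕ} (T : Set (Set (EucSp d))) : Type :=
  {F : Set (EucSp d) // ∃ t ∈ T, IsExposed ℝ t F}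

noncomputable instance {d : ℕ} (T : Set (Set (EucSp d))) : PartialOrder (TFace T) :=
  Subtype.partialOrder _

/-- The face poset of the tiling `T`: all faces of all tiles, together with a greatest
element, ordered by inclusion.  It is an abstract polytope of rank `d + 1`. -/
abbrev TPoset {d : ℕ} (T : Set (Set (EucSp d))) : Type := WithTop (TFace T)

/-- The rank of a subset of `ℝ^d` regarded as a face: `-1` for the empty face, and
otherwise its affine dimension. -/
noncomputable def setRank {d : ℕ} (F : Set (EucSp d)) : ℤ :=
  if F = ∅ then -1 else (Module.finrank ℝ (affineSpan ℝ F).direction : ℤ)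

/-- The rank function of the face poset of a tiling of `ℝ^d`: faces get their affine
dimension (`-1` for the empty face), and the greatest element gets rank `d + 1`. -/
noncomputable def tileRank {d : ℕ} (T : Set (Set (EucSp d))) : TPoset T → ℤ :=
  WithTop.recTopCoe ((d : ℤ) + 1) (fun F => setRank F.1)

/-- A tiling is normal if its tiles are uniformly bounded: for some `u, U > 0`, every tile
contains a ball of radius `u` and is contained in a ball of radius `U`. -/
def IsNormalTiling {d : ℕ} (T : Set (Set (EucSp d))) : Prop :=
  ∃ u U : ℝ, 0 < u ∧ 0 < U ∧ ∀ t ∈ T,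
    (∃ x, Metric.closedBall x u ⊆ t) ∧ (∃ x, t ⊆ Metric.closedBall x U)
/-! The tetrahedral–octahedral honeycomb and the rhombic dodecahedral honeycomb. -/

/-- The point `(a, b, c)` of Euclidean 3-space. -/
noncomputable def pt3 (a b c : ℝ) : EucSp 3 := (WithLp.equiv 2 (Fin 3 → ℝ)).symm ![a, b, c]

/-- The face-centered cubic lattice `D₃`: integer points with even coordinate sum. -/
def fccLattice : Set (EucSp 3) :=
  {x | ∃ a b c : ℤ, x = pt3 (a : ℝ) (b : ℝ) (c : ℝ) ∧ Even (a + b + c)}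

/-- The Voronoi cell of a point `p` of the lattice `D₃`: the points of space at least as
close to `p` as to every lattice point. -/
def voronoiCell (p : EucSp 3) : Set (EucSp 3) :=
  {x | ∀ q ∈ fccLattice, dist x p ≤ dist x q}

/-- The set of lattice points of `D₃` nearest to a given point `c`. -/
def nearestLatticePts (c : EucSp 3) : Set (EucSp 3) :=
  {p ∈ fccLattice | ∀ q ∈ fccLattice, dist c p ≤ dist c q}

/-- The rhombic dodecahedral honeycomb: the Voronoi tessellation of `ℝ³` with respect to
the face-centered cubic lattice `D₃`. -/
def RhombicDodecahedralHoneycomb : Set (Set (EucSp 3)) :=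
  {t | ∃ p ∈ fccLattice, t = voronoiCell p}

/-- The tetrahedral–octahedral honeycomb: the Delaunay tessellation of `ℝ³` with respect to
the face-centered cubic lattice `D₃`; its tiles are the convex hulls of the sets of nearest
lattice points of the points of `ℝ³` for which this hull is full-dimensional. -/
noncomputable def TetrahedralOctahedralHoneycomb : Set (Set (EucSp 3)) :=
  {t | ∃ c : EucSp 3, affineSpan ℝ (nearestLatticePts c) = ⊤ ∧
    t = convexHull ℝ (nearestLatticePts c)}

open scoped Classical

/-! ## Geometric realizations of incidence geometries -/

/-- Euclidean three-space. -/
abbrev E3 : Type := EucSp 3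

/-- Open simplex spanned by the points `b p`, `p ∈ s`. -/
def osimp {P : Type*} (b : P → E3) (s : Finset P) : Set E3 :=
  {y | ∃ w : P → ℝ, (∀ p ∈ s, 0 < w p) ∧ ∑ p ∈ s, w p = 1 ∧ y = ∑ p ∈ s, w p • b p}

/-- A rank four incidence geometry whose flag complex is realized as a locally finite
simplicial decomposition of Euclidean three-space. -/
structure Geo (P : Type*) where
  rk : P → Fin 4
  inc : P → P → Prop
  inc_refl : ∀ p, inc p p
  inc_symm : ∀ p q, inc p q → inc q p
  inc_eq : ∀ p q, inc p q → rk p = rk q → p = q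
  inc_trans : ∀ p q r, inc p q → inc q r → rk p < rk q → rk q < rk r → inc p r
  b : P → E3
  cover : ∀ y, ∃ s : Finset P, (∀ p ∈ s, ∀ q ∈ s, inc p q) ∧ y ∈ osimp b s
  uniq : ∀ y, ∀ s t : Finset P, (∀ p ∈ s, ∀ q ∈ s, inc p q) → (∀ p ∈ t, ∀ q ∈ t, inc p q) →
    y ∈ osimp b s → y ∈ osimp b t → s = t
  locfin : ∀ y, ∃ ε > 0, {s : Finset P | (∀ p ∈ s, ∀ q ∈ s, inc p q) ∧
    (osimp b s ∩ Metric.ball y ε).Nonempty}.Finite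
  nobf : ∀ p p' q q', rk p = rk p' → rk q = rk q' → p ≠ p' → q ≠ q' → rk p < rk q →
    (rk q : ℕ) = rk p + 1 → inc p q → inc p q' → inc p' q → inc p' q' → False

namespace Geo
variable {P : Type*} (G : Geo P)

/-- Chains of the geometry. -/
def IsCh (s : Finset P) : Prop := ∀ p ∈ s, ∀ q ∈ s, G.inc p q

theorem IsCh.mono {G : Geo P} {s t : Finset P} (h : G.IsCh t) (hst : s ⊆ t) : G.IsCh s :=
  fun p hp q hq => h p (hst hp) q (hst hq)

/-- The carrier chain of a point. -/
noncomputable def ch (y : E3) : Finset P := (G.cover y).choose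

theorem ch_isCh (y : E3) : G.IsCh (G.ch y) := (G.cover y).choose_spec.1

theorem mem_osimp_ch (y : E3) : y ∈ osimp G.b (G.ch y) := (G.cover y).choose_spec.2

theorem ch_eq {y : E3} {s : Finset P} (hs : G.IsCh s) (hy : y ∈ osimp G.b s) : G.ch y = s :=
  G.uniq y _ _ (G.ch_isCh y) hs (G.mem_osimp_ch y) hy

theorem ch_nonempty (y : E3) : (G.ch y).Nonempty := by
  obtain ⟨w, -, h1, -⟩ := G.mem_osimp_ch y
  by_contra h
  rw [Finset.not_nonempty_iff_eq_empty] at h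
  rw [h] at h1
  simp at h1

theorem card_le {s : Finset P} (hs : G.IsCh s) : s.card ≤ 4 := by
  have := Finset.card_le_card_of_injOn (s := s) (t := (Finset.univ : Finset (Fin 4))) G.rk
    (fun _ _ => Finset.mem_univ _) (fun p hp q hq h => G.inc_eq p q (hs p hp q hq) h)
  simpa using this

/-- The closed simplex is compact, described by nonnegative weights. -/
theorem mem_convexHull_iff (b : P → E3) (s : Finset P) (y : E3) :
    y ∈ convexHull ℝ (b '' s) ↔ ∃ w : P → ℝ, (∀ p ∈ s, 0 ≤ w p) ∧ ∑ p ∈ s, w p = 1 ∧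
      y = ∑ p ∈ s, w p • b p := by
  constructor
  · intro hy
    have hc : Convex ℝ {y : E3 | ∃ w : P → ℝ, (∀ p ∈ s, 0 ≤ w p) ∧ ∑ p ∈ s, w p = 1 ∧
      y = ∑ p ∈ s, w p • b p} := by
      rintro x ⟨w, hw0, hw1, rfl⟩ z ⟨w', hw0', hw1', rfl⟩ a c ha hc hac
      refine ⟨fun p => a * w p + c * w' p, fun p hp => ?_, ?_, ?_⟩
      · have := hw0 p hp
        have := hw0' p hp
        positivity
      · rw [Finset.sum_add_distrib, ← Finset.mul_sum, ← Finset.mul_sum, hw1, hw1']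
        linarith
      · simp only [add_smul, Finset.sum_add_distrib, mul_smul, Finset.smul_sum]
    refine convexHull_min ?_ hc hy
    rintro _ ⟨p, hp, rfl⟩
    have hp : p ∈ s := hp
    refine ⟨fun q => if q = p then 1 else 0, fun q _ => by positivity, ?_, ?_⟩
    · simp [hp]
    · simp [hp]
  · rintro ⟨w, h0, h1, rfl⟩
    exact (convex_convexHull ℝ _).sum_mem h0 h1
      (fun p hp => subset_convexHull ℝ _ ⟨p, hp, rfl⟩)

theorem osimp_subset_hull (b : P → E3) (s : Finset P) : osimp b s ⊆ convexHull ℝ (b '' s) := by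
  rintro y ⟨w, h0, h1, rfl⟩
  exact (mem_convexHull_iff b s _).2 ⟨w, fun p hp => (h0 p hp).le, h1, rfl⟩

theorem hull_sub {b : P → E3} {s : Finset P} {y : E3} (hy : y ∈ convexHull ℝ (b '' s)) :
    ∃ t ⊆ s, y ∈ osimp b t := by
  obtain ⟨w, h0, h1, rfl⟩ := (mem_convexHull_iff b s y).1 hy
  refine ⟨s.filter (fun p => w p ≠ 0), Finset.filter_subset _ _, w, ?_, ?_, ?_⟩
  · intro p hp
    rw [Finset.mem_filter] at hp
    exact lt_of_le_of_ne (h0 p hp.1) hp.2.symm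
  · rw [← h1, Finset.sum_filter_ne_zero]
  · rw [Finset.sum_filter]
    refine Finset.sum_congr rfl fun p _ => ?_
    by_cases h : w p = 0 <;> simp [h]

/-- Moving towards an interior point of a bigger simplex. -/
theorem osimp_lineMap {b : P → E3} {s t : Finset P} (hst : s ⊆ t) {y z : E3}
    (hy : y ∈ osimp b s) (hz : z ∈ osimp b t) {a : ℝ} (ha : 0 < a) (ha1 : a ≤ 1) :
    AffineMap.lineMap y z a ∈ osimp b t := by
  obtain ⟨w, h0, h1, rfl⟩ := hy
  obtain ⟨w', h0', h1', rfl⟩ := hz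
  refine ⟨fun p => (1 - a) * (if p ∈ s then w p else 0) + a * w' p, ?_, ?_, ?_⟩
  · intro p hp
    have := h0' p hp
    have h2 : 0 ≤ (if p ∈ s then w p else 0) := by
      split_ifs with h
      · exact (h0 p h).le
      · exact le_rfl
    have : 0 ≤ 1 - a := by linarith
    positivity
  · rw [Finset.sum_add_distrib, ← Finset.mul_sum, ← Finset.mul_sum, h1', ← Finset.sum_filter,
      Finset.filter_mem_eq_inter, Finset.inter_eq_right.2 hst, h1]
    ring
  · rw [AffineMap.lineMap_apply_module]
    simp only [add_smul, Finset.sum_add_distrib, mul_smul, ← Finset.smul_sum, ite_smul, zero_smul]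
    rw [← Finset.sum_filter, Finset.filter_mem_eq_inter, Finset.inter_eq_right.2 hst]

theorem osimp_nonempty (b : P → E3) {s : Finset P} (hs : s.Nonempty) : (osimp b s).Nonempty := by
  have : 0 < (s.card : ℝ) := by exact_mod_cast hs.card_pos
  exact ⟨∑ p ∈ s, (s.card : ℝ)⁻¹ • b p, fun _ => (s.card : ℝ)⁻¹, fun _ _ => by positivity,
    by simp; field_simp, rfl⟩

theorem convex_osimp (b : P → E3) (s : Finset P) : Convex ℝ (osimp b s) := by
  rw [convex_iff_segment_subset]
  intro x hx y hy z hz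
  rw [segment_eq_image_lineMap] at hz
  obtain ⟨a, ⟨ha0, ha1⟩, rfl⟩ := hz
  rcases ha0.eq_or_lt with rfl | h
  · simpa using hx
  · exact osimp_lineMap (Finset.Subset.refl s) hx hy h ha1

/-- Points of `osimp t` arbitrarily close to points of `osimp s`, `s ⊆ t`. -/
theorem osimp_near {b : P → E3} {s t : Finset P} (hst : s ⊆ t) {y : E3} (hy : y ∈ osimp b s)
    {O : Set E3} (hO : O ∈ nhds y) : (osimp b t ∩ O).Nonempty := by
  have hs : s.Nonempty := by
    obtain ⟨w, -, h1, -⟩ := hy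
    by_contra h
    rw [Finset.not_nonempty_iff_eq_empty] at h
    rw [h] at h1
    simp at h1
  obtain ⟨z, hz⟩ := osimp_nonempty b (hs.mono hst)
  have hc : Filter.Tendsto (fun a : ℝ => AffineMap.lineMap y z a) (nhdsWithin 0 (Set.Ioi 0))
      (nhds y) := by
    have : ContinuousAt (fun a : ℝ => (AffineMap.lineMap y z a : E3)) 0 := by
      exact (AffineMap.lineMap_continuous (p := y) (q := z)).continuousAt
    have h := this.tendsto
    simp only [AffineMap.lineMap_apply_zero] at h
    exact h.mono_left nhdsWithin_le_nhds
  have h1 : ∀ᶠ a : ℝ in nhdsWithin 0 (Set.Ioi 0), a ∈ Set.Ioc (0:ℝ) 1 :=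
    Ioc_mem_nhdsGT one_pos
  obtain ⟨a, ha, ha'⟩ := ((hc.eventually hO).and h1).exists
  exact ⟨_, osimp_lineMap hst hy hz ha'.1 ha'.2, ha⟩

/-- Upper semicontinuity of the carrier chain. -/
theorem ch_usc (y : E3) : ∀ᶠ z in nhds y, G.ch y ⊆ G.ch z := by
  obtain ⟨ε, hε, hfin⟩ := G.locfin y
  have h1 : ∀ᶠ z in nhds y, ∀ s ∈ {s : Finset P | (∀ p ∈ s, ∀ q ∈ s, G.inc p q) ∧
    (osimp G.b s ∩ Metric.ball y ε).Nonempty}, y ∉ convexHull ℝ (G.b '' s) →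
      z ∉ convexHull ℝ (G.b '' s) := by
    rw [Filter.eventually_all_finite hfin]
    intro s _
    by_cases hy : y ∈ convexHull ℝ (G.b '' s)
    · exact Filter.Eventually.of_forall fun z h => absurd hy h
    · have hcl : IsClosed (convexHull ℝ (G.b '' s)) :=
        (s.finite_toSet.image _).isClosed_convexHull ℝ
      filter_upwards [hcl.isOpen_compl.mem_nhds hy] with z hz _ using hz
  filter_upwards [h1, Metric.ball_mem_nhds y hε] with z hz hzb
  have hm := G.mem_osimp_ch z
  have h2 := hz (G.ch z) ⟨G.ch_isCh z, ⟨z, hm, hzb⟩⟩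
  have h3 : y ∈ convexHull ℝ (G.b '' (G.ch z)) := by
    by_contra h
    exact h2 h (osimp_subset_hull _ _ hm)
  obtain ⟨t, ht, hyt⟩ := hull_sub h3
  rw [G.ch_eq ((G.ch_isCh z).mono ht) hyt]
  exact ht

/-- A nonzero functional constant on the image of at most three points. -/
theorem exists_const_functional (b : P → E3) (s : Finset P) (hs : s.card ≤ 3) (hne : s.Nonempty) :
    ∃ (l : E3 →L[ℝ] ℝ) (a : ℝ), l ≠ 0 ∧ ∀ p ∈ s, l (b p) = a := by
  obtain ⟨p0, hp0⟩ := hne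
  let W : Submodule ℝ E3 := Submodule.span ℝ (((s.erase p0).image (fun p => b p - b p0) : Finset E3) : Set E3)
  have hW : W ≠ ⊤ := by
    intro h
    have h1 := finrank_span_finset_le_card (R := ℝ) ((s.erase p0).image (fun p => b p - b p0))
    have h2 : Module.finrank ℝ W = 3 := by
      rw [h, finrank_top]; simp
    have h3 : Module.finrank ℝ W ≤ ((s.erase p0).image (fun p => b p - b p0)).card := h1
    have h4 := Finset.card_image_le (s := s.erase p0) (f := fun p => b p - b p0)
    rw [Finset.card_erase_of_mem hp0] at h4
    omega
  obtain ⟨f, hf, hfW⟩ := Submodule.exists_le_ker_of_lt_top W (lt_top_iff_ne_top.2 hW)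
  refine ⟨LinearMap.toContinuousLinearMap f, f (b p0), ?_, ?_⟩
  · intro h
    apply hf
    ext x
    have := congrArg (fun g : E3 →L[ℝ] ℝ => g x) h
    simpa using this
  · intro p hp
    by_cases hpp : p = p0
    · simp [hpp]
    · have : b p - b p0 ∈ W := Submodule.subset_span (by
        simp only [Finset.coe_image, Set.mem_image, Finset.mem_coe]
        exact ⟨p, Finset.mem_erase.2 ⟨hpp, hp⟩, rfl⟩)
      have h := hfW this
      rw [LinearMap.mem_ker, map_sub, sub_eq_zero] at h
      simpa using h

theorem osimp_functional {b : P → E3} {s : Finset P} {l : E3 →L[ℝ] ℝ} {a : ℝ}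
    (h : ∀ p ∈ s, l (b p) = a) {y : E3} (hy : y ∈ osimp b s) : l y = a := by
  obtain ⟨w, h0, h1, rfl⟩ := hy
  rw [map_sum]
  have : ∀ p ∈ s, l (w p • b p) = w p * a := fun p hp => by rw [map_smul, h p hp]; rfl
  rw [Finset.sum_congr rfl this, ← Finset.sum_mul, h1, one_mul]

/-- A set which lies in a hyperplane is not a neighbourhood. -/
theorem not_nhds_of_functional {l : E3 →L[ℝ] ℝ} (hl : l ≠ 0) {a : ℝ} {O : Set E3} {y : E3}
    (hO : O ∈ nhds y) (h : ∀ z ∈ O, l z = a) : False := by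
  obtain ⟨v, hv⟩ : ∃ v, l v ≠ 0 := by
    by_contra hcon
    push Not at hcon
    exact hl (by ext x; simp [hcon x])
  have hc : Filter.Tendsto (fun t : ℝ => y + t • v) (nhdsWithin 0 (Set.Ioi 0)) (nhds y) := by
    have : ContinuousAt (fun t : ℝ => y + t • v) 0 := by fun_prop
    have h := this.tendsto
    simp only [zero_smul, add_zero] at h
    exact h.mono_left nhdsWithin_le_nhds
  obtain ⟨t, ht, ht0⟩ := ((hc.eventually hO).and self_mem_nhdsWithin).exists
  have h1 := h _ ht
  have h2 := h y (mem_of_mem_nhds hO)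
  rw [map_add, map_smul, h2, smul_eq_mul] at h1
  have : t * l v = 0 := by linarith
  rcases mul_eq_zero.1 this with h | h
  · exact absurd h (ne_of_gt ht0)
  · exact hv h

/-- Any chain extends to a chain with four elements. -/
theorem exists_ext {s : Finset P} (hs : G.IsCh s) : ∃ t, s ⊆ t ∧ G.IsCh t ∧ t.card = 4 := by
  by_contra hcon
  push Not at hcon
  obtain ⟨t, ⟨hst, ht⟩, hmax⟩ : ∃ t, (s ⊆ t ∧ G.IsCh t) ∧ ∀ u, s ⊆ u ∧ G.IsCh u → u.card ≤ t.card := by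
    have hex : ∃ n, ∃ t, (s ⊆ t ∧ G.IsCh t) ∧ 4 - t.card = n := ⟨_, s, ⟨Finset.Subset.refl _, hs⟩, rfl⟩
    obtain ⟨t, ht, htn⟩ := Nat.find_spec hex
    refine ⟨t, ht, fun u hu => ?_⟩
    have h1 := Nat.find_min' hex ⟨u, hu, rfl⟩
    have := G.card_le hu.2
    have := G.card_le ht.2
    omega
  have hc := hcon t hst ht
  have hc4 := G.card_le ht
  have hopen : ∀ y ∈ osimp G.b t, osimp G.b t ∈ nhds y := by
    intro y hy
    filter_upwards [G.ch_usc y] with z hz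
    rw [G.ch_eq ht hy] at hz
    have := hmax (G.ch z) ⟨hst.trans hz, G.ch_isCh z⟩
    rw [Finset.eq_of_subset_of_card_le hz this]
    exact G.mem_osimp_ch z
  rcases t.eq_empty_or_nonempty with rfl | hne
  · obtain ⟨p, hp⟩ := G.ch_nonempty 0
    have := hmax {p} ⟨hst.trans (Finset.empty_subset _), fun q hq r hr => by
      rw [Finset.mem_singleton] at hq hr; rw [hq, hr]; exact G.inc_refl _⟩
    simp at this
  · obtain ⟨l, a, hl, hla⟩ := exists_const_functional G.b t (by omega) hne
    obtain ⟨y, hy⟩ := osimp_nonempty G.b hne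
    exact not_nhds_of_functional hl (hopen y hy) fun z hz => osimp_functional hla hz

/-- Open simplices of maximal chains are open. -/
theorem isOpen_osimp {t : Finset P} (ht : G.IsCh t) (h4 : t.card = 4) : IsOpen (osimp G.b t) := by
  rw [isOpen_iff_mem_nhds]
  intro y hy
  filter_upwards [G.ch_usc y] with z hz
  rw [G.ch_eq ht hy] at hz
  have := G.card_le (G.ch_isCh z)
  rw [Finset.eq_of_subset_of_card_le hz (by omega)]
  exact G.mem_osimp_ch z

end Geo

open scoped Classical

/-! ## Chambers -/

/-- A locally constant function on a preconnected set is constant. -/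
theorem const_of_preconn {X α : Type*} [TopologicalSpace X] {s : Set X} (hs : IsPreconnected s)
    (f : X → α) (h : ∀ x ∈ s, ∀ᶠ z in nhdsWithin x s, f z = f x) {x y : X} (hx : x ∈ s)
    (hy : y ∈ s) : f x = f y := by
  let _ : TopologicalSpace α := ⊥
  have : DiscreteTopology α := ⟨rfl⟩
  refine hs.constant (f := f) ?_ hx hy
  intro z hz
  unfold ContinuousWithinAt
  rw [nhds_discrete, Filter.tendsto_pure]
  exact h z hz

namespace Geo
variable {P : Type*} (G : Geo P)

/-- Chambers: maximal flags listed by rank. -/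
def Cham : Type _ := {φ : Fin 4 → P // (∀ i, G.rk (φ i) = i) ∧ ∀ i j, G.inc (φ i) (φ j)}

variable {G}

theorem Cham.rk (Φ : G.Cham) (i : Fin 4) : G.rk (Φ.1 i) = i := Φ.2.1 i

theorem Cham.inc (Φ : G.Cham) (i j : Fin 4) : G.inc (Φ.1 i) (Φ.1 j) := Φ.2.2 i j

theorem Cham.inj (Φ : G.Cham) : Function.Injective Φ.1 := fun i j h => by
  rw [← Φ.rk i, ← Φ.rk j, h]

/-- The underlying chain of a chamber. -/
noncomputable def Cham.fs (Φ : G.Cham) : Finset P := Finset.univ.image Φ.1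

theorem Cham.mem_fs {Φ : G.Cham} {p : P} : p ∈ Φ.fs ↔ Φ.1 (G.rk p) = p := by
  unfold Cham.fs
  rw [Finset.mem_image]
  constructor
  · rintro ⟨i, -, rfl⟩
    rw [Φ.rk]
  · intro h
    exact ⟨_, Finset.mem_univ _, h⟩

theorem Cham.app_mem (Φ : G.Cham) (i : Fin 4) : Φ.1 i ∈ Φ.fs := by
  rw [Cham.mem_fs, Φ.rk]

theorem Cham.isCh (Φ : G.Cham) : G.IsCh Φ.fs := by
  intro p hp q hq
  rw [Cham.mem_fs] at hp hq
  rw [← hp, ← hq]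
  exact Φ.inc _ _

theorem Cham.card_fs (Φ : G.Cham) : Φ.fs.card = 4 := by
  unfold Cham.fs
  rw [Finset.card_image_of_injective _ Φ.inj]
  simp

theorem Cham.ext_fs {Φ Ψ : G.Cham} (h : Φ.fs ⊆ Ψ.fs) : Φ = Ψ := by
  apply Subtype.ext
  funext i
  have := Cham.mem_fs.1 (h (Φ.app_mem i))
  rw [Φ.rk] at this
  exact this.symm

theorem exists_cham {t : Finset P} (ht : G.IsCh t) (h4 : t.card = 4) : ∃ Φ : G.Cham, Φ.fs = t := by
  have hinj : Set.InjOn G.rk t := fun p hp q hq h => G.inc_eq p q (ht p hp q hq) h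
  have himg : t.image G.rk = Finset.univ := by
    rw [← Finset.card_eq_iff_eq_univ, Finset.card_image_of_injOn hinj, h4]
    simp
  have hex : ∀ i : Fin 4, ∃ p ∈ t, G.rk p = i := by
    intro i
    have : i ∈ t.image G.rk := by rw [himg]; exact Finset.mem_univ _
    simpa using this
  choose φ hφ hrk using hex
  have hin : ∀ i j, G.inc (φ i) (φ j) := fun i j => ht _ (hφ i) _ (hφ j)
  obtain ⟨Φ, hΦ⟩ : ∃ Φ : G.Cham, Φ.1 = φ := ⟨⟨φ, hrk, hin⟩, rfl⟩
  refine ⟨Φ, ?_⟩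
  ext p
  rw [Cham.mem_fs, hΦ]
  constructor
  · intro h
    rw [← h]
    exact hφ _
  · intro h
    exact hinj (hφ _) h (hrk _)

/-- Every chain lies in a chamber. -/
theorem exists_cham_ge {s : Finset P} (hs : G.IsCh s) : ∃ Φ : G.Cham, s ⊆ Φ.fs := by
  obtain ⟨t, hst, ht, h4⟩ := G.exists_ext hs
  obtain ⟨Φ, rfl⟩ := exists_cham ht h4
  exact ⟨Φ, hst⟩

theorem ch_eq_cham_const {H : Set E3} (hH : IsPreconnected H) (h4 : ∀ z ∈ H, (G.ch z).card = 4)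
    {x y : E3} (hx : x ∈ H) (hy : y ∈ H) : G.ch x = G.ch y := by
  refine const_of_preconn hH G.ch ?_ hx hy
  intro z hz
  apply Filter.Eventually.filter_mono nhdsWithin_le_nhds
  filter_upwards [(G.isOpen_osimp (G.ch_isCh z) (h4 z hz)).mem_nhds (G.mem_osimp_ch z)] with w hw
  exact G.ch_eq (G.ch_isCh z) hw

/-- A nonempty open set contains a point off any hyperplane. -/
theorem exists_off {l : E3 →L[ℝ] ℝ} (hl : l ≠ 0) (a : ℝ) {O : Set E3} (hO : IsOpen O)
    (hne : O.Nonempty) : ∃ z ∈ O, l z ≠ a := by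
  by_contra h
  push Not at h
  obtain ⟨y, hy⟩ := hne
  exact not_nhds_of_functional hl (hO.mem_nhds hy) h

/-- The diamond condition: a chain of three elements lies in exactly two chambers. -/
theorem diamond {c : Finset P} (hc : G.IsCh c) (h3 : c.card = 3) :
    ∃ Φ Ψ : G.Cham, Φ ≠ Ψ ∧ c ⊆ Φ.fs ∧ c ⊆ Ψ.fs ∧ ∀ Ω : G.Cham, c ⊆ Ω.fs → Ω = Φ ∨ Ω = Ψ := by
  have hne : c.Nonempty := by rw [← Finset.card_pos]; omega
  obtain ⟨l, a, hl, hla⟩ := exists_const_functional G.b c h3.le hne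
  obtain ⟨y, hy⟩ := osimp_nonempty G.b hne
  have hly : l y = a := osimp_functional hla hy
  have hcy := G.ch_eq hc hy
  obtain ⟨ε, hε, hball⟩ := Metric.eventually_nhds_iff_ball.1 (G.ch_usc y)
  rw [hcy] at hball
  have h4 : ∀ z ∈ Metric.ball y ε, l z ≠ a → (G.ch z).card = 4 := by
    intro z hz hza
    have h1 := hball z hz
    have h2 := G.card_le (G.ch_isCh z)
    have h5 := Finset.card_le_card h1
    by_contra hcon
    have : c = G.ch z := Finset.eq_of_subset_of_card_le h1 (by omega)
    exact hza (osimp_functional (this ▸ hla) (G.mem_osimp_ch z))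
  obtain ⟨v, hv⟩ : ∃ v, 0 < l v := by
    by_contra hcon
    push Not at hcon
    apply hl
    ext x
    have h1 := hcon x
    have h2 := hcon (-x)
    rw [map_neg] at h2
    simp
    linarith
  have hvn : 0 < ‖v‖ := by
    rw [norm_pos_iff]
    rintro rfl
    simp at hv
  set w : E3 := (ε / (2 * ‖v‖)) • v with hw
  have hwl : 0 < l w := by
    rw [hw, map_smul, smul_eq_mul]
    positivity
  have hwn : ‖w‖ < ε := by
    rw [hw, norm_smul, Real.norm_of_nonneg (by positivity)]
    field_simp
    linarith
  have hp : y + w ∈ Metric.ball y ε := by simpa [Metric.mem_ball, dist_eq_norm] using hwn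
  have hm : y - w ∈ Metric.ball y ε := by simpa [Metric.mem_ball, dist_eq_norm] using hwn
  have hpl : a < l (y + w) := by rw [map_add, hly]; linarith
  have hml : l (y - w) < a := by rw [map_sub, hly]; linarith
  obtain ⟨Φ, hΦ⟩ := exists_cham (G.ch_isCh _) (h4 _ hp (ne_of_gt hpl))
  obtain ⟨Ψ, hΨ⟩ := exists_cham (G.ch_isCh _) (h4 _ hm (ne_of_lt hml))
  refine ⟨Φ, Ψ, ?_, ?_, ?_, ?_⟩
  · rintro rfl
    have h1 : y + w ∈ osimp G.b Φ.fs := hΦ ▸ G.mem_osimp_ch _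
    have h2 : y - w ∈ osimp G.b Φ.fs := hΨ ▸ G.mem_osimp_ch _
    have h5 := (convex_osimp G.b Φ.fs) h1 h2 (a := 1/2) (b := 1/2) (by norm_num) (by norm_num)
      (by norm_num)
    have h6 : (1/2 : ℝ) • (y + w) + (1/2 : ℝ) • (y - w) = y := by
      rw [← smul_add]
      have : y + w + (y - w) = (2:ℝ) • y := by rw [two_smul]; abel
      rw [this, smul_smul]; norm_num
    rw [h6] at h5
    have h7 := G.ch_eq Φ.isCh h5
    have h8 := Φ.card_fs
    rw [← h7, hcy] at h8
    omega
  · rw [hΦ]; exact hball _ hp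
  · rw [hΨ]; exact hball _ hm
  · intro Ω hΩ
    have hO : (osimp G.b Ω.fs ∩ Metric.ball y ε).Nonempty :=
      osimp_near hΩ hy (Metric.ball_mem_nhds y hε)
    obtain ⟨z, ⟨hz1, hz2⟩, hz3⟩ := exists_off hl a
      ((G.isOpen_osimp Ω.isCh Ω.card_fs).inter Metric.isOpen_ball) hO
    have hzΩ := G.ch_eq Ω.isCh hz1
    rcases lt_or_gt_of_ne hz3 with hlt | hgt
    · right
      have hpre : IsPreconnected (Metric.ball y ε ∩ {z | l z < a}) :=
        ((convex_ball y ε).inter (convex_halfSpace_lt l.isLinear a)).isPreconnected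
      have := ch_eq_cham_const (G := G) hpre (fun z hz => h4 z hz.1 (ne_of_lt hz.2)) ⟨hz2, hlt⟩ ⟨hm, hml⟩
      apply Cham.ext_fs
      rw [← hzΩ, this, hΨ]
    · left
      have hpre : IsPreconnected (Metric.ball y ε ∩ {z | a < l z}) :=
        ((convex_ball y ε).inter (convex_halfSpace_gt l.isLinear a)).isPreconnected
      have := ch_eq_cham_const (G := G) hpre (fun z hz => h4 z hz.1 (ne_of_gt hz.2)) ⟨hz2, hgt⟩ ⟨hp, hpl⟩
      apply Cham.ext_fs
      rw [← hzΩ, this, hΦ]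

/-- Agreement off colour `i`. -/
theorem adj_iff {Φ Ψ : G.Cham} {i : Fin 4} :
    Φ.fs.erase (Φ.1 i) ⊆ Ψ.fs ↔ ∀ j, j ≠ i → Ψ.1 j = Φ.1 j := by
  constructor
  · intro h j hj
    have h1 : Φ.1 j ∈ Φ.fs.erase (Φ.1 i) :=
      Finset.mem_erase.2 ⟨fun h => hj (Φ.inj h), Φ.app_mem j⟩
    have := Cham.mem_fs.1 (h h1)
    rwa [Φ.rk] at this
  · intro h p hp
    rw [Finset.mem_erase] at hp
    have h1 := Cham.mem_fs.1 hp.2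
    have h2 : G.rk p ≠ i := by
      rintro rfl
      exact hp.1 h1.symm
    rw [Cham.mem_fs, h _ h2, h1]

theorem exists_adj (Φ : G.Cham) (i : Fin 4) :
    ∃ Ψ : G.Cham, Ψ ≠ Φ ∧ (∀ j, j ≠ i → Ψ.1 j = Φ.1 j) ∧
      ∀ Ω : G.Cham, (∀ j, j ≠ i → Ω.1 j = Φ.1 j) → Ω = Φ ∨ Ω = Ψ := by
  have h3 : (Φ.fs.erase (Φ.1 i)).card = 3 := by
    rw [Finset.card_erase_of_mem (Φ.app_mem i), Φ.card_fs]
  obtain ⟨A, B, hAB, hA, hB, hall⟩ := diamond (Φ.isCh.mono (Finset.erase_subset _ _)) h3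
  rcases hall Φ (Finset.erase_subset _ _) with h | h
  · refine ⟨B, fun h' => hAB (h ▸ h'.symm), adj_iff.1 hB, fun Ω hΩ => ?_⟩
    rcases hall Ω (adj_iff.2 hΩ) with h' | h'
    · left; rw [h', h]
    · right; exact h'
  · refine ⟨A, fun h' => hAB (h ▸ h'), adj_iff.1 hA, fun Ω hΩ => ?_⟩
    rcases hall Ω (adj_iff.2 hΩ) with h' | h'
    · right; exact h'
    · left; rw [h', h]

/-- The adjacent chamber. -/
noncomputable def adj (i : Fin 4) (Φ : G.Cham) : G.Cham := (exists_adj Φ i).choose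

theorem adj_ne (i : Fin 4) (Φ : G.Cham) : adj i Φ ≠ Φ := (exists_adj Φ i).choose_spec.1

theorem adj_app {i j : Fin 4} (h : j ≠ i) (Φ : G.Cham) : (adj i Φ).1 j = Φ.1 j :=
  (exists_adj Φ i).choose_spec.2.1 j h

theorem adj_unique {i : Fin 4} {Φ Ω : G.Cham} (h : ∀ j, j ≠ i → Ω.1 j = Φ.1 j) (hne : Ω ≠ Φ) :
    Ω = adj i Φ := by
  rcases (exists_adj Φ i).choose_spec.2.2 Ω h with h | h
  · exact absurd h hne
  · exact h

theorem adj_adj (i : Fin 4) (Φ : G.Cham) : adj i (adj i Φ) = Φ :=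
  (adj_unique (fun _ hj => (adj_app hj Φ).symm) (adj_ne i Φ).symm).symm

theorem adj_app_self_ne (i : Fin 4) (Φ : G.Cham) : (adj i Φ).1 i ≠ Φ.1 i := by
  intro h
  apply adj_ne i Φ
  apply Subtype.ext
  funext j
  by_cases hj : j = i
  · rw [hj, h]
  · exact adj_app hj Φ

/-- The colour involutions. -/
noncomputable def ρ (i : Fin 4) : Equiv.Perm G.Cham := ⟨adj i, adj i, adj_adj i, adj_adj i⟩

@[simp] theorem ρ_ρ (i : Fin 4) (Φ : G.Cham) : ρ i (ρ i Φ) = Φ := adj_adj i Φ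

theorem ρ_ne (i : Fin 4) (Φ : G.Cham) : ρ i Φ ≠ Φ := adj_ne i Φ

theorem ρ_app {i j : Fin 4} (h : j ≠ i) (Φ : G.Cham) : (ρ i Φ).1 j = Φ.1 j := adj_app h Φ

theorem ρ_app_self_ne (i : Fin 4) (Φ : G.Cham) : (ρ i Φ).1 i ≠ Φ.1 i := adj_app_self_ne i Φ

theorem ρ_unique {i : Fin 4} {Φ Ω : G.Cham} (h : ∀ j, j ≠ i → Ω.1 j = Φ.1 j) (hne : Ω ≠ Φ) :
    Ω = ρ i Φ := adj_unique h hne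

theorem ρ_unique' {i : Fin 4} {Φ Ω : G.Cham} (h : ∀ j, j ≠ i → Ω.1 j = Φ.1 j) :
    Ω = Φ ∨ Ω = ρ i Φ := by
  by_cases hne : Ω = Φ
  · exact Or.inl hne
  · exact Or.inr (ρ_unique h hne)

/-- Build a chamber by replacing one entry. -/
noncomputable def Cham.upd (Φ : G.Cham) (q : P) (hq : ∀ j, j ≠ G.rk q → G.inc q (Φ.1 j)) : G.Cham :=
  ⟨Function.update Φ.1 (G.rk q) q, by
    intro i
    by_cases h : i = G.rk q
    · subst h; simp
    · rw [Function.update_of_ne h, Φ.rk], by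
    intro i j
    by_cases h : i = G.rk q
    · by_cases h' : j = G.rk q
      · rw [h, h']; exact G.inc_refl _
      · rw [h, Function.update_self, Function.update_of_ne h']
        exact hq j h'
    · by_cases h' : j = G.rk q
      · rw [h', Function.update_self, Function.update_of_ne h]
        exact G.inc_symm _ _ (hq i h)
      · rw [Function.update_of_ne h, Function.update_of_ne h']
        exact Φ.inc _ _⟩

/-- Two distinct elements of the same rank incident to the rest of a chamber. -/
theorem eq_or_eq_of_inc (Φ : G.Cham) (q : P) (hq : ∀ j, j ≠ G.rk q → G.inc q (Φ.1 j)) :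
    q = Φ.1 (G.rk q) ∨ q = (ρ (G.rk q) Φ).1 (G.rk q) := by
  rcases ρ_unique' (i := G.rk q) (Φ := Φ) (Ω := Φ.upd q hq)
    (fun j hj => by simp [Cham.upd, Function.update_of_ne hj]) with h | h
  · left
    rw [← h]; simp [Cham.upd]
  · right
    rw [← h]; simp [Cham.upd]

/-- Colours at distance at least two commute. -/
theorem ρ_comm {i j : Fin 4} (h : (i : ℕ) + 2 ≤ j) (Φ : G.Cham) : ρ i (ρ j Φ) = ρ j (ρ i Φ) := by
  have hij : i ≠ j := by rintro rfl; omega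
  symm
  apply ρ_unique
  swap
  · intro he
    have h1 : (ρ j (ρ i Φ)).1 i = (ρ j Φ).1 i := by rw [he]
    rw [ρ_app hij, ρ_app hij] at h1
    exact ρ_app_self_ne i Φ h1
  intro k hk
  by_cases hkj : k = j
  swap
  · rw [ρ_app hkj, ρ_app hk, ρ_app hkj]
  subst hkj
  -- the element `(ρ j Φ).1 j` is incident to `(ρ i Φ).1 i`
  set q := (ρ k Φ).1 k with hq
  have hqk : G.rk q = k := Cham.rk _ _
  have hinc : ∀ m, m ≠ G.rk q → G.inc q ((ρ i Φ).1 m) := by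
    intro m hm
    rw [hqk] at hm
    by_cases hmi : m = i
    · subst hmi
      obtain ⟨n, hn1, hn2⟩ : ∃ n : Fin 4, m < n ∧ n < k := by
        refine ⟨⟨m + 1, by omega⟩, ?_, ?_⟩
        · rw [Fin.lt_def]; simp
        · rw [Fin.lt_def]; simp; omega
      have h1 : G.inc ((ρ m Φ).1 m) ((ρ m Φ).1 n) := Cham.inc _ _ _
      have h2 : G.inc ((ρ k Φ).1 n) q := Cham.inc _ _ _
      rw [ρ_app (ne_of_gt hn1)] at h1
      rw [ρ_app (ne_of_lt hn2)] at h2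
      refine G.inc_symm _ _ (G.inc_trans _ _ _ h1 h2 ?_ ?_)
      · rw [Cham.rk, Cham.rk]; exact hn1
      · rw [Cham.rk, hqk]; exact hn2
    · rw [ρ_app hmi, ← ρ_app hm]
      exact Cham.inc _ _ _
  rcases eq_or_eq_of_inc _ q hinc with h1 | h1
  · rw [hqk, ρ_app hij.symm] at h1
    exact absurd h1 (ρ_app_self_ne k Φ)
  · rw [hqk] at h1
    exact h1.symm

end Geo

open scoped Classical
namespace Geo
variable {P : Type*} {G : Geo P}

theorem singleton_isCh (p : P) : G.IsCh {p} := by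
  intro q hq r hr
  rw [Finset.mem_singleton] at hq hr
  rw [hq, hr]
  exact G.inc_refl _

theorem b_mem_osimp (b : P → E3) (p : P) : b p ∈ osimp b {p} :=
  ⟨fun _ => 1, by simp, by simp, by simp⟩

theorem ch_b (p : P) : G.ch (G.b p) = {p} := G.ch_eq (singleton_isCh p) (b_mem_osimp _ _)

theorem b_inj : Function.Injective G.b := fun p q h => by
  have h1 := ch_b (G := G) p
  rw [h, ch_b] at h1
  simpa using h1.symm

/-- There are countably many elements. -/
theorem countable_P (G : Geo P) : Countable P := by
  choose ε hε hfin using G.locfin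
  obtain ⟨s, hs, hcov⟩ := TopologicalSpace.countable_cover_nhds
    (fun y => Metric.ball_mem_nhds y (hε y))
  have hc : (⋃ y ∈ s, {p : P | G.b p ∈ Metric.ball y (ε y)}).Countable := by
    refine hs.biUnion fun y _ => Set.Finite.countable ?_
    refine Set.Finite.of_finite_image (f := fun p => ({p} : Finset P)) ((hfin y).subset ?_) ?_
    · rintro _ ⟨p, hp, rfl⟩
      exact ⟨singleton_isCh p, ⟨_, b_mem_osimp _ _, hp⟩⟩
    · intro p _ q _ h
      simpa using h
  rw [← Set.countable_univ_iff]
  refine hc.mono fun p _ => ?_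
  have : G.b p ∈ (⋃ y ∈ s, Metric.ball y (ε y)) := by rw [hcov]; trivial
  simp only [Set.mem_iUnion, Set.mem_setOf_eq] at this ⊢
  exact this

/-- A countable family of affine spans of at most three points does not cover an open set. -/
theorem exists_generic {ι : Type*} [Countable ι] (A : ι → Finset E3) (hA : ∀ i, (A i).card ≤ 3)
    {O : Set E3} (hO : IsOpen O) (hne : O.Nonempty) :
    ∃ d ∈ O, ∀ i, d ∉ affineSpan ℝ (A i : Set E3) := by
  have hnull : ∀ i, MeasureTheory.volume (affineSpan ℝ (A i : Set E3) : Set E3) = 0 := by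
    intro i
    apply MeasureTheory.Measure.addHaar_affineSubspace
    intro htop
    have h1 : (affineSpan ℝ (A i : Set E3)).direction = ⊤ := by rw [htop]; simp
    rw [direction_affineSpan] at h1
    rcases (A i).eq_empty_or_nonempty with he | hne
    · rw [he] at htop
      simp at htop
    · have h2 := finrank_vectorSpan_image_finset_le ℝ (fun x : E3 => x) (A i) (n := (A i).card - 1)
        (by have := hne.card_pos; omega)
      rw [show (fun x : E3 => x) = id from rfl, Finset.image_id, h1, finrank_top] at h2
      simp at h2
      have := hA i
      omega
  by_contra hcon
  push Not at hcon
  have hsub : O ⊆ ⋃ i, (affineSpan ℝ (A i : Set E3) : Set E3) := fun d hd => by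
    obtain ⟨i, hi⟩ := hcon d hd
    exact Set.mem_iUnion.2 ⟨i, hi⟩
  have h0 : MeasureTheory.volume O = 0 :=
    MeasureTheory.measure_mono_null hsub (MeasureTheory.measure_iUnion_null hnull)
  exact (hO.measure_pos MeasureTheory.volume hne).ne' h0

theorem osimp_sub_span (b : P → E3) (s : Finset P) : osimp b s ⊆ affineSpan ℝ (b '' s) :=
  (osimp_subset_hull b s).trans (convexHull_subset_affineSpan _)

/-- Colours not occurring in a chain. -/
def free (G : Geo P) (c : Finset P) (i : Fin 4) : Prop := ∀ p ∈ c, G.rk p ≠ i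

theorem free.mono {c d : Finset P} (h : c ⊆ d) {i : Fin 4} (hi : G.free d i) : G.free c i :=
  fun p hp => hi p (h hp)

theorem sub_ρ {c : Finset P} {i : Fin 4} (hi : G.free c i) {Φ : G.Cham} (h : c ⊆ Φ.fs) :
    c ⊆ (ρ i Φ).fs := by
  intro p hp
  have := Cham.mem_fs.1 (h hp)
  rw [Cham.mem_fs, ρ_app (hi p hp), this]

/-- A convex open set where the carrier contains `c`. -/
theorem exists_nbhd {c : Finset P} (hc : G.IsCh c) : ∃ O : Set E3, IsOpen O ∧ Convex ℝ O ∧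
    (∀ z ∈ O, c ⊆ G.ch z) ∧ ∀ d, G.IsCh d → c ⊆ d → d.Nonempty → (osimp G.b d ∩ O).Nonempty := by
  rcases c.eq_empty_or_nonempty with rfl | hne
  · refine ⟨Set.univ, isOpen_univ, convex_univ, fun _ _ => Finset.empty_subset _, ?_⟩
    intro d _ _ hd
    rw [Set.inter_univ]
    exact osimp_nonempty _ hd
  · obtain ⟨y, hy⟩ := osimp_nonempty G.b hne
    obtain ⟨ε, hε, hball⟩ := Metric.eventually_nhds_iff_ball.1 (G.ch_usc y)
    rw [G.ch_eq hc hy] at hball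
    exact ⟨Metric.ball y ε, Metric.isOpen_ball, convex_ball _ _, hball,
      fun d _ hcd _ => osimp_near hcd hy (Metric.ball_mem_nhds y hε)⟩

theorem star3 {d : Finset P} (h3 : 3 ≤ d.card) {Φ Ψ : G.Cham}
    (hΦ : d ⊆ Φ.fs) (hΨ : d ⊆ Ψ.fs) : Ψ = Φ ∨ ∃ i, G.free d i ∧ Ψ = ρ i Φ := by
  by_cases hex : ∃ i, Φ.1 i ∉ d
  · obtain ⟨i, hi⟩ := hex
    have hd : d = Φ.fs.erase (Φ.1 i) := by
      apply Finset.eq_of_subset_of_card_le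
      · intro p hp
        exact Finset.mem_erase.2 ⟨fun h => hi (h ▸ hp), hΦ hp⟩
      · rw [Finset.card_erase_of_mem (Φ.app_mem i), Φ.card_fs]
        omega
    rcases ρ_unique' (adj_iff.1 (hd ▸ hΨ)) with h | h
    · exact Or.inl h
    · refine Or.inr ⟨i, ?_, h⟩
      intro p hp hpi
      have := Cham.mem_fs.1 (hΦ hp)
      rw [hpi] at this
      exact hi (this ▸ hp)
  · push Not at hex
    left
    symm
    apply Cham.ext_fs
    intro p hp
    have := Cham.mem_fs.1 hp
    exact hΨ (this ▸ hex _)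

/-- Connectivity of the star of a chain. -/
theorem star_conn {c : Finset P} (hc : G.IsCh c) (S : Set G.Cham)
    (hS : ∀ i, G.free c i → ∀ Φ, c ⊆ Φ.fs → Φ ∈ S → ρ i Φ ∈ S) {Φ Ψ : G.Cham}
    (hΦ : c ⊆ Φ.fs) (hΨ : c ⊆ Ψ.fs) (hm : Φ ∈ S) : Ψ ∈ S := by
  have := G.countable_P
  obtain ⟨O, hO, hconv, hOc, hOd⟩ := exists_nbhd hc
  obtain ⟨a, ha1, ha2⟩ := hOd Φ.fs Φ.isCh hΦ (by rw [← Finset.card_pos, Φ.card_fs]; norm_num)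
  have hΨO := hOd Ψ.fs Ψ.isCh hΨ (by rw [← Finset.card_pos, Ψ.card_fs]; norm_num)
  obtain ⟨d, ⟨hd1, hd2⟩, hgen⟩ := exists_generic (ι := {e : Finset P // e.card ≤ 2})
    (fun e => insert a (e.1.image G.b)) (fun e => by
      refine (Finset.card_insert_le _ _).trans ?_
      have := Finset.card_image_le (s := e.1) (f := G.b)
      have := e.2
      omega) ((G.isOpen_osimp Ψ.isCh Ψ.card_fs).inter hO) hΨO
  have hseg3 : ∀ z ∈ segment ℝ a d, 3 ≤ (G.ch z).card := by
    intro z hz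
    by_contra hcon
    have h1 := hgen ⟨G.ch z, by omega⟩
    apply h1
    rw [segment_eq_image_lineMap] at hz
    obtain ⟨t, -, rfl⟩ := hz
    set z : E3 := AffineMap.lineMap a d t with hz
    have hza : z ≠ a := by
      intro h
      rw [h, G.ch_eq Φ.isCh ha1, Φ.card_fs] at hcon
      omega
    have ht : t ≠ 0 := by
      rintro rfl
      simp [hz] at hza
    have hzs : z ∈ affineSpan ℝ ((insert a ((G.ch z).image G.b) : Finset E3) : Set E3) := by
      refine affineSpan_mono ℝ ?_ (osimp_sub_span _ _ (G.mem_osimp_ch z))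
      simp
    have has : a ∈ affineSpan ℝ ((insert a ((G.ch z).image G.b) : Finset E3) : Set E3) :=
      subset_affineSpan ℝ _ (by simp)
    have hd : d = AffineMap.lineMap a z t⁻¹ := by
      rw [hz, AffineMap.lineMap_lineMap_right, inv_mul_cancel₀ ht, AffineMap.lineMap_apply_one]
    show d ∈ affineSpan ℝ ((insert a ((G.ch z).image G.b) : Finset E3) : Set E3)
    rw [hd]
    exact AffineMap.lineMap_mem _ has hzs
  have hsegO : ∀ z ∈ segment ℝ a d, c ⊆ G.ch z := fun z hz => hOc z (hconv.segment_subset ha2 hd2 hz)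
  have hall : ∀ z ∈ segment ℝ a d, ∀ A B : G.Cham, G.ch z ⊆ A.fs → G.ch z ⊆ B.fs → A ∈ S → B ∈ S := by
    intro z hz A B hA hB hAS
    rcases star3 (hseg3 z hz) hA hB with h | ⟨i, hi, h⟩
    · rw [h]; exact hAS
    · rw [h]; exact hS i (hi.mono (hsegO z hz)) A ((hsegO z hz).trans hA) hAS
  have hconst := const_of_preconn (convex_segment (𝕜 := ℝ) a d).isPreconnected
    (fun z => ∃ A : G.Cham, G.ch z ⊆ A.fs ∧ A ∈ S) (by
      intro z hz
      apply Filter.Eventually.filter_mono nhdsWithin_le_nhds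
      have h2 := G.ch_usc z
      filter_upwards [h2] with w hw
      apply propext
      constructor
      · rintro ⟨A, hA, hAS⟩
        exact ⟨A, hw.trans hA, hAS⟩
      · rintro ⟨A, hA, hAS⟩
        obtain ⟨B, hB⟩ := exists_cham_ge (G.ch_isCh w)
        exact ⟨B, hB, hall z hz A B hA (hw.trans hB) hAS⟩) (left_mem_segment ℝ a d)
      (right_mem_segment ℝ a d)
  have h1 : ∃ A : G.Cham, G.ch a ⊆ A.fs ∧ A ∈ S := ⟨Φ, by rw [G.ch_eq Φ.isCh ha1], hm⟩
  rw [hconst] at h1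
  obtain ⟨A, hA, hAS⟩ := h1
  rw [G.ch_eq Ψ.isCh hd1] at hA
  rwa [Cham.ext_fs hA]

end Geo

open scoped Classical

/-! ## Monodromy: sections of locally constant families over star shaped sets -/

/-- A locally constant family of sets over the points of an open set `O`; sheets are
described by an equivalence relation `R x` on elements lying over `x`. -/
structure Sheets (E : Type*) (O : Set E3) where
  ovr : E3 → E → Prop
  R : E3 → E → E → Prop
  N : E3 → E3 → Prop
  symm : ∀ x e e', R x e e' → R x e' e
  refl : ∀ x e, R x e e
  trans : ∀ x e e' e'', R x e e' → R x e' e'' → R x e e''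
  near : ∀ x ∈ O, ∀ᶠ z in nhds x, N x z
  ovr_mono : ∀ x z e, N x z → ovr z e → ovr x e
  R_mono : ∀ x z e e', N x z → R z e e' → R x e e'
  ex : ∀ x ∈ O, ∀ z e, N x z → ovr x e → ∃ e', ovr z e' ∧ R x e e'
  un : ∀ x ∈ O, ∀ z e e', N x z → ovr z e → ovr z e' → R x e e' → R z e e'

namespace Sheets
variable {E : Type*} {O : Set E3} (S : Sheets E O) {Y : Type*} [TopologicalSpace Y]

/-- Sections along a map `h` over a set `A`. -/
def Sec (h : Y → E3) (A : Set Y) (e : Y → E) : Prop :=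
  ∀ y ∈ A, S.ovr (h y) (e y) ∧ ∀ᶠ w in nhdsWithin y A, S.R (h y) (e w) (e y)

variable {S}

theorem Sec.mono {h : Y → E3} {A B : Set Y} {e : Y → E} (hs : S.Sec h A e) (hBA : B ⊆ A) :
    S.Sec h B e := fun y hy =>
  ⟨(hs y (hBA hy)).1, (hs y (hBA hy)).2.filter_mono (nhdsWithin_mono _ hBA)⟩

theorem Sec.uniq {h : Y → E3} (hcont : Continuous h) {A : Set Y} (hA : IsPreconnected A)
    (hO : ∀ y ∈ A, h y ∈ O) {e e' : Y → E} (h1 : S.Sec h A e) (h2 : S.Sec h A e') {x y : Y}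
    (hx : x ∈ A) (hy : y ∈ A) (hR : S.R (h x) (e x) (e' x)) : S.R (h y) (e y) (e' y) := by
  have := const_of_preconn hA (fun w => S.R (h w) (e w) (e' w)) (by
    intro w hw
    have hN : ∀ᶠ z in nhdsWithin w A, S.N (h w) (h z) :=
      (hcont.continuousAt.eventually (S.near _ (hO w hw))).filter_mono nhdsWithin_le_nhds
    filter_upwards [hN, (h1 w hw).2, (h2 w hw).2, self_mem_nhdsWithin] with z hz h3 h4 hzA
    apply propext
    constructor
    · intro h5
      have := S.R_mono _ _ _ _ hz h5
      exact S.trans _ _ _ _ (S.symm _ _ _ h3) (S.trans _ _ _ _ this h4)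
    · intro h5
      exact S.un _ (hO w hw) _ _ _ hz (h1 z hzA).1 (h2 z hzA).1
        (S.trans _ _ _ _ h3 (S.trans _ _ _ _ h5 (S.symm _ _ _ h4)))) hx hy
  rw [← this]
  exact hR

/-- Sections inside one sheet. -/
theorem sec_of_sheet {h : Y → E3} (hcont : Continuous h) {A : Set Y} (hO : ∀ y ∈ A, h y ∈ O)
    {e : Y → E} {y : E3} (hy : y ∈ O) {e1 : E} (hN : ∀ w ∈ A, S.N y (h w))
    (hover : ∀ w ∈ A, S.ovr (h w) (e w)) (hR : ∀ w ∈ A, S.R y e1 (e w)) : S.Sec h A e := by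
  intro w hw
  refine ⟨hover w hw, ?_⟩
  have hN' : ∀ᶠ z in nhdsWithin w A, S.N (h w) (h z) :=
    (hcont.continuousAt.eventually (S.near _ (hO w hw))).filter_mono nhdsWithin_le_nhds
  filter_upwards [hN', self_mem_nhdsWithin] with z hz hzA
  exact S.un y hy _ _ _ (hN w hw) (S.ovr_mono _ _ _ hz (hover z hzA)) (hover w hw)
    (S.trans _ _ _ _ (S.symm _ _ _ (hR z hzA)) (hR w hw))

/-- A section over a preconnected set near `y` stays in one sheet over `y`. -/
theorem Sec.sheet {h : Y → E3} {A : Set Y} (hA : IsPreconnected A)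
    {e : Y → E} {y : E3} {e1 : E} (hN : ∀ w ∈ A, S.N y (h w))
    (hs : S.Sec h A e) {w0 : Y} (hw0 : w0 ∈ A) (hR : S.R y e1 (e w0)) :
    ∀ w ∈ A, S.R y e1 (e w) := by
  intro w hw
  have := const_of_preconn hA (fun w => S.R y e1 (e w)) (by
    intro z hz
    filter_upwards [(hs z hz).2] with v hv
    have hv' := S.R_mono _ _ _ _ (hN z hz) hv
    apply propext
    exact ⟨fun h => S.trans _ _ _ _ h hv', fun h => S.trans _ _ _ _ h (S.symm _ _ _ hv')⟩) hw0 hw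
  rw [← this]
  exact hR

end Sheets

/-- Induction along the unit interval. -/
theorem interval_induction (Q : ℝ → Prop) (h0 : Q 0)
    (h : ∀ t ∈ Set.Icc (0:ℝ) 1, ∃ ε > 0, ∀ s s', s ∈ Set.Icc (0:ℝ) 1 → s' ∈ Set.Icc (0:ℝ) 1 → s ≤ s' →
      |s - t| < ε → |s' - t| < ε → Q s → Q s') : Q 1 := by
  set B : Set ℝ := {t | t ∈ Set.Icc (0:ℝ) 1 ∧ Q t} with hB
  have hne : B.Nonempty := ⟨0, by simp, h0⟩
  have hbdd : BddAbove B := ⟨1, fun t ht => ht.1.2⟩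
  set σ := sSup B with hσ
  have hσ0 : 0 ≤ σ := le_csSup hbdd ⟨by simp, h0⟩
  have hσ1 : σ ≤ 1 := csSup_le hne fun t ht => ht.1.2
  obtain ⟨ε, hε, hstep⟩ := h σ ⟨hσ0, hσ1⟩
  obtain ⟨s, hs, hsσ⟩ := exists_lt_of_lt_csSup hne (show σ - ε < σ by linarith)
  have hsle : s ≤ σ := le_csSup hbdd hs
  have key : ∀ s' ∈ Set.Icc (0:ℝ) 1, s ≤ s' → s' < σ + ε → Q s' := fun s' hs' hle hlt =>
    hstep s s' hs.1 hs' hle (by rw [abs_lt]; constructor <;> linarith)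
      (by rw [abs_lt]; constructor <;> linarith) hs.2
  rcases hσ1.lt_or_eq with hlt | heq
  · exfalso
    set s' := min 1 (σ + ε / 2) with hs'
    have h1 : σ < s' := lt_min hlt (by linarith)
    have h2 : s' ∈ B := ⟨⟨by linarith, min_le_left _ _⟩, key s' ⟨by linarith, min_le_left _ _⟩
      (by linarith) (by have := min_le_right 1 (σ + ε/2); linarith)⟩
    have := le_csSup hbdd h2
    linarith
  · exact key 1 (by simp) (by linarith) (by linarith)

namespace Sheets
variable {E : Type*} {O : Set E3} {S : Sheets E O}

/-- The contraction map. -/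
noncomputable def hmap (x0 : E3) : ℝ × E3 → E3 := fun y => AffineMap.lineMap x0 y.2 y.1

theorem hmap_cont (x0 : E3) : Continuous (hmap x0) := by
  have : hmap x0 = fun y => y.1 • (y.2 - x0) + x0 := by
    funext y
    simp [hmap, AffineMap.lineMap_apply]
  rw [this]
  fun_prop

theorem exists_cone (x0 : E3) (e0 : E) (he0 : S.ovr x0 e0) {G : Set E3} (hG : IsOpen G)
    (hGO : ∀ x ∈ G, ∀ u ∈ Set.Icc (0:ℝ) 1, hmap x0 (u, x) ∈ O) {x : E3} (hx : x ∈ G) :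
    ∃ δ > 0, Metric.ball x δ ⊆ G ∧ ∃ e : ℝ × E3 → E,
      S.Sec (hmap x0) (Set.Icc 0 1 ×ˢ Metric.ball x δ) e ∧ ∀ z, e (0, z) = e0 := by
  have hcont := hmap_cont x0
  refine interval_induction (fun t => ∃ δ > 0, Metric.ball x δ ⊆ G ∧ ∃ e : ℝ × E3 → E,
      S.Sec (hmap x0) (Set.Icc 0 t ×ˢ Metric.ball x δ) e ∧ ∀ z, e (0, z) = e0) ?_ ?_
  · obtain ⟨δ, hδ, hball⟩ := Metric.isOpen_iff.1 hG x hx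
    refine ⟨δ, hδ, hball, fun _ => e0, ?_, fun _ => rfl⟩
    rintro ⟨u, z⟩ ⟨hu, hz⟩
    have hu0 : u = 0 := by simpa using hu
    subst hu0
    have : hmap x0 (0, z) = x0 := by simp [hmap]
    rw [this]
    exact ⟨he0, Filter.Eventually.of_forall fun _ => S.refl _ _⟩
  · intro t ht
    have hy := hGO x hx t ht
    set y := hmap x0 (t, x) with hydef
    have hN : ∀ᶠ w in nhds (t, x), S.N y (hmap x0 w) := hcont.continuousAt.eventually (S.near y hy)
    obtain ⟨η, hη, hball⟩ := Metric.eventually_nhds_iff_ball.1 hN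
    refine ⟨η, hη, ?_⟩
    rintro s s' hs hs' hss hst hst' ⟨δ, hδ, hδG, e, hsec, he⟩
    have hNb : ∀ u z, |u - t| < η → z ∈ Metric.ball x η → S.N y (hmap x0 (u, z)) := by
      intro u z hu hz
      apply hball
      rw [← ball_prod_same]
      exact ⟨by rw [Metric.mem_ball, Real.dist_eq]; exact hu, hz⟩
    have hδ2 : 0 < min δ η := lt_min hδ hη
    set D := Metric.ball x (min δ η) with hD
    have hDδ : D ⊆ Metric.ball x δ := Metric.ball_subset_ball (min_le_left _ _)
    have hDη : D ⊆ Metric.ball x η := Metric.ball_subset_ball (min_le_right _ _)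
    have hxD : x ∈ D := Metric.mem_ball_self hδ2
    have hover : S.ovr y (e (s, x)) :=
      S.ovr_mono _ _ _ (hNb s x hst (Metric.mem_ball_self hη))
        (hsec (s, x) ⟨⟨hs.1, le_rfl⟩, hDδ hxD⟩).1
    have hext : ∀ w : ℝ × E3, ∃ e', S.N y (hmap x0 w) → S.ovr (hmap x0 w) e' ∧ S.R y (e (s, x)) e' := by
      intro w
      by_cases hw : S.N y (hmap x0 w)
      · obtain ⟨e', he'⟩ := S.ex y hy _ _ hw hover
        exact ⟨e', fun _ => he'⟩
      · exact ⟨e0, fun h => absurd h hw⟩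
    choose κ hκ using hext
    set e' : ℝ × E3 → E := fun w => if w.1 ≤ s then e w else κ w with he'
    refine ⟨min δ η, hδ2, hDδ.trans hδG, e', ?_, ?_⟩
    swap
    · intro z
      simp only [he', if_pos hs.1]
      exact he z
    -- the part near `t`
    have hold : ∀ w ∈ (Set.Icc 0 s ∩ {u | |u - t| < η}) ×ˢ D, S.R y (e (s, x)) (e w) := by
      have hpre : IsPreconnected ((Set.Icc 0 s ∩ {u : ℝ | |u - t| < η}) ×ˢ D) := by
        refine IsPreconnected.prod ?_ (convex_ball _ _).isPreconnected
        have : {u : ℝ | |u - t| < η} = Metric.ball t η := by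
          ext u; simp [Real.dist_eq]
        rw [this]
        exact ((convex_Icc 0 s).inter (convex_ball _ _)).isPreconnected
      refine Sec.sheet (S := S) (h := hmap x0) hpre ?_ (hsec.mono ?_) (w0 := (s, x)) ⟨⟨⟨hs.1, le_rfl⟩, hst⟩, hxD⟩
        (S.refl _ _)
      · rintro ⟨u, z⟩ ⟨hu, hz⟩
        exact hNb u z hu.2 (hDη hz)
      · rintro ⟨u, z⟩ ⟨hu, hz⟩
        exact ⟨hu.1, hDδ hz⟩
    have hloc : S.Sec (hmap x0) ((Set.Icc 0 s' ∩ {u | |u - t| < η}) ×ˢ D) e' := by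
      refine sec_of_sheet hcont ?_ hy (e1 := e (s, x)) ?_ ?_ ?_
      · rintro ⟨u, z⟩ ⟨hu, hz⟩
        exact hGO z (hδG (hDδ hz)) u ⟨hu.1.1, hu.1.2.trans hs'.2⟩
      · rintro ⟨u, z⟩ ⟨hu, hz⟩
        exact hNb u z hu.2 (hDη hz)
      · rintro ⟨u, z⟩ ⟨hu, hz⟩
        by_cases hus : u ≤ s
        · simp only [he', if_pos hus]
          exact (hsec (u, z) ⟨⟨hu.1.1, hus⟩, hDδ hz⟩).1
        · simp only [he', if_neg hus]
          exact (hκ _ (hNb u z hu.2 (hDη hz))).1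
      · rintro ⟨u, z⟩ ⟨hu, hz⟩
        by_cases hus : u ≤ s
        · simp only [he', if_pos hus]
          exact hold (u, z) ⟨⟨⟨hu.1.1, hus⟩, hu.2⟩, hz⟩
        · simp only [he', if_neg hus]
          exact (hκ _ (hNb u z hu.2 (hDη hz))).2
    rintro ⟨u, z⟩ ⟨hu, hz⟩
    by_cases hut : |u - t| < η
    · have h1 := hloc (u, z) ⟨⟨hu, hut⟩, hz⟩
      refine ⟨h1.1, ?_⟩
      have hopen : IsOpen {w : ℝ × E3 | |w.1 - t| < η} := isOpen_lt (by fun_prop) (by fun_prop)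
      have h2 := h1.2
      rw [Filter.Eventually, mem_nhdsWithin_iff_eventually] at h2 ⊢
      filter_upwards [h2, hopen.mem_nhds hut] with w hw1 hw2 hw3
      exact hw1 ⟨⟨hw3.1, hw2⟩, hw3.2⟩
    · have hus : u < s := by
        rw [abs_lt] at hst hst' hut
        by_contra hcon
        apply hut
        have := hu.2
        constructor <;> linarith
      have h1 := hsec (u, z) ⟨⟨hu.1, hus.le⟩, hDδ hz⟩
      have hval : e' (u, z) = e (u, z) := by simp only [he', if_pos hus.le]
      rw [hval]
      refine ⟨h1.1, ?_⟩
      have hopen : IsOpen {w : ℝ × E3 | w.1 < s} := isOpen_lt (by fun_prop) (by fun_prop)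
      have h2 := h1.2
      rw [Filter.Eventually, mem_nhdsWithin_iff_eventually] at h2 ⊢
      filter_upwards [h2, hopen.mem_nhds hus] with w hw1 hw2 hw3
      have hw2' : w.1 < s := hw2
      have hval : e' w = e w := by simp only [he', if_pos hw2'.le]
      show S.R _ (e' w) _
      rw [hval]
      exact hw1 ⟨⟨hw3.1.1, hw2'.le⟩, hDδ hw3.2⟩

/-- Global section over a star shaped open set. -/
theorem monodromy (x0 : E3) (e0 : E) (he0 : S.ovr x0 e0) {G : Set E3} (hG : IsOpen G)
    (hx0 : x0 ∈ G)
    (hGO : ∀ x ∈ G, ∀ u ∈ Set.Icc (0:ℝ) 1, hmap x0 (u, x) ∈ O) :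
    ∃ e : E3 → E, S.R x0 e0 (e x0) ∧ S.Sec id G e := by
  have hcont := hmap_cont x0
  have hex : ∀ x : E3, ∃ δ, ∃ e : ℝ × E3 → E, x ∈ G → 0 < δ ∧ Metric.ball x δ ⊆ G ∧
      S.Sec (hmap x0) (Set.Icc 0 1 ×ˢ Metric.ball x δ) e ∧ ∀ z, e (0, z) = e0 := by
    intro x
    by_cases hx : x ∈ G
    · obtain ⟨δ, hδ, h1, e, h2, h3⟩ := exists_cone x0 e0 he0 hG hGO hx
      exact ⟨δ, e, fun _ => ⟨hδ, h1, h2, h3⟩⟩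
    · exact ⟨0, fun _ => e0, fun h => absurd h hx⟩
  choose δ e he using hex
  have h1 : ∀ x : E3, hmap x0 (1, x) = x := fun x => by simp [hmap]
  have h0 : ∀ x : E3, hmap x0 (0, x) = x0 := fun x => by simp [hmap]
  refine ⟨fun x => e x (1, x), ?_, ?_⟩
  · -- at `x0` the path is constant
    obtain ⟨hδ, hb, hsec, hz⟩ := he x0 hx0
    have hc : ∀ u : ℝ, hmap x0 (u, x0) = x0 := fun u => by simp [hmap]
    have hpre : IsPreconnected (Set.Icc (0:ℝ) 1 ×ˢ ({x0} : Set E3)) :=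
      isPreconnected_Icc.prod isPreconnected_singleton
    have hs2 : S.Sec (hmap x0) (Set.Icc (0:ℝ) 1 ×ˢ ({x0} : Set E3)) (fun _ => e0) := by
      rintro ⟨u, z⟩ ⟨hu, hz⟩
      have hz : z = x0 := hz
      subst hz
      rw [hc]
      exact ⟨he0, Filter.Eventually.of_forall fun _ => S.refl _ _⟩
    have := Sec.uniq hcont hpre (fun y hy => by
      obtain ⟨u, z⟩ := y
      have hz : z = x0 := hy.2
      subst hz
      exact hGO _ hx0 u hy.1) hs2 (hsec.mono (Set.prod_mono le_rfl (by
        rintro _ rfl; exact Metric.mem_ball_self hδ))) (x := (0, x0)) (y := (1, x0))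
      ⟨by simp, rfl⟩ ⟨by simp, rfl⟩ (by rw [hz]; exact S.refl _ _)
    rwa [hc] at this
  · intro x hx
    obtain ⟨hδ, hb, hsec, hz⟩ := he x hx
    have hxx := hsec (1, x) ⟨by simp, Metric.mem_ball_self hδ⟩
    rw [h1] at hxx
    refine ⟨hxx.1, ?_⟩
    have hev : ∀ᶠ z in nhds x, S.R x (e x (1, z)) (e x (1, x)) := by
      have h2 := hxx.2
      rw [Filter.Eventually, mem_nhdsWithin_iff_eventually] at h2
      have hc : ContinuousAt (fun z : E3 => ((1:ℝ), z)) x := by fun_prop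
      filter_upwards [hc.eventually h2, Metric.ball_mem_nhds x hδ] with z hz1 hz2
      exact hz1 ⟨by simp, hz2⟩
    apply Filter.Eventually.filter_mono nhdsWithin_le_nhds
    have hNx : ∀ᶠ z in nhds x, S.N x z := S.near x (by simpa [h1] using hGO x hx 1 (by simp))
    filter_upwards [hev, Metric.ball_mem_nhds x hδ, hG.mem_nhds hx, hNx] with z hz1 hz2 hzG hzN
    obtain ⟨hδ', hb', hsec', hz'⟩ := he z hzG
    have hpre : IsPreconnected (Set.Icc (0:ℝ) 1 ×ˢ ({z} : Set E3)) :=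
      isPreconnected_Icc.prod isPreconnected_singleton
    have := Sec.uniq hcont hpre (fun y hy => by
      obtain ⟨u, z'⟩ := y
      have hz : z' = z := hy.2
      subst hz
      exact hGO _ hzG u hy.1) (hsec'.mono (Set.prod_mono le_rfl (by
        rintro _ rfl; exact Metric.mem_ball_self hδ'))) (hsec.mono (Set.prod_mono le_rfl (by
        rintro _ rfl; exact hz2))) (x := (0, z)) (y := (1, z))
      ⟨by simp, rfl⟩ ⟨by simp, rfl⟩ (by rw [hz, hz']; exact S.refl _ _)
    rw [h1] at this
    exact S.trans _ _ _ _ (S.R_mono _ _ _ _ hzN this) hz1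

end Sheets

open scoped Classical

namespace Geo
variable {P : Type*} {G : Geo P}

/-! ## The lifting theorem -/

/-- Words of odd length in two involutions without fixed points have no fixed points. -/
theorem odd_no_fix {X : Type*} (s t : Equiv.Perm X) (hs : ∀ x, s (s x) = x) (ht : ∀ x, t (t x) = x)
    (hs' : ∀ x, s x ≠ x) (ht' : ∀ x, t x ≠ x) (k : ℤ) (x : X) : ((s * t) ^ k) (t x) ≠ x := by
  have htt : t⁻¹ = t := by
    rw [inv_eq_iff_mul_eq_one]; ext y; simp [ht]
  have hss : s⁻¹ = s := by
    rw [inv_eq_iff_mul_eq_one]; ext y; simp [hs]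
  have hconj : t * (s * t) * t⁻¹ = (s * t)⁻¹ := by
    rw [mul_inv_rev, htt, hss]; ext y; simp [ht]
  have hsw : ∀ m : ℤ, t * (s * t) ^ m = (s * t) ^ (-m) * t := by
    intro m
    have := conj_zpow (i := m) (a := t) (b := s * t)
    rw [hconj] at this
    rw [← inv_zpow', this]
    simp
  intro h
  rcases Int.even_or_odd' k with ⟨m, rfl | rfl⟩
  · apply ht' (((s * t) ^ (-m)) x)
    have h1 : (s * t) ^ (2 * m) * t = (s * t) ^ m * (t * (s * t) ^ (-m)) := by
      rw [hsw, neg_neg, ← mul_assoc, ← zpow_add]; ring_nf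
    have h2 : ((s * t) ^ m * (t * (s * t) ^ (-m))) x = x := by rw [← h1]; exact h
    have h3 := congrArg ((s * t) ^ (-m)) h2
    simp only [Equiv.Perm.mul_apply] at h3
    rw [← Equiv.Perm.mul_apply, ← zpow_add] at h3
    simpa using h3
  · apply hs' (((s * t) ^ (-m)) x)
    have h1 : (s * t) ^ (2 * m + 1) * t = (s * t) ^ m * (s * (s * t) ^ (-m)) := by
      have : s = (s * t) * t := by ext y; simp [ht]
      conv_rhs => rw [show s * (s * t) ^ (-m) = (s * t) * (t * (s * t) ^ (-m)) by
        rw [← mul_assoc, ← this]]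
      rw [hsw, neg_neg, ← mul_assoc, ← mul_assoc, ← zpow_add_one, ← zpow_add]; ring_nf
    have h2 : ((s * t) ^ m * (s * (s * t) ^ (-m))) x = x := by rw [← h1]; exact h
    have h3 := congrArg ((s * t) ^ (-m)) h2
    simp only [Equiv.Perm.mul_apply] at h3
    rw [← Equiv.Perm.mul_apply, ← zpow_add] at h3
    simpa using h3

section lift
variable {E : Type*} (π : E → G.Cham) (r : Fin 4 → Equiv.Perm E)

/-- Reachability by colours in `F`. -/
def reach (F : Fin 4 → Prop) (e e' : E) : Prop :=
  Relation.ReflTransGen (fun a b => ∃ i, F i ∧ b = r i a) e e'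

variable {π r}

theorem reach.symm (hinv : ∀ i e, r i (r i e) = e) {F : Fin 4 → Prop} {e e' : E}
    (h : reach r F e e') : reach r F e' e := by
  induction h with
  | refl => exact Relation.ReflTransGen.refl
  | tail _ hbc ih =>
    obtain ⟨i, hi, rfl⟩ := hbc
    exact Relation.ReflTransGen.head ⟨i, hi, (hinv i _).symm⟩ ih

theorem reach.mono {F F' : Fin 4 → Prop} (hF : ∀ i, F i → F' i) {e e' : E}
    (h : reach r F e e') : reach r F' e e' :=
  by
  induction h with
  | refl => exact Relation.ReflTransGen.refl
  | tail _ hbc ih =>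
    obtain ⟨i, hi, rfl⟩ := hbc
    exact ih.tail ⟨i, hF i hi, rfl⟩

theorem π_zpow (hπ : ∀ i e, π (r i e) = ρ i (π e)) (i j : Fin 4) (k : ℤ) (e : E) :
    π (((r i * r j) ^ k) e) = ((ρ i * ρ j : Equiv.Perm G.Cham) ^ k) (π e) := by
  have h1 : ∀ e, π ((r i * r j) e) = (ρ i * ρ j : Equiv.Perm G.Cham) (π e) := fun e => by simp [hπ]
  induction k using Int.induction_on generalizing e with
  | zero => simp
  | succ n ih =>
    rw [zpow_add_one, zpow_add_one, Equiv.Perm.mul_apply _ (r i * r j), ih, h1]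
    rfl
  | pred n ih =>
    rw [zpow_sub_one, zpow_sub_one, Equiv.Perm.mul_apply _ (r i * r j)⁻¹, ih]
    have : π ((r i * r j)⁻¹ e) = (ρ i * ρ j : Equiv.Perm G.Cham)⁻¹ (π e) := by
      rw [Equiv.Perm.eq_inv_iff_eq, ← h1]
      simp
    rw [this]
    rfl

theorem reach_inj (hπ : ∀ i e, π (r i e) = ρ i (π e)) (hinv : ∀ i e, r i (r i e) = e)
    {d : Finset P} (hd : 2 ≤ d.card) (hdc : G.IsCh d) {e e' : E}
    (hcyc : ∀ i j, ∀ n : ℕ, G.free d i → G.free d j → i ≠ j →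
      ((ρ i * ρ j : Equiv.Perm G.Cham) ^ n) (π e) = π e → ((r i * r j) ^ n) e = e)
    (h : reach r (G.free d) e e') (he : π e' = π e) : e' = e := by
  set Fs : Finset (Fin 4) := Finset.univ.filter (G.free d) with hFs
  have hcard : Fs.card ≤ 2 := by
    have hsub : Fs ⊆ Finset.univ \ d.image G.rk := by
      intro i hi
      rw [hFs, Finset.mem_filter] at hi
      rw [Finset.mem_sdiff]
      refine ⟨Finset.mem_univ _, fun h => ?_⟩
      obtain ⟨p, hp, hpi⟩ := Finset.mem_image.1 h
      exact hi.2 p hp hpi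
    have h1 := Finset.card_le_card hsub
    rw [Finset.card_sdiff_of_subset (Finset.subset_univ _), Finset.card_image_of_injOn
      (fun p hp q hq h => G.inc_eq p q (hdc p hp q hq) h)] at h1
    simp at h1
    omega
  have hmem : ∀ i, G.free d i ↔ i ∈ Fs := fun i => by simp [hFs]
  by_cases h2 : Fs.card = 2
  · obtain ⟨i, j, hij, hFij⟩ := Finset.card_eq_two.1 h2
    have hi : G.free d i := by rw [hmem, hFij]; simp
    have hj : G.free d j := by rw [hmem, hFij]; simp
    have hjj : (r j)⁻¹ = r j := by rw [inv_eq_iff_mul_eq_one]; ext y; simp [hinv]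
    have hii : (r i)⁻¹ = r i := by rw [inv_eq_iff_mul_eq_one]; ext y; simp [hinv]
    set W := r i * r j with hW
    have hconj : r j * W * (r j)⁻¹ = W⁻¹ := by
      rw [hW, mul_inv_rev, hjj, hii]; ext y; simp [hinv]
    have hsw : ∀ (m : ℤ) x, r j ((W ^ m) x) = (W ^ (-m)) (r j x) := by
      intro m x
      have := conj_zpow (i := m) (a := r j) (b := W)
      rw [hconj] at this
      rw [← inv_zpow', this]
      simp
    have hri : ∀ x, r i x = W (r j x) := fun x => by simp [hW, hinv]
    have hK : ∃ k : ℤ, e' = (W ^ k) e ∨ e' = (W ^ k) (r j e) := by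
      clear he
      induction h with
      | refl => exact ⟨0, Or.inl (by simp)⟩
      | tail _ hbc ih =>
        obtain ⟨m, hm, rfl⟩ := hbc
        obtain ⟨k, hk⟩ := ih
        rw [hmem, hFij] at hm
        simp only [Finset.mem_insert, Finset.mem_singleton] at hm
        have hj' : ∀ b, (b = (W ^ k) e ∨ b = (W ^ k) (r j e)) →
            ((r j b) = (W ^ (-k)) e ∨ (r j b) = (W ^ (-k)) (r j e)) := by
          rintro b (rfl | rfl)
          · right; exact hsw _ _
          · left; rw [hsw, hinv]
        rcases hm with rfl | rfl
        · refine ⟨1 + -k, ?_⟩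
          rw [hri]
          rcases hj' _ hk with h | h
          · left; rw [h, zpow_add]; simp
          · right; rw [h, zpow_add]; simp
        · exact ⟨-k, hj' _ hk⟩
    obtain ⟨k, rfl | rfl⟩ := hK
    · rw [π_zpow hπ] at he
      rcases Int.eq_nat_or_neg k with ⟨n, rfl | rfl⟩
      · rw [zpow_natCast] at he ⊢
        exact hcyc i j n hi hj hij he
      · have he' : ((ρ i * ρ j : Equiv.Perm G.Cham) ^ n) (π e) = π e := by
          rw [zpow_neg, Equiv.Perm.inv_eq_iff_eq, zpow_natCast] at he
          exact he.symm
        rw [zpow_neg, Equiv.Perm.inv_eq_iff_eq, zpow_natCast]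
        exact (hcyc i j n hi hj hij he').symm
    · rw [π_zpow hπ, hπ] at he
      exact absurd he (odd_no_fix _ _ (ρ_ρ i) (ρ_ρ j) (ρ_ne i) (ρ_ne j) k _)
  · have h1 : Fs.card ≤ 1 := by omega
    rw [Finset.card_le_one] at h1
    have hK : e' = e ∨ ∃ i, G.free d i ∧ e' = r i e := by
      clear he
      induction h with
      | refl => exact Or.inl rfl
      | tail _ hbc ih =>
        obtain ⟨m, hm, rfl⟩ := hbc
        rcases ih with rfl | ⟨i, hi, rfl⟩
        · exact Or.inr ⟨m, hm, rfl⟩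
        · have : m = i := h1 m ((hmem m).1 hm) i ((hmem i).1 hi)
          subst this
          left; exact hinv _ _
    rcases hK with rfl | ⟨i, -, rfl⟩
    · rfl
    · rw [hπ] at he
      exact absurd he (ρ_ne i _)

theorem exists_reach (hπ : ∀ i e, π (r i e) = ρ i (π e)) {d : Finset P} (hd : G.IsCh d) {e : E}
    (he : d ⊆ (π e).fs) {Ψ : G.Cham} (hΨ : d ⊆ Ψ.fs) : ∃ e', reach r (G.free d) e e' ∧ π e' = Ψ := by
  refine star_conn hd {Ψ | ∃ e', reach r (G.free d) e e' ∧ π e' = Ψ} ?_ he hΨ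
    ⟨e, Relation.ReflTransGen.refl, rfl⟩
  rintro i hi _ - ⟨e', h1, rfl⟩
  exact ⟨r i e', h1.tail ⟨i, hi, rfl⟩, hπ i e'⟩

theorem reach_sub (hπ : ∀ i e, π (r i e) = ρ i (π e)) {d : Finset P} {e e' : E}
    (he : d ⊆ (π e).fs) (h : reach r (G.free d) e e') : d ⊆ (π e').fs := by
  induction h with
  | refl => exact he
  | tail _ hbc ih =>
    obtain ⟨i, hi, rfl⟩ := hbc
    rw [hπ]
    exact sub_ρ hi ih

/-- The sheets of a lifting problem. -/
def liftSheets (hπ : ∀ i e, π (r i e) = ρ i (π e)) (hinv : ∀ i e, r i (r i e) = e)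
    {c : Finset P}
    (hcyc : ∀ e i j, ∀ n : ℕ, c ⊆ (π e).fs → G.free c i → G.free c j → i ≠ j →
      ((ρ i * ρ j : Equiv.Perm G.Cham) ^ n) (π e) = π e → ((r i * r j) ^ n) e = e) (O : Set E3)
    (hO : ∀ x ∈ O, c ⊆ G.ch x ∧ 2 ≤ (G.ch x).card) : Sheets E O where
  ovr x e := G.ch x ⊆ (π e).fs
  R x := reach r (G.free (G.ch x))
  N x z := G.ch x ⊆ G.ch z
  symm _ _ _ h := h.symm hinv
  refl _ _ := Relation.ReflTransGen.refl
  trans _ _ _ _ h h' := Relation.ReflTransGen.trans h h'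
  near x _ := G.ch_usc x
  ovr_mono _ _ _ h h' := h.trans h'
  R_mono _ _ _ _ h h' := h'.mono fun _ hi => hi.mono h
  ex x _ z e h he := by
    obtain ⟨Ψ, hΨ⟩ := exists_cham_ge (G.ch_isCh z)
    obtain ⟨e', h1, h2⟩ := exists_reach hπ (G.ch_isCh x) he (h.trans hΨ)
    exact ⟨e', h2 ▸ hΨ, h1⟩
  un x hx z e e' h he he' hR := by
    obtain ⟨e'', h1, h2⟩ := exists_reach hπ (G.ch_isCh z) he he'
    have h3 : reach r (G.free (G.ch x)) e' e'' :=
      Relation.ReflTransGen.trans (hR.symm hinv) (h1.mono fun _ hi => hi.mono h)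
    have := reach_inj hπ hinv (hO x hx).2 (G.ch_isCh x) (fun i j n hi hj hij =>
      hcyc e' i j n ((hO x hx).1.trans (h.trans he')) (hi.mono (hO x hx).1) (hj.mono (hO x hx).1) hij)
      h3 h2
    rwa [this] at h1

end lift

theorem eq_b_of_card {x : E3} (h : ¬ 2 ≤ (G.ch x).card) : ∃ p, x = G.b p := by
  have h1 := (G.ch_nonempty x).card_pos
  obtain ⟨p, hp⟩ := Finset.card_eq_one.1 (show (G.ch x).card = 1 by omega)
  refine ⟨p, ?_⟩
  have := G.mem_osimp_ch x
  rw [hp] at this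
  obtain ⟨w, -, h2, rfl⟩ := this
  simp at h2
  simp [h2]

/-- Open convex sets stay connected after removing the shadows of the vertices. -/
theorem shadow_conn {x0 : E3} (hx0 : 2 ≤ (G.ch x0).card) {W : Set E3} (hW : IsOpen W)
    (hWc : Convex ℝ W) :
    IsPreconnected (W ∩ {x | ∀ u ∈ Set.Icc (0:ℝ) 1, 2 ≤ (G.ch (Sheets.hmap x0 (u, x))).card}) := by
  have := G.countable_P
  have hx0b : ∀ p, x0 ≠ G.b p := by
    rintro p rfl
    rw [ch_b] at hx0
    simp at hx0
  set A := {x | ∀ u ∈ Set.Icc (0:ℝ) 1, 2 ≤ (G.ch (Sheets.hmap x0 (u, x))).card} with hA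
  have key : ∀ x ∈ W ∩ A, ∀ x'' ∈ W, (∀ p, x'' ∉ affineSpan ℝ (({x0, G.b p, x} : Finset E3) : Set E3)) →
      segment ℝ x x'' ⊆ W ∩ A := by
    intro x hx x'' hx'' hgen z hz
    refine ⟨hWc.segment_subset hx.1 hx'' hz, ?_⟩
    intro u hu
    by_contra hcon
    obtain ⟨p, hp⟩ := eq_b_of_card hcon
    rw [segment_eq_image_lineMap] at hz
    obtain ⟨v, -, rfl⟩ := hz
    have hv : v ≠ 0 := by
      rintro rfl
      rw [AffineMap.lineMap_apply_zero] at hcon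
      exact hcon (hx.2 u hu)
    have hu0 : u ≠ 0 := by
      rintro rfl
      simp [Sheets.hmap] at hp
      exact hx0b p hp
    set z : E3 := AffineMap.lineMap x x'' v with hzdef
    have hz1 : z = AffineMap.lineMap x0 (G.b p) u⁻¹ := by
      rw [← hp]
      simp only [Sheets.hmap]
      rw [AffineMap.lineMap_lineMap_right, inv_mul_cancel₀ hu0, AffineMap.lineMap_apply_one]
    have hx1 : x'' = AffineMap.lineMap x z v⁻¹ := by
      rw [hzdef, AffineMap.lineMap_lineMap_right, inv_mul_cancel₀ hv, AffineMap.lineMap_apply_one]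
    apply hgen p
    rw [hx1]
    apply AffineMap.lineMap_mem
    · exact subset_affineSpan ℝ _ (by simp)
    · rw [hz1]
      apply AffineMap.lineMap_mem
      · exact subset_affineSpan ℝ _ (by simp)
      · exact subset_affineSpan ℝ _ (by simp)
  apply isPreconnected_of_forall_pair
  intro x hx y hy
  obtain ⟨d, hdW, hd⟩ := exists_generic (ι := P × Bool)
    (fun i => if i.2 then {x0, G.b i.1, x} else {x0, G.b i.1, y}) (fun i => by
      split_ifs <;> exact Finset.card_le_three) hW ⟨x, hx.1⟩
  refine ⟨segment ℝ x d ∪ segment ℝ y d, Set.union_subset (key x hx d hdW fun p => ?_)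
    (key y hy d hdW fun p => ?_), Or.inl (left_mem_segment _ _ _), Or.inr (left_mem_segment _ _ _), ?_⟩
  · simpa using hd (p, true)
  · simpa using hd (p, false)
  · exact IsPreconnected.union d (right_mem_segment _ _ _) (right_mem_segment _ _ _)
      (convex_segment x d).isPreconnected (convex_segment y d).isPreconnected

/-- The lifting theorem: the star of a chain (or the whole chamber system) is simply
connected modulo its rank two residues. -/
theorem lift {E : Type*} (π : E → G.Cham) (r : Fin 4 → Equiv.Perm E)
    (hπ : ∀ i e, π (r i e) = ρ i (π e)) (hinv : ∀ i e, r i (r i e) = e)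
    {c : Finset P} (hc : G.IsCh c)
    (hcyc : ∀ e i j, ∀ n : ℕ, c ⊆ (π e).fs → G.free c i → G.free c j → i ≠ j →
      ((ρ i * ρ j : Equiv.Perm G.Cham) ^ n) (π e) = π e → ((r i * r j) ^ n) e = e)
    (e0 : E) (he0 : c ⊆ (π e0).fs) :
    ∃ f : G.Cham → E, f (π e0) = e0 ∧ ∀ Φ, c ⊆ Φ.fs → π (f Φ) = Φ ∧
      ∀ i, G.free c i → f (ρ i Φ) = r i (f Φ) := by
  have := G.countable_P
  obtain ⟨O0, hO0, hconv, hO0c, hO0d⟩ := exists_nbhd hc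
  have hne : ∀ Φ : G.Cham, Φ.fs.Nonempty := fun Φ => by rw [← Finset.card_pos, Φ.card_fs]; norm_num
  obtain ⟨x0, hx01, hx02⟩ := hO0d _ (π e0).isCh he0 (hne _)
  have hchx0 := G.ch_eq (π e0).isCh hx01
  have hx0card : 2 ≤ (G.ch x0).card := by rw [hchx0, Cham.card_fs]; norm_num
  set O : Set E3 := O0 ∩ {x | 2 ≤ (G.ch x).card} with hOdef
  set S := liftSheets hπ hinv hcyc O (fun x hx => ⟨hO0c x hx.1, hx.2⟩) with hS
  set A : Set E3 := {x | ∀ u ∈ Set.Icc (0:ℝ) 1, 2 ≤ (G.ch (Sheets.hmap x0 (u, x))).card} with hA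
  have hAopen : IsOpen A := by
    rw [isOpen_iff_mem_nhds]
    intro x hx
    have hK : IsCompact (Set.Icc (0:ℝ) 1) := isCompact_Icc
    refine hK.eventually_forall_of_forall_eventually fun u hu => ?_
    have h1 := G.ch_usc (Sheets.hmap x0 (u, x))
    have hcont : ContinuousAt (fun y : E3 × ℝ => Sheets.hmap x0 (y.2, y.1)) (x, u) :=
      ((Sheets.hmap_cont x0).comp (by fun_prop)).continuousAt
    filter_upwards [hcont.eventually h1] with y hy
    exact (hx u hu).trans (Finset.card_le_card hy)
  have hx0A : x0 ∈ O0 ∩ A := ⟨hx02, fun u _ => by simpa [Sheets.hmap] using hx0card⟩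
  obtain ⟨e, hee, hsec⟩ := Sheets.monodromy (S := S) x0 e0 (show G.ch x0 ⊆ (π e0).fs by rw [hchx0])
    (hO0.inter hAopen) hx0A (fun x hx u hu => ⟨by
      have := hconv.segment_subset hx02 hx.1
      apply this
      rw [segment_eq_image_lineMap]
      exact ⟨u, hu, rfl⟩, hx.2 u hu⟩)
  -- values on chambers are constant
  have hnofree : ∀ (Φ : G.Cham) (e e' : E), reach r (G.free Φ.fs) e e' → e' = e := by
    intro Φ e e' h
    induction h with
    | refl => rfl
    | tail _ hbc _ =>
      obtain ⟨i, hi, -⟩ := hbc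
      exact absurd (Φ.rk i) (hi _ (Φ.app_mem i))
  have hcomp : ∀ W : Set E3, IsOpen W → Convex ℝ W → IsPreconnected (W ∩ A) := fun W h1 h2 =>
    shadow_conn hx0card h1 h2
  have hchconst : ∀ (Φ : G.Cham), ∀ x ∈ (osimp G.b Φ.fs ∩ O0) ∩ A,
      ∀ y ∈ (osimp G.b Φ.fs ∩ O0) ∩ A, e x = e y := by
    intro Φ x hx y hy
    refine const_of_preconn (hcomp _ ((G.isOpen_osimp Φ.isCh Φ.card_fs).inter hO0)
      ((convex_osimp _ _).inter hconv)) e ?_ hx hy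
    intro z hz
    have h1 := (hsec z ⟨hz.1.2, hz.2⟩).2
    have h2 := h1.filter_mono (nhdsWithin_mono z (show (osimp G.b Φ.fs ∩ O0) ∩ A ⊆ O0 ∩ A from
      fun w hw => ⟨hw.1.2, hw.2⟩))
    filter_upwards [h2] with w hw
    have hw : reach r (G.free (G.ch z)) (e w) (e z) := hw
    rw [G.ch_eq Φ.isCh hz.1.1] at hw
    exact (hnofree _ _ _ hw).symm
  -- generic points
  have hgen : ∀ W : Set E3, IsOpen W → W.Nonempty → (W ∩ A).Nonempty := by
    intro W hW hWne
    obtain ⟨d, hdW, hd⟩ := exists_generic (fun p : P => ({x0, G.b p} : Finset E3))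
      (fun p => Finset.card_le_two.trans (by norm_num)) hW hWne
    refine ⟨d, hdW, fun u hu => ?_⟩
    by_contra hcon
    obtain ⟨p, hp⟩ := eq_b_of_card hcon
    have hu0 : u ≠ 0 := by
      rintro rfl
      simp [Sheets.hmap] at hp
      rw [hp, ch_b] at hx0card
      simp at hx0card
    apply hd p
    have hd1 : d = AffineMap.lineMap x0 (G.b p) u⁻¹ := by
      rw [← hp]
      simp only [Sheets.hmap]
      rw [AffineMap.lineMap_lineMap_right, inv_mul_cancel₀ hu0, AffineMap.lineMap_apply_one]
    rw [hd1]
    apply AffineMap.lineMap_mem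
    · exact subset_affineSpan ℝ _ (by simp)
    · exact subset_affineSpan ℝ _ (by simp)
  have hpick : ∀ Φ : G.Cham, ∃ x, c ⊆ Φ.fs → x ∈ (osimp G.b Φ.fs ∩ O0) ∩ A := by
    intro Φ
    by_cases h : c ⊆ Φ.fs
    · obtain ⟨x, hx⟩ := hgen _ ((G.isOpen_osimp Φ.isCh Φ.card_fs).inter hO0)
        (hO0d _ Φ.isCh h (hne Φ))
      exact ⟨x, fun _ => hx⟩
    · exact ⟨x0, fun h' => absurd h' h⟩
  choose X hX using hpick
  have hπX : ∀ Φ, c ⊆ Φ.fs → π (e (X Φ)) = Φ := by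
    intro Φ hΦ
    have hx := hX Φ hΦ
    have h1 : G.ch (X Φ) ⊆ (π (e (X Φ))).fs := (hsec _ ⟨hx.1.2, hx.2⟩).1
    rw [G.ch_eq Φ.isCh hx.1.1] at h1
    exact (Cham.ext_fs h1).symm
  refine ⟨fun Φ => e (X Φ), ?_, fun Φ hΦ => ⟨hπX Φ hΦ, fun i hi => ?_⟩⟩
  · have h1 : e (X (π e0)) = e x0 := hchconst (π e0) _ (hX _ he0) _ ⟨⟨hx01, hx02⟩, hx0A.2⟩
    have h2 : reach r (G.free (G.ch x0)) e0 (e x0) := hee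
    rw [hchx0] at h2
    show e (X (π e0)) = e0
    rw [h1]
    exact hnofree _ _ _ h2
  · -- compare along the common triangle
    set d := Φ.fs.erase (Φ.1 i) with hd
    have hdc : G.IsCh d := Φ.isCh.mono (Finset.erase_subset _ _)
    have hcd : c ⊆ d := fun p hp => Finset.mem_erase.2 ⟨by
      rintro rfl
      exact hi _ hp (Φ.rk i), hΦ hp⟩
    have hd3 : d.card = 3 := by rw [hd, Finset.card_erase_of_mem (Φ.app_mem i), Φ.card_fs]
    obtain ⟨y, hy1, hy2⟩ := hO0d d hdc hcd (by rw [← Finset.card_pos]; omega)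
    have hchy := G.ch_eq hdc hy1
    obtain ⟨ε, hε, hball⟩ := Metric.eventually_nhds_iff_ball.1
      ((G.ch_usc y).and (hO0.mem_nhds hy2))
    rw [hchy] at hball
    set W := Metric.ball y ε with hW
    have hWn : W ∈ nhds y := Metric.ball_mem_nhds y hε
    have hdΨ : d ⊆ (ρ i Φ).fs := adj_iff.2 fun j hj => ρ_app hj Φ
    have hpt : ∀ Ψ : G.Cham, d ⊆ Ψ.fs → ∃ z ∈ W ∩ A, e z = e (X Ψ) := by
      intro Ψ hΨ
      obtain ⟨z, hz⟩ := hgen _ ((G.isOpen_osimp Ψ.isCh Ψ.card_fs).inter Metric.isOpen_ball)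
        (osimp_near hΨ hy1 hWn)
      exact ⟨z, ⟨hz.1.2, hz.2⟩, hchconst Ψ z ⟨⟨hz.1.1, (hball z hz.1.2).2⟩, hz.2⟩ _
        (hX Ψ (hcd.trans hΨ))⟩
    obtain ⟨z1, hz1, he1⟩ := hpt Φ (Finset.erase_subset _ _)
    obtain ⟨z2, hz2, he2⟩ := hpt (ρ i Φ) hdΨ
    have hRR : reach r (G.free d) (e z1) (e z2) := by
      have hR := Sheets.Sec.sheet (S := S) (h := id) (hcomp W Metric.isOpen_ball (convex_ball _ _)) (y := y)
        (e1 := e z1) (fun w hw => by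
          show G.ch y ⊆ G.ch w
          rw [hchy]; exact (hball w hw.1).1)
        (hsec.mono (show W ∩ A ⊆ O0 ∩ A from fun w hw => ⟨(hball w hw.1).2, hw.2⟩)) hz1
        (S.refl _ _) z2 hz2
      have hR : reach r (G.free (G.ch y)) (e z1) (e z2) := hR
      rwa [hchy] at hR
    rw [he1, he2] at hRR
    have hfi : G.free d i := by
      intro p hp hpi
      have hp' := Finset.mem_erase.1 hp
      have := Cham.mem_fs.1 hp'.2
      rw [hpi] at this
      exact hp'.1 this.symm
    have hR2 : reach r (G.free d) (r i (e (X Φ))) (e (X (ρ i Φ))) :=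
      Relation.ReflTransGen.trans (Relation.ReflTransGen.single ⟨i, hfi, (hinv i _).symm⟩) hRR
    have hπr : π (r i (e (X Φ))) = ρ i Φ := by rw [hπ, hπX Φ hΦ]
    refine reach_inj hπ hinv (d := d) (by omega) hdc (fun a b n ha hb hab =>
      hcyc _ a b n ?_ (ha.mono hcd) (hb.mono hcd) hab) hR2 ?_
    · rw [hπr]; exact hcd.trans hdΨ
    · rw [hπr, hπX _ (hcd.trans hdΨ)]

end Geo

open scoped Classical

/-! ## Duality, connectivity and periods -/

namespace Geo
variable {P : Type*} {G : Geo P}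

/-- The dual geometry. -/
def dual (G : Geo P) : Geo P where
  rk p := Fin.rev (G.rk p)
  inc := G.inc
  inc_refl := G.inc_refl
  inc_symm := G.inc_symm
  inc_eq p q h h' := G.inc_eq p q h (Fin.rev_injective h')
  inc_trans p q r h1 h2 h3 h4 := G.inc_symm _ _ (G.inc_trans r q p (G.inc_symm _ _ h2)
    (G.inc_symm _ _ h1) (Fin.rev_lt_rev.1 h4) (Fin.rev_lt_rev.1 h3))
  b := G.b
  cover := G.cover
  uniq := G.uniq
  locfin := G.locfin
  nobf p p' q q' h1 h2 h3 h4 h5 h6 i1 i2 i3 i4 :=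
    G.nobf q q' p p' (Fin.rev_injective h2) (Fin.rev_injective h1) h4 h3 (Fin.rev_lt_rev.1 h5)
      (by simp only [Fin.val_rev] at h6; have := (G.rk p).2; have := (G.rk q).2; omega)
      (G.inc_symm _ _ i1) (G.inc_symm _ _ i3) (G.inc_symm _ _ i2) (G.inc_symm _ _ i4)

/-- Chambers of the dual. -/
def dualCham (G : Geo P) : G.Cham ≃ G.dual.Cham where
  toFun Φ := ⟨fun i => Φ.1 i.rev, fun i => by
    show Fin.rev (G.rk (Φ.1 i.rev)) = i
    rw [Φ.rk, Fin.rev_rev], fun i j => Φ.inc _ _⟩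
  invFun Φ := ⟨fun i => Φ.1 i.rev, fun i => by
    have : Fin.rev (G.rk (Φ.1 i.rev)) = i.rev := Φ.rk i.rev
    exact Fin.rev_injective this, fun i j => Φ.inc _ _⟩
  left_inv Φ := by apply Subtype.ext; funext i; simp
  right_inv Φ := by apply Subtype.ext; funext i; simp

theorem dualCham_app (Φ : G.Cham) (i : Fin 4) : (G.dualCham Φ).1 i = Φ.1 i.rev := rfl

theorem dualCham_ρ (Φ : G.Cham) (i : Fin 4) : G.dualCham (ρ i Φ) = ρ i.rev (G.dualCham Φ) := by
  apply ρ_unique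
  · intro j hj
    rw [dualCham_app, dualCham_app, ρ_app]
    rintro rfl
    simp at hj
  · intro h
    exact ρ_ne i Φ (G.dualCham.injective h)

theorem conn {J : Fin 4 → Prop} {S : Set G.Cham} (hS : ∀ i, J i → ∀ Φ, Φ ∈ S → ρ i Φ ∈ S)
    {Φ Ψ : G.Cham} (h : ∀ i, ¬ J i → Ψ.1 i = Φ.1 i) (hΦ : Φ ∈ S) : Ψ ∈ S := by
  set c : Finset P := (Finset.univ.filter fun i => ¬ J i).image Φ.1 with hc
  have h1 : c ⊆ Φ.fs := by
    intro p hp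
    obtain ⟨i, -, rfl⟩ := Finset.mem_image.1 hp
    exact Φ.app_mem i
  have h2 : c ⊆ Ψ.fs := by
    intro p hp
    obtain ⟨i, hi, rfl⟩ := Finset.mem_image.1 hp
    rw [← h i (by simpa using hi)]
    exact Ψ.app_mem i
  refine star_conn (Φ.isCh.mono h1) S ?_ h1 h2 hΦ
  intro i hi Ω _ hm
  refine hS i ?_ Ω hm
  by_contra hJ
  exact hi (Φ.1 i) (Finset.mem_image.2 ⟨i, by simpa using hJ, rfl⟩) (Φ.rk i)

theorem conn_all {S : Set G.Cham} (hS : ∀ i, ∀ Φ, Φ ∈ S → ρ i Φ ∈ S)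
    {Φ : G.Cham} (Ψ : G.Cham) (hΦ : Φ ∈ S) : Ψ ∈ S :=
  conn (J := fun _ => True) (fun i _ => hS i) (by simp) hΦ

theorem nonempty_cham (G : Geo P) : Nonempty G.Cham := by
  obtain ⟨Φ, -⟩ := exists_cham_ge (G := G) (s := ∅) (by intro p hp; simp at hp)
  exact ⟨Φ⟩

theorem exists_sgn (G : Geo P) : ∃ s : G.Cham → Bool, ∀ i Φ, s (ρ i Φ) = !s Φ := by
  obtain ⟨Φ0⟩ := G.nonempty_cham
  let r : Fin 4 → Equiv.Perm (G.Cham × Bool) := fun i => (ρ i).prodCongr (Equiv.boolNot)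
  have h2 : ∀ i j, ∀ n : ℕ, ∀ e, (((r i * r j) ^ n) e).2 = e.2 := by
    intro i j n
    induction n with
    | zero => simp
    | succ n ih => intro e; rw [pow_succ, Equiv.Perm.mul_apply, ih]; simp [r]
  have h1 : ∀ i j, ∀ n : ℕ, ∀ e, (((r i * r j) ^ n) e).1 =
      ((ρ i * ρ j : Equiv.Perm G.Cham) ^ n) e.1 := by
    intro i j n
    induction n with
    | zero => simp
    | succ n ih => intro e; rw [pow_succ, Equiv.Perm.mul_apply, ih, pow_succ]; rfl
  obtain ⟨f, hf, hf'⟩ := lift (G := G) (E := G.Cham × Bool) Prod.fst r (fun i e => rfl)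
    (fun i e => by apply Prod.ext <;> simp [r]) (c := ∅) (by intro p hp; simp at hp)
    (fun e i j n _ _ _ _ h => Prod.ext (by rw [h1, h]) (h2 i j n e)) (Φ0, true)
    (Finset.empty_subset _)
  refine ⟨fun Φ => (f Φ).2, fun i Φ => ?_⟩
  dsimp only
  rw [(hf' Φ (Finset.empty_subset _)).2 i (by intro p hp; simp at hp)]
  rfl

theorem star_finite (p : P) : {Φ : G.Cham | p ∈ Φ.fs}.Finite := by
  obtain ⟨ε, hε, hfin⟩ := G.locfin (G.b p)
  refine Set.Finite.of_finite_image (f := Cham.fs) (hfin.subset ?_) ?_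
  · rintro _ ⟨Φ, hΦ, rfl⟩
    refine ⟨Φ.isCh, ?_⟩
    have := osimp_near (s := {p}) (t := Φ.fs) (by simpa using hΦ) (b_mem_osimp G.b p)
      (Metric.ball_mem_nhds _ hε)
    obtain ⟨z, h1, h2⟩ := this
    exact ⟨z, h1, h2⟩
  · intro Φ _ Ψ _ h
    exact Cham.ext_fs h.le

/-- The period of a product of two adjacency permutations. -/
noncomputable def per (i j : Fin 4) (Φ : G.Cham) : ℕ :=
  Function.minimalPeriod (ρ i * ρ j : Equiv.Perm G.Cham) Φ

theorem pow_fix {i j : Fin 4} {Φ : G.Cham} {n : ℕ} :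
    ((ρ i * ρ j : Equiv.Perm G.Cham) ^ n) Φ = Φ ↔ per i j Φ ∣ n := by
  rw [per, ← Function.isPeriodicPt_iff_minimalPeriod_dvd, Function.IsPeriodicPt,
    Function.IsFixedPt, Equiv.Perm.iterate_eq_pow]

theorem pow_app {i j k : Fin 4} (hi : k ≠ i) (hj : k ≠ j) (n : ℕ) (Φ : G.Cham) :
    (((ρ i * ρ j : Equiv.Perm G.Cham) ^ n) Φ).1 k = Φ.1 k := by
  induction n with
  | zero => rfl
  | succ n ih => rw [pow_succ', Equiv.Perm.mul_apply, Equiv.Perm.mul_apply, ρ_app hi, ρ_app hj, ih]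

theorem exists_third (i j : Fin 4) : ∃ k : Fin 4, k ≠ i ∧ k ≠ j := by
  revert i j; decide

theorem per_pos (i j : Fin 4) (Φ : G.Cham) : 0 < per i j Φ := by
  obtain ⟨k, hki, hkj⟩ := exists_third i j
  apply Function.minimalPeriod_pos_of_mem_periodicPts
  have hfin := star_finite (G := G) (Φ.1 k)
  obtain ⟨m, n, hmn, h⟩ : ∃ m n : ℕ, m < n ∧ ((ρ i * ρ j : Equiv.Perm G.Cham) ^ m) Φ =
      ((ρ i * ρ j : Equiv.Perm G.Cham) ^ n) Φ := by
    have : Set.MapsTo (fun n : ℕ => ((ρ i * ρ j : Equiv.Perm G.Cham) ^ n) Φ) Set.univ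
        {Ψ : G.Cham | Φ.1 k ∈ Ψ.fs} := by
      intro n _
      show Φ.1 k ∈ (((ρ i * ρ j : Equiv.Perm G.Cham) ^ n) Φ).fs
      rw [← pow_app hki hkj n Φ]
      exact Cham.app_mem _ _
    obtain ⟨m, -, n, -, hmn, h⟩ := Set.infinite_univ.exists_ne_map_eq_of_mapsTo this hfin
    rcases lt_or_gt_of_ne hmn with hl | hl
    · exact ⟨m, n, hl, h⟩
    · exact ⟨n, m, hl, h.symm⟩
  refine ⟨n - m, by omega, ?_⟩
  rw [Function.IsPeriodicPt, Function.IsFixedPt, Equiv.Perm.iterate_eq_pow]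
  have h2 : n = m + (n - m) := by omega
  rw [h2, pow_add, Equiv.Perm.mul_apply] at h
  exact (Equiv.injective _ h).symm

theorem per_ρ_left (i j : Fin 4) (Φ : G.Cham) : per i j (ρ i Φ) = per j i Φ := by
  apply Nat.dvd_right_iff_eq.1
  intro n
  rw [← pow_fix, ← pow_fix]
  have : ∀ n : ℕ, ((ρ i * ρ j : Equiv.Perm G.Cham) ^ n) (ρ i Φ) =
      ρ i (((ρ j * ρ i : Equiv.Perm G.Cham) ^ n) Φ) := by
    intro n
    induction n with
    | zero => rfl
    | succ n ih => rw [pow_succ', Equiv.Perm.mul_apply, ih, pow_succ']; simp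
  rw [this]
  simp

theorem per_symm (i j : Fin 4) (Φ : G.Cham) : per j i Φ = per i j Φ := by
  apply Nat.dvd_right_iff_eq.1
  intro n
  rw [← pow_fix, ← pow_fix]
  have : (ρ j * ρ i : Equiv.Perm G.Cham) = (ρ i * ρ j)⁻¹ := by
    rw [eq_inv_iff_mul_eq_one]; ext Ψ; simp
  rw [this, inv_pow, Equiv.Perm.inv_eq_iff_eq]
  exact eq_comm

theorem per_ρ₁ (i j : Fin 4) (Φ : G.Cham) : per i j (ρ i Φ) = per i j Φ := by
  rw [per_ρ_left, per_symm]

theorem per_ρ₂ (i j : Fin 4) (Φ : G.Cham) : per i j (ρ j Φ) = per i j Φ := by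
  rw [per_symm, per_ρ_left]

theorem sgn_pow {s : G.Cham → Bool} (hs : ∀ i Φ, s (ρ i Φ) = !s Φ) (i j : Fin 4) (n : ℕ)
    (Φ : G.Cham) : s (((ρ i * ρ j : Equiv.Perm G.Cham) ^ n) Φ) = s Φ := by
  induction n with
  | zero => rfl
  | succ n ih => rw [pow_succ', Equiv.Perm.mul_apply, Equiv.Perm.mul_apply, hs, hs, ih]; simp

theorem star2 {i j : Fin 4} {Φ Ψ : G.Cham} (h : ∀ k, k ≠ i → k ≠ j → Ψ.1 k = Φ.1 k) :
    ∃ n : ℕ, n < per i j Φ ∧ (Ψ = ((ρ i * ρ j : Equiv.Perm G.Cham) ^ n) Φ ∨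
      Ψ = ρ i (((ρ i * ρ j : Equiv.Perm G.Cham) ^ n) Φ)) := by
  have hp := per_pos i j Φ
  have key : ∃ n : ℕ, (Ψ = ((ρ i * ρ j : Equiv.Perm G.Cham) ^ n) Φ ∨
      Ψ = ρ i (((ρ i * ρ j : Equiv.Perm G.Cham) ^ n) Φ)) := by
    refine conn (J := fun k => k = i ∨ k = j) (S := {Ψ | ∃ n : ℕ,
      (Ψ = ((ρ i * ρ j : Equiv.Perm G.Cham) ^ n) Φ ∨
      Ψ = ρ i (((ρ i * ρ j : Equiv.Perm G.Cham) ^ n) Φ))}) ?_ ?_ (Φ := Φ) ⟨0, Or.inl rfl⟩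
    · rintro k (rfl | rfl) Ω ⟨n, rfl | rfl⟩
      · exact ⟨n, Or.inr rfl⟩
      · exact ⟨n, Or.inl (by simp)⟩
      · refine ⟨n + 1, Or.inr ?_⟩
        rw [pow_succ', Equiv.Perm.mul_apply]; simp
      · refine ⟨n + per i k Φ - 1, Or.inl ?_⟩
        apply (ρ i * ρ k : Equiv.Perm G.Cham).injective
        rw [← Equiv.Perm.mul_apply (ρ i * ρ k) ((ρ i * ρ k) ^ (n + per i k Φ - 1)), ← pow_succ',
          show n + per i k Φ - 1 + 1 = n + per i k Φ by omega, pow_add, Equiv.Perm.mul_apply (_ ^ n),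
          pow_fix.2 dvd_rfl]
        simp
    · intro k hk
      push Not at hk
      exact h k hk.1 hk.2
  obtain ⟨n, hn⟩ := key
  refine ⟨n % per i j Φ, Nat.mod_lt _ hp, ?_⟩
  have : ((ρ i * ρ j : Equiv.Perm G.Cham) ^ (n % per i j Φ)) Φ =
      ((ρ i * ρ j : Equiv.Perm G.Cham) ^ n) Φ := by
    conv_rhs => rw [← Nat.mod_add_div n (per i j Φ), pow_add, Equiv.Perm.mul_apply,
      pow_fix.2 (dvd_mul_right _ _)]
  rw [this]
  exact hn

theorem pow_inj {i j : Fin 4} {Φ : G.Cham} {m n : ℕ} (hm : m < per i j Φ) (hn : n < per i j Φ)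
    (h : ((ρ i * ρ j : Equiv.Perm G.Cham) ^ m) Φ = ((ρ i * ρ j : Equiv.Perm G.Cham) ^ n) Φ) :
    m = n := by
  rw [← Equiv.Perm.iterate_eq_pow, ← Equiv.Perm.iterate_eq_pow] at h
  exact Function.iterate_injOn_Iio_minimalPeriod hm hn h

theorem bijOn_pow {i j : Fin 4} (hij : i ≠ j) (Φ : G.Cham) :
    Set.BijOn (fun n : ℕ => (((ρ i * ρ j : Equiv.Perm G.Cham) ^ n) Φ).1 j) (Set.Iio (per i j Φ))
      {p | G.rk p = j ∧ ∀ k, k ≠ i → k ≠ j → G.inc p (Φ.1 k)} := by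
  obtain ⟨s, hs⟩ := G.exists_sgn
  refine ⟨?_, ?_, ?_⟩
  · intro n _
    refine ⟨Cham.rk _ _, fun k hk hk' => ?_⟩
    rw [← pow_app hk hk' n Φ]
    exact Cham.inc _ _ _
  · intro m hm n hn h
    dsimp only at h
    rcases ρ_unique' (i := i) (Φ := ((ρ i * ρ j : Equiv.Perm G.Cham) ^ m) Φ)
      (Ω := ((ρ i * ρ j : Equiv.Perm G.Cham) ^ n) Φ) (by
        intro k hk
        by_cases hkj : k = j
        · rw [hkj]; exact h.symm
        · rw [pow_app hk hkj, pow_app hk hkj]) with h' | h'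
    · exact pow_inj hm hn h'.symm
    · have := congrArg s h'
      rw [hs, sgn_pow hs, sgn_pow hs] at this
      simp at this
  · rintro p ⟨hp, hinc⟩
    set c : Finset P := insert p ((Finset.univ.filter fun k => k ≠ i ∧ k ≠ j).image Φ.1) with hc
    have hcc : G.IsCh c := by
      intro x hx y hy
      rw [hc, Finset.mem_insert, Finset.mem_image] at hx hy
      rcases hx with rfl | ⟨k, hk, rfl⟩ <;> rcases hy with rfl | ⟨l, hl, rfl⟩
      · exact G.inc_refl _
      · simp at hl; exact hinc l hl.1 hl.2
      · simp at hk; exact G.inc_symm _ _ (hinc k hk.1 hk.2)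
      · exact Φ.inc _ _
    obtain ⟨Ψ, hΨ⟩ := exists_cham_ge hcc
    have h1 : Ψ.1 j = p := by
      have := Cham.mem_fs.1 (hΨ (Finset.mem_insert_self p _))
      rwa [hp] at this
    have h2 : ∀ k, k ≠ i → k ≠ j → Ψ.1 k = Φ.1 k := by
      intro k hk hk'
      have := Cham.mem_fs.1 (hΨ (Finset.mem_insert_of_mem
        (Finset.mem_image.2 ⟨k, by simp [hk, hk'], rfl⟩)))
      rwa [Φ.rk] at this
    obtain ⟨n, hn, h | h⟩ := star2 h2
    · exact ⟨n, hn, by dsimp only; rw [← h, h1]⟩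
    · exact ⟨n, hn, by dsimp only; rw [← h1, h, ρ_app hij.symm]⟩

theorem per_eq_ncard {i j : Fin 4} (hij : i ≠ j) (Φ : G.Cham) :
    per i j Φ = {p | G.rk p = j ∧ ∀ k, k ≠ i → k ≠ j → G.inc p (Φ.1 k)}.ncard := by
  rw [← (bijOn_pow hij Φ).image_eq, (bijOn_pow hij Φ).injOn.ncard_image]
  simp [Set.ncard_eq_toFinset_card']

theorem star2_ncard {i j : Fin 4} (Φ : G.Cham) :
    {Ψ : G.Cham | ∀ k, k ≠ i → k ≠ j → Ψ.1 k = Φ.1 k}.ncard = 2 * per i j Φ := by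
  obtain ⟨s, hs⟩ := G.exists_sgn
  set A := (fun n : ℕ => ((ρ i * ρ j : Equiv.Perm G.Cham) ^ n) Φ) '' (Set.Iio (per i j Φ)) with hA
  have hAc : A.ncard = per i j Φ := by
    have : Set.InjOn (fun n : ℕ => ((ρ i * ρ j : Equiv.Perm G.Cham) ^ n) Φ)
        (Set.Iio (per i j Φ)) := fun m hm n hn h => pow_inj hm hn h
    rw [hA, this.ncard_image]
    simp [Set.ncard_eq_toFinset_card']
  have hU : {Ψ : G.Cham | ∀ k, k ≠ i → k ≠ j → Ψ.1 k = Φ.1 k} = A ∪ (ρ i) '' A := by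
    ext Ψ
    constructor
    · intro h
      obtain ⟨n, hn, h | h⟩ := star2 h
      · left; exact ⟨n, hn, h.symm⟩
      · right; exact ⟨_, ⟨n, hn, rfl⟩, h.symm⟩
    · rintro (⟨n, -, rfl⟩ | ⟨_, ⟨n, -, rfl⟩, rfl⟩)
      · intro k hk hk'; exact pow_app hk hk' _ _
      · intro k hk hk'; dsimp only; rw [ρ_app hk]; exact pow_app hk hk' _ _
  have hfin : A.Finite := (Set.finite_Iio _).image _
  rw [hU, Set.ncard_union_eq ?_ hfin (hfin.image _), Set.ncard_image_of_injective _ (ρ i).injective,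
    hAc, two_mul]
  rw [Set.disjoint_left]
  rintro _ ⟨n, -, rfl⟩ ⟨_, ⟨m, -, rfl⟩, h⟩
  have := congrArg s h
  dsimp only at this
  rw [hs, sgn_pow hs, sgn_pow hs] at this
  simp at this

theorem per_ne_one {i j : Fin 4} (hij : i ≠ j) (Φ : G.Cham) : per i j Φ ≠ 1 := by
  intro h
  have h1 := (pow_fix (i := i) (j := j) (Φ := Φ) (n := 1)).2 (by rw [h])
  rw [pow_one, Equiv.Perm.mul_apply] at h1
  have h2 := congrArg (fun Ψ : G.Cham => Ψ.1 j) h1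
  rw [ρ_app hij.symm] at h2
  exact ρ_app_self_ne j Φ h2

theorem per_ge_three {i j : Fin 4} (hij : (j : ℕ) = i + 1) (Φ : G.Cham) : 3 ≤ per i j Φ := by
  have hne : i ≠ j := by rintro rfl; omega
  have h0 := per_pos i j Φ
  have h1 := per_ne_one hne Φ
  by_contra hlt
  have h2 : per i j Φ = 2 := by omega
  have h3 := (pow_fix (i := i) (j := j) (Φ := Φ) (n := 2)).2 (by rw [h2])
  have h4 : ρ i (ρ j Φ) = ρ j (ρ i Φ) := by
    have h5 : ρ i (ρ j (ρ i (ρ j Φ))) = Φ := by simpa [pow_two] using h3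
    have := congrArg (fun Ψ => ρ j (ρ i Ψ)) h5
    simpa using this
  refine G.nobf (Φ.1 i) ((ρ i Φ).1 i) (Φ.1 j) ((ρ j Φ).1 j) ?_ ?_ (ρ_app_self_ne i Φ).symm
    (ρ_app_self_ne j Φ).symm ?_ ?_ (Φ.inc _ _) ?_ ?_ ?_
  · simp [Cham.rk]
  · simp [Cham.rk]
  · rw [Φ.rk, Φ.rk, Fin.lt_def]; omega
  · rw [Φ.rk, Φ.rk]; exact hij
  · rw [← ρ_app hne Φ]; exact Cham.inc _ _ _
  · rw [← ρ_app hne.symm Φ]; exact Cham.inc _ _ _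
  · rw [← ρ_app hne (ρ i Φ), ← h4, ← ρ_app hne.symm (ρ j Φ)]; exact Cham.inc _ _ _

theorem per_two {i j : Fin 4} (hij : (i : ℕ) + 2 ≤ j) (Φ : G.Cham) : per i j Φ = 2 := by
  have hne : i ≠ j := by rintro rfl; omega
  have h1 := per_ne_one hne Φ
  have h2 : per i j Φ ∣ 2 := by
    rw [← pow_fix, pow_two]
    show ρ i (ρ j (ρ i (ρ j Φ))) = Φ
    rw [ρ_comm hij Φ]
    simp
  rcases (Nat.dvd_prime Nat.prime_two).1 h2 with h | h
  · exact absurd h h1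
  · exact h

theorem dual_per (i j : Fin 4) (Φ : G.Cham) : per i j (G.dualCham Φ) = per i.rev j.rev Φ := by
  apply Nat.dvd_right_iff_eq.1
  intro n
  rw [← pow_fix, ← pow_fix]
  have : ∀ n : ℕ, ((ρ i * ρ j : Equiv.Perm G.dual.Cham) ^ n) (G.dualCham Φ) =
      G.dualCham (((ρ i.rev * ρ j.rev : Equiv.Perm G.Cham) ^ n) Φ) := by
    intro n
    induction n with
    | zero => rfl
    | succ n ih => rw [pow_succ', Equiv.Perm.mul_apply, ih, pow_succ']; simp [dualCham_ρ]
  rw [this, G.dualCham.injective.eq_iff]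

end Geo

open scoped Classical

/-! ## The Euler inequality for links of elements of top rank -/

/-- Counting an image by weights. -/
theorem sum_inv_fiber {X Y : Type*} (s : Finset X) (g : X → Y) :
    ∑ x ∈ s, (1 : ℚ) / ((s.filter fun x' => g x' = g x).card : ℚ) = ((s.image g).card : ℚ) := by
  rw [← Finset.sum_fiberwise_of_maps_to (t := s.image g) (g := g)
    (fun x hx => Finset.mem_image_of_mem g hx), Finset.card_eq_sum_ones, Nat.cast_sum]
  refine Finset.sum_congr rfl fun y hy => ?_
  obtain ⟨x0, hx0, rfl⟩ := Finset.mem_image.1 hy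
  have hpos : 0 < (s.filter fun x' => g x' = g x0).card :=
    Finset.card_pos.2 ⟨x0, by simp [hx0]⟩
  rw [Finset.sum_congr rfl (g := fun _ => (1 : ℚ) / ((s.filter fun x' => g x' = g x0).card : ℚ))]
  · rw [Finset.sum_const, nsmul_eq_mul]
    have : ((s.filter fun x' => g x' = g x0).card : ℚ) ≠ 0 := by positivity
    field_simp
    simp
  · intro x hx
    rw [Finset.mem_filter] at hx
    rw [hx.2]

/-- The linear algebra behind the Euler inequality. -/
theorem euler_linear {V E F : Type*} [Fintype V] [Fintype E] [Fintype F] [Nonempty V]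
    (d0 : (V → ZMod 2) →ₗ[ZMod 2] (E → ZMod 2)) (d1 : (E → ZMod 2) →ₗ[ZMod 2] (F → ZMod 2))
    (h1 : d0 (fun _ => 1) = 0) (h2 : ∀ y, d1 y = 0 → ∃ x, d0 x = y) :
    Fintype.card E + 1 ≤ Fintype.card V + Fintype.card F := by
  have : Fact (Nat.Prime 2) := ⟨Nat.prime_two⟩
  have e0 := d0.finrank_range_add_finrank_ker
  have e1 := d1.finrank_range_add_finrank_ker
  rw [Module.finrank_fintype_fun_eq_card] at e0 e1
  have h3 : LinearMap.ker d1 ≤ LinearMap.range d0 := by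
    intro y hy
    obtain ⟨x, hx⟩ := h2 y hy
    exact ⟨x, hx⟩
  have h4 := Submodule.finrank_mono h3
  have h5 := (LinearMap.range d1).finrank_le
  rw [Module.finrank_fintype_fun_eq_card] at h5
  have h6 : 0 < Module.finrank (ZMod 2) (LinearMap.ker d0) := by
    have : Nontrivial (LinearMap.ker d0) := by
      refine ⟨⟨⟨fun _ => 1, h1⟩, 0, ?_⟩⟩
      intro h
      have := congrFun (congrArg Subtype.val h) (Classical.arbitrary V)
      simp at this
    exact Module.finrank_pos
  omega

namespace Geo
variable {P : Type*} {G : Geo P}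

theorem coboundary {t : P} (ht : G.rk t = 3) (y : P → ZMod 2)
    (hy : ∀ Φ : G.Cham, Φ.1 3 = t → ∑ k ∈ Finset.range (per 0 1 Φ),
      y ((((ρ 0 * ρ 1 : Equiv.Perm G.Cham) ^ k) Φ).1 1) = 0) :
    ∃ x : P → ZMod 2, ∀ Φ : G.Cham, Φ.1 3 = t → x (Φ.1 0) + x ((ρ 0 Φ).1 0) = y (Φ.1 1) := by
  obtain ⟨Φ0, hΦ0⟩ := exists_cham_ge (singleton_isCh (G := G) t)
  let r0 : Equiv.Perm (G.Cham × ZMod 2) := Function.Involutive.toPerm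
    (fun e => (ρ 0 e.1, e.2 + y (e.1.1 1))) (by
      intro e
      apply Prod.ext
      · simp
      · show e.2 + y (e.1.1 1) + y ((ρ 0 e.1).1 1) = e.2
        rw [ρ_app (by decide), add_assoc, CharTwo.add_self_eq_zero, add_zero])
  let r' : Fin 4 → Equiv.Perm (G.Cham × ZMod 2) := fun i => (ρ i).prodCongr (Equiv.refl _)
  let r : Fin 4 → Equiv.Perm (G.Cham × ZMod 2) := fun i => if i = 0 then r0 else r' i
  have hr0 : ∀ e, r 0 e = (ρ 0 e.1, e.2 + y (e.1.1 1)) := fun e => rfl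
  have hr : ∀ i, i ≠ 0 → ∀ e, r i e = (ρ i e.1, e.2) := fun i hi e => by simp only [r, if_neg hi]; rfl
  have hπ : ∀ i e, (r i e).1 = ρ i e.1 := by
    intro i e
    by_cases hi : i = 0
    · subst hi; rfl
    · rw [hr i hi]
  have hinv : ∀ i e, r i (r i e) = e := by
    intro i e
    by_cases hi : i = 0
    · subst hi
      exact Equiv.Perm.ext_iff.1 (Function.Involutive.symm_eq_self_of_involutive r0
        (Function.Involutive.toPerm_involutive _) ▸ (inv_mul_cancel r0)) e
    · rw [hr i hi, hr i hi]; simp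
  have hpow1 : ∀ i j (n : ℕ) e, (((r i * r j) ^ n) e).1 =
      ((ρ i * ρ j : Equiv.Perm G.Cham) ^ n) e.1 := by
    intro i j n
    induction n with
    | zero => simp
    | succ n ih =>
      intro e
      rw [pow_succ', Equiv.Perm.mul_apply, Equiv.Perm.mul_apply, hπ, hπ, ih, pow_succ']
      rfl
  have hpow01 : ∀ (n : ℕ) e, (((r 0 * r 1) ^ n) e).2 = e.2 + ∑ k ∈ Finset.range n,
      y ((((ρ 0 * ρ 1 : Equiv.Perm G.Cham) ^ (k + 1)) e.1).1 1) := by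
    intro n e
    induction n with
    | zero => simp
    | succ n ih =>
      rw [pow_succ', Equiv.Perm.mul_apply, Equiv.Perm.mul_apply, hr0, hr 1 (by decide),
        Finset.sum_range_succ, ← add_assoc, ← ih, hpow1, pow_succ' _ n, Equiv.Perm.mul_apply,
        Equiv.Perm.mul_apply (ρ 0), ρ_app (show (1 : Fin 4) ≠ 0 by decide)]
  have hcyc01 : ∀ e (n : ℕ), e.1.1 3 = t → ((ρ 0 * ρ 1 : Equiv.Perm G.Cham) ^ n) e.1 = e.1 →
      ((r 0 * r 1) ^ n) e = e := by
    intro e n he h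
    apply Prod.ext
    · rw [hpow1, h]
    have hb : ((r 0 * r 1) ^ (per 0 1 e.1)) e = e := by
      apply Prod.ext
      · rw [hpow1, pow_fix.2 dvd_rfl]
      · rw [hpow01]
        have := hy e.1 he
        have h2 := Finset.sum_range_succ' (fun k => y ((((ρ 0 * ρ 1 : Equiv.Perm G.Cham) ^ k) e.1).1 1))
          (per 0 1 e.1)
        rw [Finset.sum_range_succ, this, pow_fix.2 dvd_rfl, zero_add, pow_zero] at h2
        have h3 : y (e.1.1 1) = _ + y (e.1.1 1) := h2
        rw [right_eq_add] at h3
        rw [h3, add_zero]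
    obtain ⟨m, rfl⟩ := pow_fix.1 h
    rw [pow_mul]
    have : ∀ m : ℕ, (((r 0 * r 1) ^ (per 0 1 e.1)) ^ m) e = e := by
      intro m
      induction m with
      | zero => rfl
      | succ m ih => rw [pow_succ', Equiv.Perm.mul_apply, ih, hb]
    rw [this]
  have hcyc02 : ∀ e (n : ℕ), ((ρ 0 * ρ 2 : Equiv.Perm G.Cham) ^ n) e.1 = e.1 →
      ((r 0 * r 2) ^ n) e = e := by
    intro e n h
    have h2 := pow_fix.1 h
    rw [per_two (by decide)] at h2
    obtain ⟨m, rfl⟩ := h2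
    have : (r 0 * r 2) ^ 2 = 1 := by
      ext1 e
      rw [pow_two, Equiv.Perm.mul_apply, Equiv.Perm.mul_apply, Equiv.Perm.mul_apply, hr0, hr0,
        hr 2 (by decide), hr 2 (by decide)]
      apply Prod.ext
      · show ρ 0 (ρ 2 (ρ 0 (ρ 2 e.1))) = e.1
        rw [ρ_comm (show ((0 : Fin 4) : ℕ) + 2 ≤ (2 : Fin 4) by decide)]
        simp
      · show e.2 + y ((ρ 2 e.1).1 1) + y ((ρ 2 (ρ 0 (ρ 2 e.1))).1 1) = e.2
        rw [ρ_app (show (1 : Fin 4) ≠ 2 by decide), ρ_app (show (1 : Fin 4) ≠ 2 by decide),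
          ρ_app (show (1 : Fin 4) ≠ 0 by decide), ρ_app (show (1 : Fin 4) ≠ 2 by decide), add_assoc,
          CharTwo.add_self_eq_zero, add_zero]
    rw [pow_mul, this, one_pow]
    rfl
  have hcycr : ∀ i j, i ≠ 0 → j ≠ 0 → ∀ e (n : ℕ), ((ρ i * ρ j : Equiv.Perm G.Cham) ^ n) e.1 = e.1 →
      ((r i * r j) ^ n) e = e := by
    intro i j hi hj e n h
    apply Prod.ext
    · rw [hpow1, h]
    clear h
    induction n with
    | zero => rfl
    | succ n ih => rw [pow_succ', Equiv.Perm.mul_apply, Equiv.Perm.mul_apply, hr i hi, hr j hj]; exact ih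
  have hswap : ∀ i j, ∀ e (n : ℕ), ((r i * r j) ^ n) e = e → ((r j * r i) ^ n) e = e := by
    intro i j e n h
    have : r j * r i = (r i * r j)⁻¹ := by
      rw [eq_inv_iff_mul_eq_one]; ext1 e; simp [hinv]
    rw [this, inv_pow, Equiv.Perm.inv_eq_iff_eq]
    exact h.symm
  have hswapρ : ∀ i j, ∀ e (n : ℕ), ((ρ i * ρ j : Equiv.Perm G.Cham) ^ n) e = e →
      ((ρ j * ρ i : Equiv.Perm G.Cham) ^ n) e = e := by
    intro i j e n h
    rw [pow_fix, per_symm, ← pow_fix]; exact h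
  have hfree : ∀ i, G.free {t} i ↔ i ≠ 3 := by
    intro i
    simp [free, ht, eq_comm]
  have hmem : ∀ Φ : G.Cham, {t} ⊆ Φ.fs ↔ Φ.1 3 = t := by
    intro Φ
    rw [Finset.singleton_subset_iff, Cham.mem_fs, ht]
  obtain ⟨f, -, hf⟩ := lift (G := G) (E := G.Cham × ZMod 2) Prod.fst r hπ hinv
    (singleton_isCh t) (by
      intro e i j n he hi hj hij h
      rw [hfree] at hi hj
      rw [hmem] at he
      by_cases hi0 : i = 0
      · subst hi0
        have : j = 1 ∨ j = 2 := by clear h; revert hij hj; revert j; decide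
        rcases this with rfl | rfl
        · exact hcyc01 e n he h
        · exact hcyc02 e n h
      · by_cases hj0 : j = 0
        · subst hj0
          have : i = 1 ∨ i = 2 := by revert hi hi0; clear hij h; revert i; decide
          rcases this with rfl | rfl
          · exact hswap _ _ _ _ (hcyc01 e n he (hswapρ _ _ _ _ h))
          · exact hswap _ _ _ _ (hcyc02 e n (hswapρ _ _ _ _ h))
        · exact hcycr i j hi0 hj0 e n h) (Φ0, 0) (by simpa using hΦ0)
  have hf' : ∀ Φ : G.Cham, Φ.1 3 = t → (f Φ).1 = Φ ∧ (f (ρ 0 Φ)).2 = (f Φ).2 + y (Φ.1 1) ∧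
      (f (ρ 1 Φ)).2 = (f Φ).2 ∧ (f (ρ 2 Φ)).2 = (f Φ).2 := by
    intro Φ hΦ
    obtain ⟨h1, h2⟩ := hf Φ ((hmem Φ).2 hΦ)
    refine ⟨h1, ?_, ?_, ?_⟩
    · rw [h2 0 ((hfree 0).2 (by decide)), hr0, h1]
    · rw [h2 1 ((hfree 1).2 (by decide)), hr 1 (by decide)]
    · rw [h2 2 ((hfree 2).2 (by decide)), hr 2 (by decide)]
  have hconst : ∀ Φ Ψ : G.Cham, Φ.1 3 = t → Ψ.1 3 = t → Ψ.1 0 = Φ.1 0 → (f Ψ).2 = (f Φ).2 := by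
    intro Φ Ψ h1 h2 h3
    have : Ψ ∈ {Ω : G.Cham | Ω.1 3 = t ∧ (f Ω).2 = (f Φ).2} := by
      refine conn (J := fun i => i = 1 ∨ i = 2) ?_ ?_ (Φ := Φ) ⟨h1, rfl⟩
      · rintro i (rfl | rfl) Ω ⟨ha, hb⟩
        · exact ⟨by rw [ρ_app (by decide), ha], by rw [(hf' Ω ha).2.2.1, hb]⟩
        · exact ⟨by rw [ρ_app (by decide), ha], by rw [(hf' Ω ha).2.2.2, hb]⟩
      · intro i hi
        have : i = 0 ∨ i = 3 := by revert hi; revert i; decide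
        rcases this with rfl | rfl
        · exact h3
        · rw [h1, h2]
    exact this.2
  refine ⟨fun v => if h : ∃ Φ : G.Cham, Φ.1 3 = t ∧ Φ.1 0 = v then (f h.choose).2 else 0, ?_⟩
  have hx : ∀ Φ : G.Cham, Φ.1 3 = t → (fun v => if h : ∃ Φ : G.Cham, Φ.1 3 = t ∧ Φ.1 0 = v then
      (f h.choose).2 else 0) (Φ.1 0) = (f Φ).2 := by
    intro Φ hΦ
    have h : ∃ Ψ : G.Cham, Ψ.1 3 = t ∧ Ψ.1 0 = Φ.1 0 := ⟨Φ, hΦ, rfl⟩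
    simp only [dif_pos h]
    exact hconst _ _ hΦ h.choose_spec.1 h.choose_spec.2
  intro Φ hΦ
  rw [hx Φ hΦ, hx (ρ 0 Φ) (by rw [ρ_app (by decide), hΦ]), (hf' Φ hΦ).2.1, ← add_assoc,
    CharTwo.add_self_eq_zero, zero_add]

theorem cham_through {p t : P} (ht : G.rk t = 3) (hpt : G.inc p t) :
    ∃ Φ : G.Cham, Φ.1 3 = t ∧ Φ.1 (G.rk p) = p := by
  obtain ⟨Φ, hΦ⟩ := exists_cham_ge (G := G) (s := {p, t}) (by
    intro x hx y hy
    simp only [Finset.mem_insert, Finset.mem_singleton] at hx hy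
    rcases hx with rfl | rfl <;> rcases hy with rfl | rfl
    · exact G.inc_refl _
    · exact hpt
    · exact G.inc_symm _ _ hpt
    · exact G.inc_refl _)
  refine ⟨Φ, ?_, Cham.mem_fs.1 (hΦ (by simp))⟩
  rw [← ht]; exact Cham.mem_fs.1 (hΦ (by simp))

theorem euler_card {t : P} (ht : G.rk t = 3) (X : Finset G.Cham) (hX : ∀ Φ, Φ ∈ X ↔ Φ.1 3 = t) :
    (X.image fun Φ => Φ.1 1).card + 1 ≤ (X.image fun Φ => Φ.1 0).card +
      (X.image fun Φ => Φ.1 2).card := by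
  set V := X.image fun Φ => Φ.1 0 with hV
  set E := X.image fun Φ => Φ.1 1 with hE
  set F := X.image fun Φ => Φ.1 2 with hF
  have hmem : ∀ (k : Fin 4) p, p ∈ X.image (fun Φ => Φ.1 k) ↔ G.rk p = k ∧ G.inc p t := by
    intro k p
    rw [Finset.mem_image]
    constructor
    · rintro ⟨Φ, hΦ, rfl⟩
      rw [hX] at hΦ
      exact ⟨Φ.rk k, hΦ ▸ Φ.inc _ _⟩
    · rintro ⟨rfl, h⟩
      obtain ⟨Φ, h1, h2⟩ := cham_through ht h
      exact ⟨Φ, (hX Φ).2 h1, h2⟩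
  let d0 : (V → ZMod 2) →ₗ[ZMod 2] (E → ZMod 2) :=
    { toFun := fun x e => ∑ v, if G.inc v.1 e.1 then x v else 0
      map_add' := by
        intro x x'; funext e
        simp only [Pi.add_apply, ← Finset.sum_add_distrib]
        exact Finset.sum_congr rfl fun v _ => by split_ifs <;> simp
      map_smul' := by
        intro c x; funext e
        simp [Finset.mul_sum] }
  let d1 : (E → ZMod 2) →ₗ[ZMod 2] (F → ZMod 2) :=
    { toFun := fun x e => ∑ v, if G.inc v.1 e.1 then x v else 0
      map_add' := by
        intro x x'; funext e
        simp only [Pi.add_apply, ← Finset.sum_add_distrib]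
        exact Finset.sum_congr rfl fun v _ => by split_ifs <;> simp
      map_smul' := by
        intro c x; funext e
        simp [Finset.mul_sum] }
  obtain ⟨Φ0, hΦ0⟩ := exists_cham_ge (singleton_isCh (G := G) t)
  have hΦ0t : Φ0.1 3 = t := by rw [← ht]; exact Cham.mem_fs.1 (hΦ0 (by simp))
  have : Nonempty V := ⟨⟨Φ0.1 0, Finset.mem_image_of_mem _ ((hX _).2 hΦ0t)⟩⟩
  have hd0 : ∀ (x : P → ZMod 2) (Φ : G.Cham) (hΦ : Φ ∈ X),
      d0 (fun v => x v.1) ⟨Φ.1 1, Finset.mem_image_of_mem _ hΦ⟩ = x (Φ.1 0) + x ((ρ 0 Φ).1 0) := by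
    intro x Φ hΦ
    have hΦ' := (hX Φ).1 hΦ
    have hne := ρ_app_self_ne 0 Φ
    show ∑ v : V, (if G.inc v.1 (Φ.1 1) then x v.1 else 0) = _
    rw [Finset.sum_coe_sort V (fun v => if G.inc v (Φ.1 1) then x v else 0), ← Finset.sum_filter]
    have : V.filter (fun v => G.inc v (Φ.1 1)) = {Φ.1 0, (ρ 0 Φ).1 0} := by
      ext v
      rw [Finset.mem_filter, hV, hmem, Finset.mem_insert, Finset.mem_singleton]
      constructor
      · rintro ⟨⟨hv, hvt⟩, hve⟩
        have := eq_or_eq_of_inc Φ v (by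
          rw [hv]
          intro j hj
          have : j = 1 ∨ j = 2 ∨ j = 3 := by revert hj; revert j; decide
          rcases this with rfl | rfl | rfl
          · exact hve
          · exact G.inc_trans v (Φ.1 1) (Φ.1 2) hve (Φ.inc _ _) (by rw [hv, Φ.rk]; decide)
              (by rw [Φ.rk, Φ.rk]; decide)
          · rw [hΦ']; exact hvt)
        rwa [hv] at this
      · rintro (rfl | rfl)
        · exact ⟨⟨Φ.rk 0, hΦ' ▸ Φ.inc _ _⟩, Φ.inc _ _⟩
        · refine ⟨⟨Cham.rk _ 0, ?_⟩, ?_⟩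
          · rw [← hΦ', ← ρ_app (show (3 : Fin 4) ≠ 0 by decide) Φ]; exact Cham.inc _ _ _
          · rw [← ρ_app (show (1 : Fin 4) ≠ 0 by decide) Φ]; exact Cham.inc _ _ _
    rw [this, Finset.sum_pair hne.symm]
  have key := euler_linear d0 d1 (by
      funext e
      obtain ⟨Φ, hΦ, he⟩ := Finset.mem_image.1 e.2
      have := hd0 (fun _ => 1) Φ hΦ
      have he' : e = ⟨Φ.1 1, Finset.mem_image_of_mem _ hΦ⟩ := Subtype.ext he.symm
      rw [he', this]
      rfl) (by
    intro y hy
    let y' : P → ZMod 2 := fun p => if h : p ∈ E then y ⟨p, h⟩ else 0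
    have hy' : ∀ e : E, y' e.1 = y e := fun e => by simp [y']
    obtain ⟨x, hx⟩ := coboundary ht y' (by
      intro Φ hΦ
      have hf := congrFun hy ⟨Φ.1 2, Finset.mem_image_of_mem _ ((hX Φ).2 hΦ)⟩
      have h2 : ∑ v : E, (if G.inc v.1 (Φ.1 2) then y' v.1 else 0) = 0 := by
        refine Eq.trans ?_ hf
        exact Finset.sum_congr rfl fun v _ => by simp only [hy']
      rw [Finset.sum_coe_sort E (fun v => if G.inc v (Φ.1 2) then y' v else 0),
        ← Finset.sum_filter] at h2
      rw [← h2]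
      have hb := bijOn_pow (show (0 : Fin 4) ≠ 1 by decide) Φ
      have hset : ∀ p, p ∈ E.filter (fun v => G.inc v (Φ.1 2)) ↔
          p ∈ {p | G.rk p = 1 ∧ ∀ k, k ≠ 0 → k ≠ 1 → G.inc p (Φ.1 k)} := by
        intro p
        rw [Finset.mem_filter, hE, hmem]
        constructor
        · rintro ⟨⟨h1, h2⟩, h3⟩
          refine ⟨h1, fun k hk hk' => ?_⟩
          have : k = 2 ∨ k = 3 := by revert hk hk'; revert k; decide
          rcases this with rfl | rfl
          · exact h3
          · rw [hΦ]; exact h2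
        · rintro ⟨h1, h2⟩
          exact ⟨⟨h1, hΦ ▸ h2 3 (by decide) (by decide)⟩, h2 2 (by decide) (by decide)⟩
      refine Finset.sum_nbij (fun n : ℕ => (((ρ 0 * ρ 1 : Equiv.Perm G.Cham) ^ n) Φ).1 1)
        ?_ ?_ ?_ (fun _ _ => rfl)
      · intro n hn
        rw [hset]
        exact hb.mapsTo (by simpa using hn)
      · intro m hm n hn h
        exact hb.injOn (by simpa using hm) (by simpa using hn) h
      · intro p hp
        obtain ⟨n, hn, h⟩ := hb.surjOn ((hset p).1 hp)
        exact ⟨n, by simpa using hn, h⟩)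
    refine ⟨fun v => x v.1, ?_⟩
    funext e
    obtain ⟨Φ, hΦ, he⟩ := Finset.mem_image.1 e.2
    have he' : e = ⟨Φ.1 1, Finset.mem_image_of_mem _ hΦ⟩ := Subtype.ext he.symm
    rw [he', hd0 x Φ hΦ, hx Φ ((hX Φ).1 hΦ), ← hy'])
  simpa using key

theorem euler {t : P} (ht : G.rk t = 3) : ∃ Φ : G.Cham, Φ.1 3 = t ∧
    (1 : ℚ) < 2 / per 0 1 Φ + 1 / per 1 2 Φ + 1 / per 1 2 (ρ 0 Φ) := by
  have hfin : {Φ : G.Cham | Φ.1 3 = t}.Finite := by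
    refine (star_finite (G := G) t).subset ?_
    intro Φ hΦ
    show t ∈ Φ.fs
    rw [← show Φ.1 3 = t from hΦ]
    exact Φ.app_mem 3
  set X := hfin.toFinset with hXd
  have hX : ∀ Φ, Φ ∈ X ↔ Φ.1 3 = t := fun Φ => by simp [hXd]
  have h0 := euler_card ht X hX
  have hcount : ∀ (k i j : Fin 4), i ≠ j → k ≠ i → k ≠ j → 3 ≠ i → 3 ≠ j → k ≠ 3 →
      ((X.image fun Φ => Φ.1 k).card : ℚ) = ∑ Φ ∈ X, 1 / (2 * (per i j Φ : ℚ)) := by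
    intro k i j hij hki hkj h3i h3j hk3
    rw [← sum_inv_fiber]
    refine Finset.sum_congr rfl fun Φ hΦ => ?_
    have : (X.filter fun Ψ => Ψ.1 k = Φ.1 k).card = 2 * per i j Φ := by
      rw [← star2_ncard, ← Set.ncard_coe_finset]
      congr 1
      ext Ψ
      simp only [Finset.coe_filter, hX, Set.mem_ofPred_eq]
      rw [hX] at hΦ
      constructor
      · rintro ⟨h1, h2⟩ l hl hl'
        have : l = k ∨ l = 3 := by
          clear h1 h2
          revert hl hl' hij hki hkj h3i h3j hk3; revert l k i j; decide
        rcases this with rfl | rfl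
        · exact h2
        · rw [h1, hΦ]
      · intro h
        exact ⟨by rw [h 3 h3i h3j, hΦ], h k hki hkj⟩
    rw [this]; push_cast; rfl
  have hV := hcount 0 1 2 (by decide) (by decide) (by decide) (by decide) (by decide) (by decide)
  have hE := hcount 1 0 2 (by decide) (by decide) (by decide) (by decide) (by decide) (by decide)
  have hF := hcount 2 0 1 (by decide) (by decide) (by decide) (by decide) (by decide) (by decide)
  have hsum : (0 : ℚ) < ∑ Φ ∈ X, (1 / (2 * (per 1 2 Φ : ℚ)) + 1 / (2 * (per 0 1 Φ : ℚ)) -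
      1 / (2 * (per 0 2 Φ : ℚ))) := by
    rw [Finset.sum_sub_distrib, Finset.sum_add_distrib, ← hV, ← hE, ← hF]
    have : ((X.image fun Φ => Φ.1 1).card : ℚ) + 1 ≤ (X.image fun Φ => Φ.1 0).card +
      (X.image fun Φ => Φ.1 2).card := by exact_mod_cast h0
    linarith
  set h : G.Cham → ℚ := fun Φ => (1 / (2 * (per 1 2 Φ : ℚ)) + 1 / (2 * (per 0 1 Φ : ℚ)) -
      1 / (2 * (per 0 2 Φ : ℚ))) with hh
  have hsw : ∑ Φ ∈ X, h (ρ 0 Φ) = ∑ Φ ∈ X, h Φ := by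
    refine Finset.sum_nbij (fun Φ => ρ 0 Φ) ?_ ?_ ?_ (fun _ _ => rfl)
    · intro Φ hΦ
      rw [hX] at hΦ ⊢
      rw [ρ_app (by decide), hΦ]
    · intro Φ _ Ψ _ h; exact (ρ 0).injective h
    · intro Φ hΦ
      have hΦ' := (hX Φ).1 hΦ
      exact ⟨ρ 0 Φ, (hX _).2 (by rw [ρ_app (by decide), hΦ']), by simp⟩
  have h3 : ∃ Φ ∈ X, 0 < h Φ + h (ρ 0 Φ) := by
    apply Finset.exists_lt_of_sum_lt (f := fun _ => (0 : ℚ))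
    rw [Finset.sum_add_distrib, hsw]
    simp only [Finset.sum_const_zero]
    linarith
  obtain ⟨Φ, hΦ, h4⟩ := h3
  refine ⟨Φ, (hX Φ).1 hΦ, ?_⟩
  simp only [hh, per_ρ₁ 0 1, per_two (show ((0 : Fin 4) : ℕ) + 2 ≤ (2 : Fin 4) by decide)] at h4
  have a1 : ∀ n : ℕ, (1 : ℚ) / (2 * n) = (1 / 2) * (1 / n) := fun n => by
    rw [one_div_mul_one_div]
  simp only [a1] at h4
  have a2 : (2 : ℚ) / per 0 1 Φ = 2 * (1 / per 0 1 Φ) := by rw [mul_one_div]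
  rw [a2]
  push_cast at h4
  linarith

end Geo

open scoped Classical

/-! ## Isomorphisms of geometries and two-orbit geometries -/

namespace Geo
variable {P : Type*} {G : Geo P} {Q : Type*} {H : Geo Q}

/-- Isomorphisms of geometries. -/
structure GIso (G : Geo P) (H : Geo Q) where
  e : P ≃ Q
  rk : ∀ p, H.rk (e p) = G.rk p
  inc : ∀ p q, H.inc (e p) (e q) ↔ G.inc p q

/-- The action of an isomorphism on chambers. -/
def GIso.cham (f : GIso G H) (Φ : G.Cham) : H.Cham :=
  ⟨fun i => f.e (Φ.1 i), fun i => by rw [f.rk, Φ.rk], fun i j => (f.inc _ _).2 (Φ.inc i j)⟩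

theorem GIso.cham_app (f : GIso G H) (Φ : G.Cham) (i : Fin 4) : (f.cham Φ).1 i = f.e (Φ.1 i) := rfl

theorem GIso.cham_ρ (f : GIso G H) (Φ : G.Cham) (i : Fin 4) : f.cham (ρ i Φ) = ρ i (f.cham Φ) := by
  apply ρ_unique
  · intro j hj
    rw [f.cham_app, f.cham_app, ρ_app hj]
  · intro h
    have := congrArg (fun Ψ : H.Cham => Ψ.1 i) h
    exact ρ_app_self_ne i Φ (f.e.injective this)

theorem pow_map {φ : G.Cham → H.Cham} (hφ : ∀ i Φ, φ (ρ i Φ) = ρ i (φ Φ)) (i j : Fin 4) (n : ℕ)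
    (Φ : G.Cham) : φ (((ρ i * ρ j : Equiv.Perm G.Cham) ^ n) Φ) =
      ((ρ i * ρ j : Equiv.Perm H.Cham) ^ n) (φ Φ) := by
  induction n with
  | zero => rfl
  | succ n ih =>
    rw [pow_succ', pow_succ', Equiv.Perm.mul_apply, Equiv.Perm.mul_apply, hφ, hφ, ih]
    rfl

theorem GIso.cham_per (f : GIso G H) (Φ : G.Cham) (i j : Fin 4) :
    per i j (f.cham Φ) = per i j Φ := by
  apply Nat.dvd_right_iff_eq.1
  intro n
  rw [← pow_fix, ← pow_fix, ← pow_map (fun i Φ => f.cham_ρ Φ i)]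
  constructor
  · intro h
    apply Subtype.ext
    funext k
    exact f.e.injective (congrArg (fun Ψ : H.Cham => Ψ.1 k) h)
  · intro h; rw [h]

theorem exists_cham_mem (G : Geo P) (p : P) : ∃ Φ : G.Cham, Φ.1 (G.rk p) = p := by
  obtain ⟨Φ, hΦ⟩ := exists_cham_ge (singleton_isCh (G := G) p)
  exact ⟨Φ, Cham.mem_fs.1 (hΦ (by simp))⟩

theorem exists_cham_mem₂ {p q : P} (h : G.inc p q) :
    ∃ Φ : G.Cham, Φ.1 (G.rk p) = p ∧ Φ.1 (G.rk q) = q := by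
  obtain ⟨Φ, hΦ⟩ := exists_cham_ge (G := G) (s := {p, q}) (by
    intro x hx y hy
    simp only [Finset.mem_insert, Finset.mem_singleton] at hx hy
    rcases hx with rfl | rfl <;> rcases hy with rfl | rfl
    · exact G.inc_refl _
    · exact h
    · exact G.inc_symm _ _ h
    · exact G.inc_refl _)
  exact ⟨Φ, Cham.mem_fs.1 (hΦ (by simp)), Cham.mem_fs.1 (hΦ (by simp))⟩

theorem map_app {φ : G.Cham → H.Cham} (hφ : ∀ i Φ, φ (ρ i Φ) = ρ i (φ Φ)) {Φ Ψ : G.Cham}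
    {k : Fin 4} (h : Ψ.1 k = Φ.1 k) : (φ Ψ).1 k = (φ Φ).1 k := by
  refine conn (J := fun i => i ≠ k) (S := {Ω | (φ Ω).1 k = (φ Φ).1 k}) ?_ ?_ (Φ := Φ) rfl
  · intro i hi Ω hΩ
    show (φ (ρ i Ω)).1 k = _
    rw [hφ, ρ_app hi.symm]
    exact hΩ
  · intro i hi
    push Not at hi
    rw [hi]; exact h

theorem iso_of_maps {φ : G.Cham → H.Cham} {ψ : H.Cham → G.Cham}
    (hφ : ∀ i Φ, φ (ρ i Φ) = ρ i (φ Φ)) (hψ : ∀ i Φ, ψ (ρ i Φ) = ρ i (ψ Φ)) {Φ0 : G.Cham}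
    (h0 : ψ (φ Φ0) = Φ0) : ∃ f : GIso G H, f.cham Φ0 = φ Φ0 := by
  have h1 : ∀ Φ, ψ (φ Φ) = Φ := fun Φ => conn_all (S := {Φ | ψ (φ Φ) = Φ})
    (fun i Φ h => by show ψ (φ (ρ i Φ)) = _; rw [hφ, hψ, show ψ (φ Φ) = Φ from h]) (Φ := Φ0) Φ h0
  have h2 : ∀ Ψ, φ (ψ Ψ) = Ψ := fun Φ => conn_all (S := {Φ | φ (ψ Φ) = Φ})
    (fun i Φ h => by show φ (ψ (ρ i Φ)) = _; rw [hψ, hφ, show φ (ψ Φ) = Φ from h]) (Φ := φ Φ0) Φ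
    (by show φ (ψ (φ Φ0)) = _; rw [h0])
  choose c hc using G.exists_cham_mem
  choose d hd using H.exists_cham_mem
  have hf : ∀ Φ k, (φ (c (Φ.1 k))).1 k = (φ Φ).1 k := fun Φ k =>
    map_app hφ (by have := hc (Φ.1 k); rwa [Φ.rk] at this)
  have hg : ∀ Φ k, (ψ (d (Φ.1 k))).1 k = (ψ Φ).1 k := fun Φ k =>
    map_app hψ (by have := hd (Φ.1 k); rwa [Φ.rk] at this)
  let f : P → Q := fun p => (φ (c p)).1 (G.rk p)
  let g : Q → P := fun q => (ψ (d q)).1 (H.rk q)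
  have hf' : ∀ Φ k, f (Φ.1 k) = (φ Φ).1 k := fun Φ k => by
    show (φ (c (Φ.1 k))).1 (G.rk (Φ.1 k)) = _
    rw [Φ.rk, hf]
  have hg' : ∀ Φ k, g (Φ.1 k) = (ψ Φ).1 k := fun Φ k => by
    show (ψ (d (Φ.1 k))).1 (H.rk (Φ.1 k)) = _
    rw [Φ.rk, hg]
  refine ⟨⟨⟨f, g, ?_, ?_⟩, ?_, ?_⟩, ?_⟩
  · intro p
    rw [← hc p, hf', hg', h1]
  · intro q
    rw [← hd q, hg', hf', h2]
  · intro p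
    exact (φ (c p)).rk _
  · intro p q
    constructor
    · intro h
      obtain ⟨Φ, h3, h4⟩ := exists_cham_mem₂ h
      have e1 : g (f p) = p := by conv_lhs => rw [← hc p, hf', hg', h1, hc]
      have e2 : g (f q) = q := by conv_lhs => rw [← hc q, hf', hg', h1, hc]
      have h3' := hg' Φ (H.rk (f p))
      have h4' := hg' Φ (H.rk (f q))
      have e3 : Φ.1 (H.rk (f p)) = f p := h3
      have e4 : Φ.1 (H.rk (f q)) = f q := h4
      rw [e3, e1] at h3'
      rw [e4, e2] at h4'
      rw [h3', h4']
      exact Cham.inc _ _ _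
    · intro h
      obtain ⟨Φ, h3, h4⟩ := exists_cham_mem₂ h
      show H.inc (f p) (f q)
      rw [← h3, ← h4, hf', hf']
      exact Cham.inc _ _ _
  · apply Subtype.ext
    funext k
    exact hf' Φ0 k

theorem map_of_rel {R : G.Cham → H.Cham → Prop} (hR : ∀ i Φ Ψ, R Φ Ψ → R (ρ i Φ) (ρ i Ψ))
    (h01 : ∀ Φ Ψ, R Φ Ψ → per 0 1 Φ = per 0 1 Ψ) (h12 : ∀ Φ Ψ, R Φ Ψ → per 1 2 Φ = per 1 2 Ψ)
    (h23 : ∀ Φ Ψ, R Φ Ψ → per 2 3 Φ = per 2 3 Ψ) {Φ0 : G.Cham} {Ψ0 : H.Cham} (h0 : R Φ0 Ψ0) :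
    ∃ φ : G.Cham → H.Cham, φ Φ0 = Ψ0 ∧ ∀ i Φ, φ (ρ i Φ) = ρ i (φ Φ) := by
  have hper : ∀ Φ Ψ, R Φ Ψ → ∀ i j, i < j → per i j Φ = per i j Ψ := by
    intro Φ Ψ h i j hij
    by_cases h2 : (i : ℕ) + 2 ≤ j
    · rw [per_two h2, per_two h2]
    · have : (i = 0 ∧ j = 1) ∨ (i = 1 ∧ j = 2) ∨ (i = 2 ∧ j = 3) := by
        revert hij h2; revert i j; decide
      rcases this with ⟨rfl, rfl⟩ | ⟨rfl, rfl⟩ | ⟨rfl, rfl⟩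
      · exact h01 _ _ h
      · exact h12 _ _ h
      · exact h23 _ _ h
  have hper' : ∀ Φ Ψ, R Φ Ψ → ∀ i j, i ≠ j → per i j Φ = per i j Ψ := by
    intro Φ Ψ h i j hij
    rcases lt_or_gt_of_ne hij with hl | hl
    · exact hper Φ Ψ h i j hl
    · exact (per_symm j i Φ).trans ((hper Φ Ψ h j i hl).trans (per_symm j i Ψ).symm)
  let E := {e : G.Cham × H.Cham // R e.1 e.2}
  let r : Fin 4 → Equiv.Perm E := fun i =>
    ⟨fun e => ⟨(ρ i e.1.1, ρ i e.1.2), hR _ _ _ e.2⟩, fun e => ⟨(ρ i e.1.1, ρ i e.1.2), hR _ _ _ e.2⟩,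
      fun e => by apply Subtype.ext; simp, fun e => by apply Subtype.ext; simp⟩
  have hp : ∀ i j (n : ℕ) (e : E), (((r i * r j) ^ n) e).1 = (((ρ i * ρ j : Equiv.Perm G.Cham) ^ n) e.1.1,
      ((ρ i * ρ j : Equiv.Perm H.Cham) ^ n) e.1.2) := by
    intro i j n e
    induction n with
    | zero => rfl
    | succ n ih =>
      rw [pow_succ', Equiv.Perm.mul_apply]
      show (ρ i (ρ j (((r i * r j) ^ n) e).1.1), ρ i (ρ j (((r i * r j) ^ n) e).1.2)) = _
      rw [ih, pow_succ', pow_succ']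
      rfl
  obtain ⟨f, hf0, hf⟩ := lift (G := G) (E := E) (fun e => e.1.1) r (fun i e => rfl)
    (fun i e => by apply Subtype.ext; simp [r]) (c := ∅) (by intro p hp; simp at hp)
    (by
      intro e i j n _ _ _ hij h
      apply Subtype.ext
      rw [hp, h]
      apply Prod.ext
      · rfl
      · dsimp only
        rw [pow_fix, ← hper' _ _ e.2 i j hij, ← pow_fix]
        exact h) ⟨(Φ0, Ψ0), h0⟩ (Finset.empty_subset _)
  refine ⟨fun Φ => (f Φ).1.2, ?_, ?_⟩
  · dsimp only
    rw [show f Φ0 = _ from hf0]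
  · intro i Φ
    dsimp only
    rw [(hf Φ (Finset.empty_subset _)).2 i (by intro p hp; simp at hp)]
    rfl

theorem iso_of_rel {R : G.Cham → H.Cham → Prop} (hR : ∀ i Φ Ψ, R Φ Ψ → R (ρ i Φ) (ρ i Ψ))
    (h01 : ∀ Φ Ψ, R Φ Ψ → per 0 1 Φ = per 0 1 Ψ) (h12 : ∀ Φ Ψ, R Φ Ψ → per 1 2 Φ = per 1 2 Ψ)
    (h23 : ∀ Φ Ψ, R Φ Ψ → per 2 3 Φ = per 2 3 Ψ) {Φ0 : G.Cham} {Ψ0 : H.Cham} (h0 : R Φ0 Ψ0) :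
    ∃ f : GIso G H, f.cham Φ0 = Ψ0 := by
  obtain ⟨φ, h1, h2⟩ := map_of_rel hR h01 h12 h23 h0
  obtain ⟨ψ, h3, h4⟩ := map_of_rel (R := fun Ψ Φ => R Φ Ψ) (fun i Φ Ψ h => hR i Ψ Φ h)
    (fun Φ Ψ h => (h01 Ψ Φ h).symm) (fun Φ Ψ h => (h12 Ψ Φ h).symm)
    (fun Φ Ψ h => (h23 Ψ Φ h).symm) h0
  obtain ⟨f, hf⟩ := iso_of_maps h2 h4 (Φ0 := Φ0) (by rw [h1, h3])
  exact ⟨f, by rw [hf, h1]⟩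

/-- Two-orbit geometries, with a typing of the chambers by orbits. -/
structure TwoOrb (G : Geo P) (typ : G.Cham → Bool) : Prop where
  trans : ∀ Φ Ψ, typ Φ = typ Ψ → ∃ f : GIso G G, f.cham Φ = Ψ
  inv : ∀ (f : GIso G G) Φ, typ (f.cham Φ) = typ Φ
  two : ∃ Φ Ψ, typ Φ ≠ typ Ψ

/-- Combinatorial data of tetrahedral-octahedral type. -/
def DataA (q : ℕ) (G : Geo P) : Prop := ∃ typ : G.Cham → Bool,
  (∀ i, i ≠ 3 → ∀ Φ, typ (ρ i Φ) = typ Φ) ∧ (∀ Φ, typ (ρ 3 Φ) = !typ Φ) ∧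
  (∀ Φ : G.Cham, per 0 1 Φ = 3) ∧ (∀ Φ : G.Cham, per 2 3 Φ = 4) ∧
  ∀ Φ : G.Cham, per 1 2 Φ = if typ Φ then q else 3

/-- Combinatorial data of the self-dual type. -/
def DataB (q : ℕ) (G : Geo P) : Prop := ∃ typ : G.Cham → Bool,
  (∀ i, i = 1 ∨ i = 2 → ∀ Φ, typ (ρ i Φ) = typ Φ) ∧
  (∀ i, i = 0 ∨ i = 3 → ∀ Φ, typ (ρ i Φ) = !typ Φ) ∧
  (∀ Φ : G.Cham, per 0 1 Φ = 4) ∧ (∀ Φ : G.Cham, per 2 3 Φ = 4) ∧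
  ∀ Φ : G.Cham, per 1 2 Φ = if typ Φ then q else 3

theorem DataA.iso {q : ℕ} (hG : DataA q G) (hH : DataA q H) : Nonempty (GIso G H) := by
  obtain ⟨τ, a1, a2, a3, a4, a5⟩ := hG
  obtain ⟨σ, b1, b2, b3, b4, b5⟩ := hH
  obtain ⟨Φ⟩ := G.nonempty_cham
  obtain ⟨Ψ, hΨ⟩ : ∃ Ψ, τ Φ = σ Ψ := by
    obtain ⟨Ψ⟩ := H.nonempty_cham
    by_cases h : τ Φ = σ Ψ
    · exact ⟨Ψ, h⟩
    · refine ⟨ρ 3 Ψ, ?_⟩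
      rw [b2]
      revert h
      cases τ Φ <;> cases σ Ψ <;> simp
  obtain ⟨f, -⟩ := iso_of_rel (R := fun Φ Ψ => τ Φ = σ Ψ) (by
      intro i Φ Ψ h
      by_cases hi : i = 3
      · subst hi; rw [a2, b2, h]
      · rw [a1 i hi, b1 i hi, h]) (fun _ _ _ => by rw [a3, b3])
    (fun _ _ h => by rw [a5, b5, h]) (fun _ _ _ => by rw [a4, b4]) hΨ
  exact ⟨f⟩

theorem per_comm_ρ {i j k : Fin 4} (hi : ∀ Φ : G.Cham, ρ k (ρ i Φ) = ρ i (ρ k Φ))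
    (hj : ∀ Φ : G.Cham, ρ k (ρ j Φ) = ρ j (ρ k Φ)) (Φ : G.Cham) : per i j (ρ k Φ) = per i j Φ := by
  apply Nat.dvd_right_iff_eq.1
  intro n
  rw [← pow_fix, ← pow_fix]
  have : ∀ n : ℕ, ((ρ i * ρ j : Equiv.Perm G.Cham) ^ n) (ρ k Φ) =
      ρ k (((ρ i * ρ j : Equiv.Perm G.Cham) ^ n) Φ) := by
    intro n
    induction n with
    | zero => rfl
    | succ n ih => rw [pow_succ', Equiv.Perm.mul_apply, ih]; simp [hi, hj]
  rw [this, (ρ k).injective.eq_iff]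

theorem dual_euler {t : P} (ht : G.rk t = 0) : ∃ Φ : G.Cham, Φ.1 0 = t ∧
    (1 : ℚ) < 2 / per 2 3 Φ + 1 / per 1 2 Φ + 1 / per 1 2 (ρ 3 Φ) := by
  obtain ⟨Ψ, h1, h2⟩ := euler (G := G.dual) (t := t) (by show Fin.rev (G.rk t) = 3; rw [ht]; decide)
  obtain ⟨Φ, rfl⟩ := G.dualCham.surjective Ψ
  refine ⟨Φ, h1, ?_⟩
  have e : ρ 0 (G.dualCham Φ) = G.dualCham (ρ 3 Φ) := by rw [dualCham_ρ]; rfl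
  rw [e, dual_per, dual_per, dual_per] at h2
  change (1 : ℚ) < 2 / per 3 2 Φ + 1 / per 2 1 Φ + 1 / per 2 1 (ρ 3 Φ) at h2
  rwa [per_symm 2 3, per_symm 1 2, per_symm 1 2] at h2

end Geo

theorem inv_le_of {a n : ℕ} (hn : 0 < n) (h : n ≤ a) : (1 : ℚ) / a ≤ 1 / n :=
  one_div_le_one_div_of_le (by exact_mod_cast hn) (by exact_mod_cast h)

theorem arith₁ {a b c : ℕ} (ha : 4 ≤ a) (hb : 3 ≤ b) (hbc : b < c)
    (h : (1 : ℚ) < 2 / a + 1 / b + 1 / c) : a = 4 ∧ b = 3 ∧ (c = 4 ∨ c = 5) := by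
  have e : (2 : ℚ) / a = 2 * (1 / a) := by rw [mul_one_div]
  rw [e] at h
  have ha' := inv_le_of (by norm_num) ha
  have hb3 : b = 3 := by
    by_contra hne
    have h1 := inv_le_of (by norm_num) (show 4 ≤ b by omega)
    have h2 := inv_le_of (by norm_num) (show 5 ≤ c by omega)
    norm_num at ha' h1 h2 h
    linarith
  subst hb3
  have hc : c < 6 := by
    by_contra hne
    have h2 := inv_le_of (by norm_num) (show 6 ≤ c by omega)
    norm_num at ha' h2 h
    linarith
  refine ⟨?_, rfl, by omega⟩
  by_contra hne
  have h1 := inv_le_of (by norm_num) (show 5 ≤ a by omega)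
  have h2 := inv_le_of (by norm_num) (show 4 ≤ c by omega)
  norm_num at h1 h2 h
  linarith

theorem arith₂ {a b c : ℕ} (ha : 4 ≤ a) (hb : 4 ≤ b) (hc : 4 ≤ c)
    (h : (1 : ℚ) < 2 / a + 1 / b + 1 / c) : False := by
  have e : (2 : ℚ) / a = 2 * (1 / a) := by rw [mul_one_div]
  rw [e] at h
  have ha' := inv_le_of (by norm_num) ha
  have hb' := inv_le_of (by norm_num) hb
  have hc' := inv_le_of (by norm_num) hc
  norm_num at ha' hb' hc' h
  linarith

theorem arith₃ {a b : ℕ} (ha : 3 ≤ a) (hb : 4 ≤ b)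
    (h : (1 : ℚ) < 2 / a + 1 / b + 1 / b) : a = 3 := by
  by_contra hne
  exact arith₂ (by omega) hb hb h

namespace Geo
variable {P : Type*} {G : Geo P}

theorem even_per {typ : G.Cham → Bool} {i j : Fin 4} {a b : Bool} (hi : ∀ Φ, typ (ρ i Φ) = xor a (typ Φ))
    (hj : ∀ Φ, typ (ρ j Φ) = xor b (typ Φ)) (hab : a ≠ b) (Φ : G.Cham) : 2 ∣ per i j Φ := by
  have h : ∀ n : ℕ, typ (((ρ i * ρ j : Equiv.Perm G.Cham) ^ n) Φ) =
      xor (decide (¬ 2 ∣ n)) (typ Φ) := by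
    intro n
    induction n with
    | zero => simp
    | succ n ih =>
      rw [pow_succ', Equiv.Perm.mul_apply, Equiv.Perm.mul_apply, hi, hj, ih]
      by_cases h2 : 2 ∣ n
      · have h3 : ¬ 2 ∣ n + 1 := by omega
        simp only [h2, h3]
        revert hab; cases a <;> cases b <;> simp
      · have h3 : 2 ∣ n + 1 := by omega
        simp only [h2, h3]
        revert hab; cases a <;> cases b <;> simp
  have h1 := h (per i j Φ)
  rw [pow_fix.2 dvd_rfl] at h1
  by_contra h2
  simp [h2] at h1

theorem TwoOrb.flips {typ : G.Cham → Bool} (h : TwoOrb G typ) (i : Fin 4) :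
    ∃ a : Bool, ∀ Φ, typ (ρ i Φ) = xor a (typ Φ) := by
  have key : ∀ Φ Ψ, typ Φ = typ Ψ → typ (ρ i Φ) = typ (ρ i Ψ) := by
    intro Φ Ψ hΦ
    obtain ⟨f, rfl⟩ := h.trans Φ Ψ hΦ
    rw [← f.cham_ρ, h.inv]
  by_cases hx : ∃ Φ, typ (ρ i Φ) = typ Φ
  · obtain ⟨Φ, hΦ⟩ := hx
    refine ⟨false, fun Ψ => ?_⟩
    rw [Bool.false_xor]
    by_cases h1 : typ Ψ = typ Φ
    · rw [key Ψ Φ h1, hΦ, h1]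
    · by_cases h2 : typ (ρ i Ψ) = typ Φ
      · have := key _ _ h2
        rw [ρ_ρ, hΦ] at this
        exact absurd this h1
      · revert h1 h2
        cases typ Ψ <;> cases typ (ρ i Ψ) <;> cases typ Φ <;> simp
  · push Not at hx
    refine ⟨true, fun Ψ => ?_⟩
    have := hx Ψ
    revert this
    cases typ Ψ <;> cases typ (ρ i Ψ) <;> simp

theorem TwoOrb.classify {typ : G.Cham → Bool} (h : TwoOrb G typ) :
    (∃ q, (q = 4 ∨ q = 5) ∧ DataA q G) ∨ (∃ q, (q = 4 ∨ q = 5) ∧ DataA q G.dual) ∨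
      (∃ q, (q = 4 ∨ q = 5) ∧ DataB q G) := by
  choose fl hfl using h.flips
  have hsurj : ∀ x : Bool, ∃ Φ, typ Φ = x := by
    obtain ⟨Φ, Ψ, hne⟩ := h.two
    intro x
    by_cases h1 : typ Φ = x
    · exact ⟨Φ, h1⟩
    · refine ⟨Ψ, ?_⟩
      revert hne h1
      cases typ Φ <;> cases typ Ψ <;> cases x <;> simp
  choose c hc using hsurj
  have hper : ∀ i j (Φ : G.Cham), per i j Φ = per i j (c (typ Φ)) := by
    intro i j Φ
    obtain ⟨f, hf⟩ := h.trans Φ (c (typ Φ)) (hc _).symm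
    rw [← hf, f.cham_per]
  set p1 : Bool → ℕ := fun x => per 0 1 (c x) with hp1
  set p2 : Bool → ℕ := fun x => per 1 2 (c x) with hp2
  set p3 : Bool → ℕ := fun x => per 2 3 (c x) with hp3
  have e1 : ∀ Φ : G.Cham, per 0 1 Φ = p1 (typ Φ) := hper 0 1
  have e2 : ∀ Φ : G.Cham, per 1 2 Φ = p2 (typ Φ) := hper 1 2
  have e3 : ∀ Φ : G.Cham, per 2 3 Φ = p3 (typ Φ) := hper 2 3
  have g1 : ∀ x, 3 ≤ p1 x := fun x => per_ge_three (by decide) _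
  have g2 : ∀ x, 3 ≤ p2 x := fun x => per_ge_three (by decide) _
  have g3 : ∀ x, 3 ≤ p3 x := fun x => per_ge_three (by decide) _
  -- invariance
  have i10 : fl 0 = true → p1 true = p1 false := by
    intro hf
    have := per_ρ₁ 0 1 (c true)
    rw [e1, e1, hfl, hf, hc] at this
    exact this.symm
  have i11 : fl 1 = true → p1 true = p1 false := by
    intro hf
    have := per_ρ₂ 0 1 (c true)
    rw [e1, e1, hfl, hf, hc] at this
    exact this.symm
  have i13 : fl 3 = true → p1 true = p1 false := by
    intro hf
    have := per_comm_ρ (i := 0) (j := 1) (k := 3) (fun Φ => (ρ_comm (by decide) Φ).symm)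
      (fun Φ => (ρ_comm (by decide) Φ).symm) (c true)
    rw [e1, e1, hfl, hf, hc] at this
    exact this.symm
  have i21 : fl 1 = true → p2 true = p2 false := by
    intro hf
    have := per_ρ₁ 1 2 (c true)
    rw [e2, e2, hfl, hf, hc] at this
    exact this.symm
  have i22 : fl 2 = true → p2 true = p2 false := by
    intro hf
    have := per_ρ₂ 1 2 (c true)
    rw [e2, e2, hfl, hf, hc] at this
    exact this.symm
  have i32 : fl 2 = true → p3 true = p3 false := by
    intro hf
    have := per_ρ₁ 2 3 (c true)
    rw [e3, e3, hfl, hf, hc] at this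
    exact this.symm
  have i33 : fl 3 = true → p3 true = p3 false := by
    intro hf
    have := per_ρ₂ 2 3 (c true)
    rw [e3, e3, hfl, hf, hc] at this
    exact this.symm
  have i30 : fl 0 = true → p3 true = p3 false := by
    intro hf
    have := per_comm_ρ (i := 2) (j := 3) (k := 0) (fun Φ => ρ_comm (by decide) Φ)
      (fun Φ => ρ_comm (by decide) Φ) (c true)
    rw [e3, e3, hfl, hf, hc] at this
    exact this.symm
  -- parity
  have v1 : fl 0 ≠ fl 1 → ∀ x, 2 ∣ p1 x := fun hne x => even_per (hfl 0) (hfl 1) hne (c x)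
  have v2 : fl 1 ≠ fl 2 → ∀ x, 2 ∣ p2 x := fun hne x => even_per (hfl 1) (hfl 2) hne (c x)
  have v3 : fl 2 ≠ fl 3 → ∀ x, 2 ∣ p3 x := fun hne x => even_per (hfl 2) (hfl 3) hne (c x)
  -- not everything constant
  have hnc : ¬ (p1 true = p1 false ∧ p2 true = p2 false ∧ p3 true = p3 false) := by
    rintro ⟨c1, c2, c3⟩
    have k1 : ∀ x y, p1 x = p1 y := by intro x y; cases x <;> cases y <;> simp [c1]
    have k2 : ∀ x y, p2 x = p2 y := by intro x y; cases x <;> cases y <;> simp [c2]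
    have k3 : ∀ x y, p3 x = p3 y := by intro x y; cases x <;> cases y <;> simp [c3]
    obtain ⟨f, hf⟩ := iso_of_rel (G := G) (H := G) (R := fun _ _ => True) (fun _ _ _ _ => trivial)
      (fun Φ Ψ _ => by rw [e1, e1, k1]) (fun Φ Ψ _ => by rw [e2, e2, k2])
      (fun Φ Ψ _ => by rw [e3, e3, k3]) (Φ0 := c true) (Ψ0 := c false) trivial
    have := h.inv f (c true)
    rw [hf, hc, hc] at this
    simp at this
  have hnf : ¬ (fl 0 = false ∧ fl 1 = false ∧ fl 2 = false ∧ fl 3 = false) := by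
    rintro ⟨c0, c1, c2, c3⟩
    have : c false ∈ {Φ | typ Φ = true} := conn_all (Φ := c true) (by
      intro i Φ hΦ
      have hi : fl i = false := by
        have : i = 0 ∨ i = 1 ∨ i = 2 ∨ i = 3 := by revert i; decide
        rcases this with rfl | rfl | rfl | rfl <;> assumption
      show typ (ρ i Φ) = true
      rw [hfl, hi]
      simpa using hΦ) _ (hc true)
    have h2 : typ (c false) = true := this
    rw [hc] at h2
    simp at h2
  -- Euler
  have eu : ∃ x, (1 : ℚ) < 2 / p1 x + 1 / p2 x + 1 / p2 (xor (fl 0) x) := by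
    obtain ⟨Φ, -, hΦ⟩ := euler (G := G) (t := (c true).1 3) (Cham.rk _ _)
    rw [e1, e2, e2, hfl] at hΦ
    exact ⟨_, hΦ⟩
  have du : ∃ x, (1 : ℚ) < 2 / p3 x + 1 / p2 x + 1 / p2 (xor (fl 3) x) := by
    obtain ⟨Φ, -, hΦ⟩ := dual_euler (G := G) (t := (c true).1 0) (Cham.rk _ _)
    rw [e3, e2, e2, hfl] at hΦ
    exact ⟨_, hΦ⟩
  have eu' : fl 0 = false → fl 1 = false → fl 2 = false →
      ∀ x, (1 : ℚ) < 2 / p1 x + 1 / p2 x + 1 / p2 x := by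
    intro c0 c1 c2 x
    obtain ⟨Φ, h1, hΦ⟩ := euler (G := G) (t := (c x).1 3) (Cham.rk _ _)
    have : Φ ∈ {Φ | typ Φ = x} := conn (J := fun i => i ≠ 3) (Φ := c x) (by
      intro i hi Φ hΦ
      have hi : fl i = false := by
        have : i = 0 ∨ i = 1 ∨ i = 2 := by clear hΦ; revert hi; revert i; decide
        rcases this with rfl | rfl | rfl <;> assumption
      show typ (ρ i Φ) = x
      rw [hfl, hi]
      simpa using hΦ) (by
      intro i hi
      push Not at hi
      rw [hi, h1]) (hc x)
    have h2 : typ Φ = x := this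
    rw [e1, e2, e2, hfl, c0, h2] at hΦ
    simpa using hΦ
  have du' : fl 3 = false → fl 1 = false → fl 2 = false →
      ∀ x, (1 : ℚ) < 2 / p3 x + 1 / p2 x + 1 / p2 x := by
    intro c0 c1 c2 x
    obtain ⟨Φ, h1, hΦ⟩ := dual_euler (G := G) (t := (c x).1 0) (Cham.rk _ _)
    have : Φ ∈ {Φ | typ Φ = x} := conn (J := fun i => i ≠ 0) (Φ := c x) (by
      intro i hi Φ hΦ
      have hi : fl i = false := by
        have : i = 1 ∨ i = 2 ∨ i = 3 := by clear hΦ; revert hi; revert i; decide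
        rcases this with rfl | rfl | rfl <;> assumption
      show typ (ρ i Φ) = x
      rw [hfl, hi]
      simpa using hΦ) (by
      intro i hi
      push Not at hi
      rw [hi, h1]) (hc x)
    have h2 : typ Φ = x := this
    rw [e3, e2, e2, hfl, c0, h2] at hΦ
    simpa using hΦ
  -- the cases where the second or third generator flips
  have hf1 : fl 1 = false := by
    by_contra hf
    rw [Bool.not_eq_false] at hf
    have c3 : p3 true ≠ p3 false := fun hh => hnc ⟨i11 hf, i21 hf, hh⟩
    have f2 : fl 2 = false := by
      by_contra h'; rw [Bool.not_eq_false] at h'; exact c3 (i32 h')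
    have f0 : fl 0 = false := by
      by_contra h'; rw [Bool.not_eq_false] at h'; exact c3 (i30 h')
    have w1 := v1 (by rw [f0, hf]; decide)
    have w2 := v2 (by rw [f2, hf]; decide)
    obtain ⟨x, hx⟩ := eu
    refine arith₂ ?_ ?_ ?_ hx
    · have := w1 x; have := g1 x; omega
    · have := w2 x; have := g2 x; omega
    · have := w2 (xor (fl 0) x); have := g2 (xor (fl 0) x); omega
  have hf2 : fl 2 = false := by
    by_contra hf
    rw [Bool.not_eq_false] at hf
    have c1 : p1 true ≠ p1 false := fun hh => hnc ⟨hh, i22 hf, i32 hf⟩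
    have f3 : fl 3 = false := by
      by_contra h'; rw [Bool.not_eq_false] at h'; exact c1 (i13 h')
    have w3 := v3 (by rw [f3, hf]; decide)
    have w2 := v2 (by rw [hf1, hf]; decide)
    obtain ⟨x, hx⟩ := du
    refine arith₂ ?_ ?_ ?_ hx
    · have := w3 x; have := g3 x; omega
    · have := w2 x; have := g2 x; omega
    · have := w2 (xor (fl 3) x); have := g2 (xor (fl 3) x); omega
  have c1 : p1 true = p1 false := by
    by_cases h0 : fl 0 = true
    · exact i10 h0
    · apply i13
      by_contra h3
      exact hnf ⟨by simpa using h0, hf1, hf2, by simpa using h3⟩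
  have c3 : p3 true = p3 false := by
    by_cases h0 : fl 0 = true
    · exact i30 h0
    · apply i33
      by_contra h3
      exact hnf ⟨by simpa using h0, hf1, hf2, by simpa using h3⟩
  have c2 : p2 true ≠ p2 false := fun hh => hnc ⟨c1, hh, c3⟩
  -- normalise
  have norm : ∀ a : ℕ, 4 ≤ a → (∃ x, (1 : ℚ) < 2 / a + 1 / p2 x + 1 / p2 (!x)) →
      a = 4 ∧ ∃ y q, (q = 4 ∨ q = 5) ∧ ∀ x, p2 x = if xor y x then q else 3 := by
    rintro a ha ⟨x, hx⟩
    have hne : p2 x ≠ p2 (!x) := by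
      cases x
      · exact c2.symm
      · exact c2
    rcases lt_or_gt_of_ne hne with hl | hl
    · obtain ⟨r1, r2, r3⟩ := arith₁ ha (g2 x) hl hx
      refine ⟨r1, x, p2 (!x), r3, ?_⟩
      intro z
      revert r2
      cases x <;> cases z <;> simp
    · obtain ⟨r1, r2, r3⟩ := arith₁ ha (g2 (!x)) hl (by rw [add_right_comm]; exact hx)
      refine ⟨r1, !x, p2 x, r3, ?_⟩
      intro z
      revert r2
      cases x <;> cases z <;> simp
  by_cases h0 : fl 0 = true
  · have w1 := v1 (by rw [h0, hf1]; decide)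
    obtain ⟨x, hx⟩ := eu
    rw [h0, Bool.true_xor] at hx
    obtain ⟨r1, y, q, hq, hy⟩ := norm (p1 x) (by have := w1 x; have := g1 x; omega) ⟨x, hx⟩
    have s1 : ∀ z, p1 z = 4 := by
      intro z; rw [← r1]; cases x <;> cases z <;> simp [c1]
    by_cases h3 : fl 3 = true
    · right; right
      have w3 := v3 (by rw [h3, hf2]; decide)
      obtain ⟨x', hx'⟩ := du
      rw [h3, Bool.true_xor] at hx'
      obtain ⟨r3, -⟩ := norm (p3 x') (by have := w3 x'; have := g3 x'; omega) ⟨x', hx'⟩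
      have s3 : ∀ z, p3 z = 4 := by
        intro z; rw [← r3]; cases x' <;> cases z <;> simp [c3]
      refine ⟨q, hq, fun Φ => xor y (typ Φ), ?_, ?_, ?_, ?_, ?_⟩
      · rintro i (rfl | rfl) Φ
        · simp [hfl, hf1]
        · simp [hfl, hf2]
      · rintro i (rfl | rfl) Φ
        · simp [hfl, h0]
        · simp [hfl, h3]
      · intro Φ; rw [e1, s1]
      · intro Φ; rw [e3, s3]
      · intro Φ; rw [e2, hy]
    · right; left
      rw [Bool.not_eq_true] at h3
      have s3 : ∀ z, p3 z = 3 := by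
        have := arith₃ (g3 (!y)) (by rw [hy]; simp; omega) (du' h3 hf1 hf2 (!y))
        intro z; rw [← this]; cases y <;> cases z <;> simp [c3]
      refine ⟨q, hq, fun Φ => xor y (typ (G.dualCham.symm Φ)), ?_, ?_, ?_, ?_, ?_⟩
      · intro i hi Ψ
        obtain ⟨Φ, rfl⟩ := G.dualCham.surjective Ψ
        have : ρ i (G.dualCham Φ) = G.dualCham (ρ i.rev Φ) := by rw [dualCham_ρ, Fin.rev_rev]
        rw [this]; dsimp only; rw [Equiv.symm_apply_apply, Equiv.symm_apply_apply]
        have : i = 0 ∨ i = 1 ∨ i = 2 := by clear this; revert hi; revert i; decide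
        rcases this with rfl | rfl | rfl
        · rw [show Fin.rev (0 : Fin 4) = 3 from rfl, hfl, h3]; simp
        · rw [show Fin.rev (1 : Fin 4) = 2 from rfl, hfl, hf2]; simp
        · rw [show Fin.rev (2 : Fin 4) = 1 from rfl, hfl, hf1]; simp
      · intro Ψ
        obtain ⟨Φ, rfl⟩ := G.dualCham.surjective Ψ
        have : ρ 3 (G.dualCham Φ) = G.dualCham (ρ 0 Φ) := by rw [dualCham_ρ]; rfl
        rw [this]; dsimp only; rw [Equiv.symm_apply_apply, Equiv.symm_apply_apply, hfl, h0]; simp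
      · intro Ψ
        obtain ⟨Φ, rfl⟩ := G.dualCham.surjective Ψ
        rw [dual_per]
        exact (per_symm 2 3 Φ).trans (by rw [e3, s3])
      · intro Ψ
        obtain ⟨Φ, rfl⟩ := G.dualCham.surjective Ψ
        rw [dual_per]
        exact (per_symm 0 1 Φ).trans (by rw [e1, s1])
      · intro Ψ
        obtain ⟨Φ, rfl⟩ := G.dualCham.surjective Ψ
        rw [dual_per]; simp only [Equiv.symm_apply_apply]
        exact (per_symm 1 2 Φ).trans (by rw [e2, hy])
  · rw [Bool.not_eq_true] at h0
    have h3 : fl 3 = true := by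
      by_contra h3
      exact hnf ⟨h0, hf1, hf2, by simpa using h3⟩
    left
    have w3 := v3 (by rw [h3, hf2]; decide)
    obtain ⟨x', hx'⟩ := du
    rw [h3, Bool.true_xor] at hx'
    obtain ⟨r3, y, q, hq, hy⟩ := norm (p3 x') (by have := w3 x'; have := g3 x'; omega) ⟨x', hx'⟩
    have s3 : ∀ z, p3 z = 4 := by
      intro z; rw [← r3]; cases x' <;> cases z <;> simp [c3]
    have s1 : ∀ z, p1 z = 3 := by
      have := arith₃ (g1 (!y)) (by rw [hy]; simp; omega) (eu' h0 hf1 hf2 (!y))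
      intro z; rw [← this]; cases y <;> cases z <;> simp [c1]
    refine ⟨q, hq, fun Φ => xor y (typ Φ), ?_, ?_, ?_, ?_, ?_⟩
    · intro i hi Φ
      have : i = 0 ∨ i = 1 ∨ i = 2 := by revert hi; revert i; decide
      rcases this with rfl | rfl | rfl
      · simp [hfl, h0]
      · simp [hfl, hf1]
      · simp [hfl, hf2]
    · intro Φ; simp [hfl, h3]
    · intro Φ; rw [e1, s1]
    · intro Φ; rw [e3, s3]
    · intro Φ; rw [e2, hy]

end Geo

open scoped Classical

/-! ## Growth of chamber systems -/

namespace Geo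
variable {P : Type*} {G : Geo P}

/-- The number of chambers at gallery distance at most `n` from a given one grows at most
cubically. -/
def PolyGrowth (G : Geo P) : Prop := ∀ Φ0 : G.Cham, ∃ C : ℕ, ∀ n : ℕ, ∀ S : Finset (List (Fin 4)),
  (∀ l ∈ S, l.length ≤ n) → Set.InjOn (fun l : List (Fin 4) => l.foldr (fun i Φ => ρ i Φ) Φ0) S →
    S.card ≤ C * (n + 1) ^ 3

theorem PolyGrowth.dual (h : PolyGrowth G) : PolyGrowth G.dual := by
  intro Ψ0
  obtain ⟨Φ0, rfl⟩ := G.dualCham.surjective Ψ0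
  obtain ⟨C, hC⟩ := h Φ0
  have key : ∀ l : List (Fin 4), l.foldr (fun i Φ => ρ i Φ) (G.dualCham Φ0) =
      G.dualCham ((l.map Fin.rev).foldr (fun i Φ => ρ i Φ) Φ0) := by
    intro l
    induction l with
    | nil => rfl
    | cons i l ih =>
      rw [List.foldr_cons, ih, List.map_cons, List.foldr_cons, dualCham_ρ, Fin.rev_rev]
  have hinj : Function.Injective (List.map (Fin.rev : Fin 4 → Fin 4)) :=
    List.map_injective_iff.2 Fin.rev_injective
  refine ⟨C, fun n S hS hI => ?_⟩
  have := hC n (S.image (List.map Fin.rev)) (by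
    intro l hl
    obtain ⟨l', h', rfl⟩ := Finset.mem_image.1 hl
    rw [List.length_map]; exact hS _ h') (by
    intro l hl l' hl' h
    obtain ⟨m, hm, rfl⟩ := Finset.mem_image.1 (Finset.mem_coe.1 hl)
    obtain ⟨m', hm', rfl⟩ := Finset.mem_image.1 (Finset.mem_coe.1 hl')
    congr 1
    apply hI hm hm'
    dsimp only at h ⊢
    rw [key, key, h])
  rwa [Finset.card_image_of_injective _ hinj] at this

theorem lift_model {Y : Type*} (r : Fin 4 → Y → Y) (R : G.Cham → Y → Prop)
    (hR : ∀ i Φ y, R Φ y → R (ρ i Φ) (r i y)) (hinv : ∀ i y, r i (r i y) = y)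
    (hcyc : ∀ i j Φ y, R Φ y → i < j → (fun y => r i (r j y))^[per i j Φ] y = y)
    {Φ0 : G.Cham} {y0 : Y} (h0 : R Φ0 y0) :
    ∃ f : G.Cham → Y, f Φ0 = y0 ∧ ∀ i Φ, f (ρ i Φ) = r i (f Φ) := by
  let E := {e : G.Cham × Y // R e.1 e.2}
  let s : Fin 4 → Equiv.Perm Y := fun i => ⟨r i, r i, hinv i, hinv i⟩
  let r' : Fin 4 → Equiv.Perm E := fun i =>
    ⟨fun e => ⟨(ρ i e.1.1, r i e.1.2), hR _ _ _ e.2⟩, fun e => ⟨(ρ i e.1.1, r i e.1.2), hR _ _ _ e.2⟩,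
      fun e => by apply Subtype.ext; simp [hinv], fun e => by apply Subtype.ext; simp [hinv]⟩
  have hs : ∀ i j n y, ((s i * s j) ^ n) y = (fun y => r i (r j y))^[n] y := by
    intro i j n y
    rw [← Equiv.Perm.iterate_eq_pow]
    rfl
  have hp : ∀ i j (n : ℕ) (e : E), (((r' i * r' j) ^ n) e).1 = (((ρ i * ρ j : Equiv.Perm G.Cham) ^ n) e.1.1,
      ((s i * s j) ^ n) e.1.2) := by
    intro i j n e
    induction n with
    | zero => rfl
    | succ n ih =>
      rw [pow_succ', Equiv.Perm.mul_apply]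
      show (ρ i (ρ j (((r' i * r' j) ^ n) e).1.1), r i (r j (((r' i * r' j) ^ n) e).1.2)) = _
      rw [ih, pow_succ', pow_succ']
      rfl
  have hmul : ∀ i j (Φ : G.Cham) y n, R Φ y → i < j → per i j Φ ∣ n → ((s i * s j) ^ n) y = y := by
    rintro i j Φ y n hΦ hij ⟨k, rfl⟩
    rw [pow_mul]
    have h1 : ((s i * s j) ^ (per i j Φ)) y = y := by rw [hs]; exact hcyc i j Φ y hΦ hij
    induction k with
    | zero => rfl
    | succ k ih => rw [pow_succ, Equiv.Perm.mul_apply, h1, ih]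
  obtain ⟨f, hf0, hf⟩ := lift (G := G) (E := E) (fun e => e.1.1) r' (fun i e => rfl)
    (fun i e => by apply Subtype.ext; simp [r', hinv]) (c := ∅) (by intro p hp; simp at hp)
    (by
      intro e i j n _ _ _ hij h
      apply Subtype.ext
      rw [hp, h]
      apply Prod.ext
      · rfl
      · dsimp only
        rw [pow_fix] at h
        rcases lt_or_gt_of_ne hij with hl | hl
        · exact hmul i j _ _ _ e.2 hl h
        · rw [per_symm j i] at h
          have h2 := hmul j i _ _ _ e.2 hl h
          have : (s i * s j) = (s j * s i)⁻¹ := by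
            rw [eq_inv_iff_mul_eq_one]; ext y; simp [s, hinv]
          rw [this, inv_pow, Equiv.Perm.inv_eq_iff_eq]
          exact h2.symm) ⟨(Φ0, y0), h0⟩ (Finset.empty_subset _)
  refine ⟨fun Φ => (f Φ).1.2, ?_, ?_⟩
  · dsimp only
    rw [show f Φ0 = _ from hf0]
  · intro i Φ
    dsimp only
    rw [(hf Φ (Finset.empty_subset _)).2 i (by intro p hp; simp at hp)]
    rfl

/-- Words encoding elements of a free monoid of rank two. -/
def enc (a b c : List (Fin 4)) : List Bool → List (Fin 4)
  | [] => []
  | x :: l => a ++ ((if x then b else c) ++ enc a b c l)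

theorem enc_length (a b c : List (Fin 4)) (l : List Bool) :
    (enc a b c l).length ≤ l.length * (a.length + b.length + c.length) := by
  induction l with
  | nil => simp [enc]
  | cons x l ih =>
    have : (if x then b else c).length ≤ b.length + c.length := by cases x <;> simp
    simp only [enc, List.length_append, List.length_cons]
    nlinarith

theorem exp_beats (C L : ℕ) : ∃ n : ℕ, C * (n * L + 1) ^ 3 < 2 ^ n := by
  have h1 : Filter.Tendsto (fun n : ℕ => (n : ℝ) ^ 3 / 2 ^ n) Filter.atTop (nhds 0) := by
    have := tendsto_pow_const_div_const_pow_of_one_lt 3 (by norm_num : (1 : ℝ) < 2)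
    exact this
  have h2 : ∀ᶠ n : ℕ in Filter.atTop, (n : ℝ) ^ 3 / 2 ^ n < 1 / ((C + 1) * (L + 1) ^ 3 : ℝ) :=
    h1.eventually_lt_const (by positivity)
  obtain ⟨n, hn, hn1⟩ := (h2.and (Filter.eventually_ge_atTop 1)).exists
  refine ⟨n, ?_⟩
  rw [div_lt_div_iff₀ (by positivity) (by positivity)] at hn
  have h3 : (n * L + 1 : ℝ) ≤ n * (L + 1) := by
    have : (1 : ℝ) ≤ n := by exact_mod_cast hn1
    linarith
  have h4 : (C * (n * L + 1) ^ 3 : ℝ) ≤ (C + 1) * (n * (L + 1)) ^ 3 := by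
    have : (n * L + 1 : ℝ) ^ 3 ≤ (n * (L + 1)) ^ 3 := pow_le_pow_left₀ (by positivity) h3 3
    have h5 : (0 : ℝ) ≤ (n * L + 1 : ℝ) ^ 3 := by positivity
    have h6 : (0 : ℝ) ≤ C := by positivity
    nlinarith
  have : (C * (n * L + 1) ^ 3 : ℝ) < 2 ^ n := by
    refine h4.trans_lt ?_
    rw [mul_pow]; linarith
  exact_mod_cast this

theorem no_growth (hG : PolyGrowth G) {Y : Type*} (r : Fin 4 → Y → Y) (hinv : ∀ i y, r i (r i y) = y)
    (f : G.Cham → Y) (hf : ∀ i Φ, f (ρ i Φ) = r i (f Φ)) (Φ0 : G.Cham) (a b c : List (Fin 4))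
    (I : Set Y) (A B D : Y → ℝ) (c1 c2 c3 c4 c5 c6 : ℝ) (h1 : 2 ≤ c1) (h2 : 2 ≤ c2) (h3 : 2 ≤ c3)
    (h4 : 2 ≤ c4) (h5 : 2 ≤ c5) (h6 : 2 ≤ c6)
    (ha : ∀ y ∈ I, a.foldr r y ∈ I ∧ A (a.foldr r y) = - A y ∧ B (a.foldr r y) = B y + c1 * A y ∧
      D (a.foldr r y) = D y + c2 * A y)
    (hb : ∀ y ∈ I, b.foldr r y ∈ I ∧ B (b.foldr r y) = - B y ∧ A (b.foldr r y) = A y + c3 * B y ∧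
      D (b.foldr r y) = D y + c4 * B y)
    (hc : ∀ y ∈ I, c.foldr r y ∈ I ∧ D (c.foldr r y) = - D y ∧ A (c.foldr r y) = A y + c5 * D y ∧
      B (c.foldr r y) = B y + c6 * D y)
    (h0 : f Φ0 ∈ I ∧ A (f Φ0) < 0 ∧ 0 < A (f Φ0) + B (f Φ0) ∧ 0 < A (f Φ0) + D (f Φ0)) : False := by
  obtain ⟨C, hC⟩ := hG Φ0
  have hfw : ∀ l : List (Fin 4), f (l.foldr (fun i Φ => ρ i Φ) Φ0) = l.foldr r (f Φ0) := by
    intro l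
    induction l with
    | nil => rfl
    | cons i l ih => rw [List.foldr_cons, List.foldr_cons, hf, ih]
  have hinj : ∀ l : List (Fin 4), Function.Injective (fun y => l.foldr r y) := by
    intro l
    induction l with
    | nil => exact fun _ _ h => h
    | cons i l ih =>
      intro y z h
      apply ih
      have := congrArg (r i) h
      simpa only [List.foldr_cons, hinv] using this
  have mb : ∀ y ∈ I, A y < 0 → 0 < A y + B y → 0 < A y + D y →
      (b.foldr r y ∈ I ∧ B (b.foldr r y) < 0 ∧ 0 < B (b.foldr r y) + A (b.foldr r y) ∧
        0 < B (b.foldr r y) + D (b.foldr r y)) := by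
    intro y hy i1 i2 i3
    obtain ⟨j0, j1, j2, j3⟩ := hb y hy
    rw [j1, j2, j3]
    refine ⟨j0, by linarith, by nlinarith, by nlinarith⟩
  have mc : ∀ y ∈ I, A y < 0 → 0 < A y + B y → 0 < A y + D y →
      (c.foldr r y ∈ I ∧ D (c.foldr r y) < 0 ∧ 0 < D (c.foldr r y) + A (c.foldr r y) ∧
        0 < D (c.foldr r y) + B (c.foldr r y)) := by
    intro y hy i1 i2 i3
    obtain ⟨j0, j1, j2, j3⟩ := hc y hy
    rw [j1, j2, j3]
    refine ⟨j0, by linarith, by nlinarith, by nlinarith⟩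
  have ma : ∀ y ∈ I, 0 < A y + B y → 0 < A y + D y → 0 < A y →
      (a.foldr r y ∈ I ∧ A (a.foldr r y) < 0 ∧ 0 < A (a.foldr r y) + B (a.foldr r y) ∧
        0 < A (a.foldr r y) + D (a.foldr r y)) := by
    intro y hy i1 i2 i3
    obtain ⟨j0, j1, j2, j3⟩ := ha y hy
    rw [j1, j2, j3]
    refine ⟨j0, by linarith, by nlinarith, by nlinarith⟩
  have hmem : ∀ l : List Bool, (enc a b c l).foldr r (f Φ0) ∈ {y | y ∈ I ∧ A y < 0 ∧ 0 < A y + B y ∧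
      0 < A y + D y} := by
    intro l
    induction l with
    | nil => exact h0
    | cons x l ih =>
      obtain ⟨i0, i1, i2, i3⟩ := ih
      simp only [enc, List.foldr_append]
      cases x
      · obtain ⟨k0, k1, k2, k3⟩ := mc _ i0 i1 i2 i3
        exact ma _ k0 (by simp only [Bool.false_eq_true, if_false]; linarith)
          (by simp only [Bool.false_eq_true, if_false]; linarith)
          (by simp only [Bool.false_eq_true, if_false]; linarith)
      · obtain ⟨k0, k1, k2, k3⟩ := mb _ i0 i1 i2 i3
        exact ma _ k0 (by simp only [if_true]; linarith) (by simp only [if_true]; linarith)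
          (by simp only [if_true]; linarith)
  have hfree : ∀ l l' : List Bool, l.length = l'.length →
      (enc a b c l).foldr r (f Φ0) = (enc a b c l').foldr r (f Φ0) → l = l' := by
    intro l
    induction l with
    | nil => intro l' h _; exact (List.length_eq_zero_iff.1 h.symm).symm
    | cons x l ih =>
      intro l' h h'
      cases l' with
      | nil => simp at h
      | cons x' l' =>
        simp only [enc, List.foldr_append] at h'
        have h'' := hinj a h'
        obtain ⟨i0, i1, i2, i3⟩ := hmem l
        obtain ⟨i0', i1', i2', i3'⟩ := hmem l'
        have hl : l.length = l'.length := by simpa using h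
        cases x <;> cases x'
        · rw [ih l' hl (hinj c h'')]
        · exfalso
          simp only [Bool.false_eq_true, if_false, if_true] at h''
          obtain ⟨k0, k1, k2, k3⟩ := mc _ i0 i1 i2 i3
          obtain ⟨k0', k1', k2', k3'⟩ := mb _ i0' i1' i2' i3'
          rw [h''] at k1 k2 k3
          linarith
        · exfalso
          simp only [Bool.false_eq_true, if_false, if_true] at h''
          obtain ⟨k0, k1, k2, k3⟩ := mb _ i0 i1 i2 i3
          obtain ⟨k0', k1', k2', k3'⟩ := mc _ i0' i1' i2' i3'
          rw [h''] at k1 k2 k3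
          linarith
        · rw [ih l' hl (hinj b h'')]
  obtain ⟨n, hn⟩ := exp_beats C (a.length + b.length + c.length)
  let e : (Fin n → Bool) → List (Fin 4) := fun x => enc a b c (List.ofFn x)
  have einj : ∀ x x', (e x).foldr r (f Φ0) = (e x').foldr r (f Φ0) → x = x' := by
    intro x x' h
    exact List.ofFn_injective (hfree _ _ (by simp) h)
  have := hC (n * (a.length + b.length + c.length)) (Finset.univ.image e) (by
      intro l hl
      obtain ⟨x, -, rfl⟩ := Finset.mem_image.1 hl
      refine (enc_length _ _ _ _).trans (by simp)) (by
      intro l hl l' hl' h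
      obtain ⟨x, -, rfl⟩ := Finset.mem_image.1 (Finset.mem_coe.1 hl)
      obtain ⟨x', -, rfl⟩ := Finset.mem_image.1 (Finset.mem_coe.1 hl')
      dsimp only at h
      have := congrArg f h
      rw [hfw, hfw] at this
      rw [einj x x' this])
  rw [Finset.card_image_of_injective _ (fun x x' h => einj x x' (by rw [h]))] at this
  simp at this
  omega

/-- Generators of the reflection group of the first diagram. -/
def sA (φ : ℝ) : Fin 4 → ℝ × ℝ × ℝ × ℝ → ℝ × ℝ × ℝ × ℝ
  | 0, (a, b, c, d) => (-a, b + a, c, d)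
  | 1, (a, b, c, d) => (a + b, -b, c + b, d + φ * b)
  | 2, (a, b, c, d) => (a, b + c, -c, d)
  | 3, (a, b, c, d) => (a, b + φ * d, c, -d)

/-- Generators of the reflection group of the cyclic diagrams. -/
def sB (m n : ℝ) : Fin 4 → ℝ × ℝ × ℝ × ℝ → ℝ × ℝ × ℝ × ℝ
  | 0, (a, b, c, d) => (-a, b + a, c, d + m * a)
  | 1, (a, b, c, d) => (a + b, -b, c + n * b, d)
  | 2, (a, b, c, d) => (a, b + m * c, -c, d + c)
  | 3, (a, b, c, d) => (a + n * d, b, c + d, -d)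

/-- The first model chamber system. -/
def rA (φ : ℝ) : Fin 4 → Bool × (ℝ × ℝ × ℝ × ℝ) → Bool × (ℝ × ℝ × ℝ × ℝ)
  | 0, (t, v) => (t, sA φ 0 v)
  | 1, (t, v) => (t, sA φ 1 v)
  | 2, (t, v) => (t, sA φ (if t then 3 else 2) v)
  | 3, (t, v) => (!t, v)

/-- The second model chamber system. -/
def rB (m n : ℝ) : Fin 4 → Bool × Bool × (ℝ × ℝ × ℝ × ℝ) → Bool × Bool × (ℝ × ℝ × ℝ × ℝ)
  | 0, (x, z, v) => (!x, z, v)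
  | 1, (x, z, v) => (x, z, sB m n (if x then 2 else 0) v)
  | 2, (x, z, v) => (x, z, sB m n (if z then 3 else 1) v)
  | 3, (x, z, v) => (x, !z, v)

theorem dataA_absurd (hG : PolyGrowth G) (h : DataA 5 G) : False := by
  obtain ⟨typ, h1, h2, h3, h4, h5⟩ := h
  obtain ⟨φ, hφ, hφ0⟩ : ∃ φ : ℝ, φ ^ 2 = φ + 1 ∧ 1 < φ :=
    ⟨Real.goldenRatio, Real.goldenRatio_sq, Real.one_lt_goldenRatio⟩
  obtain ⟨Φ0, hΦ0⟩ : ∃ Φ0, typ Φ0 = false := by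
    obtain ⟨Φ⟩ := G.nonempty_cham
    by_cases h : typ Φ = false
    · exact ⟨Φ, h⟩
    · exact ⟨ρ 3 Φ, by rw [h2]; simpa using h⟩
  have hinv : ∀ i y, rA φ i (rA φ i y) = y := by
    rintro i ⟨t, a, b, c, d⟩
    fin_cases i <;> cases t <;> simp [rA, sA]
  obtain ⟨f, hf0, hf⟩ := lift_model (G := G) (rA φ) (fun Φ y => typ Φ = y.1) (by
      rintro i Φ ⟨t, v⟩ h
      dsimp only at h
      by_cases hi : i = 3
      · subst hi; rw [h2, h]; rfl
      · rw [h1 i hi, h]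
        fin_cases i <;> first | rfl | exact absurd rfl hi) hinv (by
      rintro i j Φ ⟨t, a, b, c, d⟩ h hij
      dsimp only at h
      have : (i = 0 ∧ j = 1) ∨ (i = 0 ∧ j = 2) ∨ (i = 0 ∧ j = 3) ∨ (i = 1 ∧ j = 2) ∨
          (i = 1 ∧ j = 3) ∨ (i = 2 ∧ j = 3) := by
        clear h; revert i j; decide
      rcases this with ⟨rfl, rfl⟩ | ⟨rfl, rfl⟩ | ⟨rfl, rfl⟩ | ⟨rfl, rfl⟩ | ⟨rfl, rfl⟩ | ⟨rfl, rfl⟩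
      · rw [h3]; cases t <;> simp [rA, sA] <;> grind
      · rw [per_two (by decide)]; cases t <;> simp [rA, sA] <;> try ring
      · rw [per_two (by decide)]; cases t <;> simp [rA, sA] <;> try ring
      · rw [h5, h]; cases t <;> simp [rA, sA] <;> grind
      · rw [per_two (by decide)]; cases t <;> simp [rA, sA] <;> try ring
      · rw [h4]; cases t <;> simp [rA, sA] <;> ring) (Φ0 := Φ0) (y0 := (false, (-1, 0, 1, 3/4))) hΦ0
  refine no_growth hG (rA φ) hinv f hf Φ0 [0, 1, 3, 2, 3, 2, 1, 2, 3, 2, 3, 1, 0]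
    [2, 1, 3, 2, 3, 1, 0, 1, 3, 2, 3, 1, 2] [3, 2, 3, 1, 3, 2, 3] {y | y.1 = false}
    (fun y => (1 + φ) * y.2.1 + (1 + φ) * y.2.2.1 + y.2.2.2.1 + φ * y.2.2.2.2)
    (fun y => y.2.1 + (1 + φ) * y.2.2.1 + (1 + φ) * y.2.2.2.1 + φ * y.2.2.2.2)
    (fun y => y.2.2.1 + φ * y.2.2.2.2) (2 * φ) (1 + φ) (2 * φ) (1 + φ) (1 + φ) (1 + φ)
    (by linarith) (by linarith) (by linarith) (by linarith) (by linarith) (by linarith) ?_ ?_ ?_ ?_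
  · rintro ⟨t, a, b, c, d⟩ rfl
    simp [rA, sA]
    grind
  · rintro ⟨t, a, b, c, d⟩ rfl
    simp [rA, sA]
    grind
  · rintro ⟨t, a, b, c, d⟩ rfl
    simp [rA, sA]
    grind
  · rw [hf0]
    refine ⟨rfl, ?_, ?_, ?_⟩ <;> dsimp only <;> linarith

theorem DataB.aux {q : ℕ} (h : DataB q G) {m n : ℝ}
    (hq : ∀ i j y, (i = 0 ∧ j = 3 ∨ i = 2 ∧ j = 1) →
      (fun y => sB m n i (sB m n j y))^[q] y = y) (v : ℝ × ℝ × ℝ × ℝ) :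
    (∀ i y, rB m n i (rB m n i y) = y) ∧ ∃ (Φ0 : G.Cham) (f : G.Cham → _),
      f Φ0 = (false, false, v) ∧ ∀ i Φ, f (ρ i Φ) = rB m n i (f Φ) := by
  obtain ⟨typ, h1, h2, h3, h4, h5⟩ := h
  obtain ⟨Φ0, hΦ0⟩ : ∃ Φ0, typ Φ0 = false := by
    obtain ⟨Φ⟩ := G.nonempty_cham
    by_cases h : typ Φ = false
    · exact ⟨Φ, h⟩
    · exact ⟨ρ 3 Φ, by rw [h2 3 (Or.inr rfl)]; simpa using h⟩
  have hinv : ∀ i y, rB m n i (rB m n i y) = y := by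
    rintro i ⟨x, z, a, b, c, d⟩
    fin_cases i <;> cases x <;> cases z <;> simp [rB, sB]
  have h01 : ∀ i j y, (i = 0 ∧ j = 1 ∨ i = 2 ∧ j = 3) →
      (fun y => sB m n i (sB m n j y))^[3] y = y := by
    rintro i j ⟨a, b, c, d⟩ (⟨rfl, rfl⟩ | ⟨rfl, rfl⟩) <;> simp [sB] <;> grind
  have hit : ∀ (k : ℕ) x z v, (fun y => rB m n 1 (rB m n 2 y))^[k] (x, z, v) = (x, z,
      (fun y => sB m n (if x then 2 else 0) (sB m n (if z then 3 else 1) y))^[k] v) := by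
    intro k x z
    induction k with
    | zero => intro v; rfl
    | succ k ih => intro v; rw [Function.iterate_succ_apply, Function.iterate_succ_apply]; exact ih _
  refine ⟨hinv, Φ0, lift_model (G := G) (rB m n) (fun Φ y => typ Φ = xor y.1 y.2.1) (by
      rintro i Φ ⟨x, z, v⟩ h
      dsimp only at h
      fin_cases i
      · refine (h2 0 (Or.inl rfl) Φ).trans ?_; rw [h]; simp [rB]
      · refine (h1 1 (Or.inl rfl) Φ).trans ?_; rw [h]; simp [rB]
      · refine (h1 2 (Or.inr rfl) Φ).trans ?_; rw [h]; simp [rB]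
      · refine (h2 3 (Or.inr rfl) Φ).trans ?_; rw [h]; simp [rB]) hinv (by
      rintro i j Φ ⟨x, z, a, b, c, d⟩ h hij
      dsimp only at h
      have : (i = 0 ∧ j = 1) ∨ (i = 0 ∧ j = 2) ∨ (i = 0 ∧ j = 3) ∨ (i = 1 ∧ j = 2) ∨
          (i = 1 ∧ j = 3) ∨ (i = 2 ∧ j = 3) := by
        clear h; revert i j; decide
      rcases this with ⟨rfl, rfl⟩ | ⟨rfl, rfl⟩ | ⟨rfl, rfl⟩ | ⟨rfl, rfl⟩ | ⟨rfl, rfl⟩ | ⟨rfl, rfl⟩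
      · rw [h3]; cases x <;> simp [rB, sB] <;> grind
      · rw [per_two (by decide)]; cases x <;> cases z <;> simp [rB, sB]
      · rw [per_two (by decide)]; cases x <;> cases z <;> simp [rB, sB]
      · rw [hit, h5, h]
        cases x <;> cases z
        · simpa using h01 0 1 _ (by simp)
        · simpa using hq 0 3 _ (by simp)
        · simpa using hq 2 1 _ (by simp)
        · simpa using h01 2 3 _ (by simp)
      · rw [per_two (by decide)]; cases x <;> cases z <;> simp [rB, sB]
      · rw [h4]; cases z <;> simp [rB, sB] <;> grind) (Φ0 := Φ0) (y0 := (false, false, v)) hΦ0⟩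

theorem dataB_absurd {q : ℕ} (hq : q = 4 ∨ q = 5) (hG : PolyGrowth G) (h : DataB q G) : False := by
  rcases hq with rfl | rfl
  · obtain ⟨hinv, Φ0, f, hf0, hf⟩ := h.aux (m := 2) (n := 1) (by
      rintro i j ⟨a, b, c, d⟩ (⟨rfl, rfl⟩ | ⟨rfl, rfl⟩) <;> simp [sB] <;> grind) (-1, 0, 1/2, 3)
    refine no_growth hG (rB 2 1) hinv f hf Φ0 [1, 2, 0, 1, 0, 2, 1]
      [0, 1, 0, 3, 2, 3, 1, 3, 2, 3, 0, 1, 0] [3, 2, 3, 2, 1, 2, 3, 2, 3]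
      {y | y.1 = false ∧ y.2.1 = false} (fun y => y.2.2.1 + y.2.2.2.1 + y.2.2.2.2.1)
      (fun y => y.2.2.1 + y.2.2.2.2.1 + y.2.2.2.2.2) (fun y => y.2.2.1 + y.2.2.2.1 + y.2.2.2.2.2)
      3 3 3 5 3 2 (by norm_num) (by norm_num) (by norm_num) (by norm_num) (by norm_num) (by norm_num)
      ?_ ?_ ?_ ?_
    · rintro ⟨x, z, a, b, c, d⟩ ⟨rfl, rfl⟩
      simp [rB, sB]
      grind
    · rintro ⟨x, z, a, b, c, d⟩ ⟨rfl, rfl⟩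
      simp [rB, sB]
      grind
    · rintro ⟨x, z, a, b, c, d⟩ ⟨rfl, rfl⟩
      simp [rB, sB]
      grind
    · rw [hf0]
      refine ⟨⟨rfl, rfl⟩, ?_, ?_, ?_⟩ <;> dsimp only <;> norm_num
  · obtain ⟨φ, hφ, hφ0⟩ : ∃ φ : ℝ, φ ^ 2 = φ + 1 ∧ 1 < φ :=
      ⟨Real.goldenRatio, Real.goldenRatio_sq, Real.one_lt_goldenRatio⟩
    obtain ⟨hinv, Φ0, f, hf0, hf⟩ := h.aux (m := φ) (n := φ) (by
      rintro i j ⟨a, b, c, d⟩ (⟨rfl, rfl⟩ | ⟨rfl, rfl⟩) <;> simp [sB] <;> grind) (-1, 1, 1, 1)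
    refine no_growth hG (rB φ φ) hinv f hf Φ0 [1, 3, 2, 3, 1]
      [3, 2, 3, 0, 1, 0, 2, 1, 2, 0, 1, 0, 3, 2, 3] [0, 1, 0, 2, 0, 1, 0]
      {y | y.1 = false ∧ y.2.1 = false} (fun y => φ * y.2.2.1 + y.2.2.2.2.2)
      (fun y => y.2.2.1 + y.2.2.2.1 + φ * y.2.2.2.2.1 + 2 * φ * y.2.2.2.2.2)
      (fun y => y.2.2.2.1 + φ * y.2.2.2.2.1)
      (2 + φ) (2 * φ) (2 + φ) (1 + 2 * φ) (2 * φ) (1 + 2 * φ) (by linarith) (by linarith)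
      (by linarith) (by linarith) (by linarith) (by linarith)
      ?_ ?_ ?_ ?_
    · rintro ⟨x, z, a, b, c, d⟩ ⟨rfl, rfl⟩
      simp [rB, sB]
      grind
    · rintro ⟨x, z, a, b, c, d⟩ ⟨rfl, rfl⟩
      simp [rB, sB]
      grind
    · rintro ⟨x, z, a, b, c, d⟩ ⟨rfl, rfl⟩
      simp [rB, sB]
      grind
    · rw [hf0]
      refine ⟨⟨rfl, rfl⟩, ?_, ?_, ?_⟩ <;> dsimp only <;> linarith

/-- The combinatorial classification. -/
theorem TwoOrb.classify' {typ : G.Cham → Bool} (h : TwoOrb G typ) (hG : PolyGrowth G) :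
    DataA 4 G ∨ DataA 4 G.dual := by
  rcases h.classify with ⟨q, rfl | rfl, h⟩ | ⟨q, rfl | rfl, h⟩ | ⟨q, hq, h⟩
  · exact Or.inl h
  · exact (dataA_absurd hG h).elim
  · exact Or.inr h
  · exact (dataA_absurd hG.dual h).elim
  · exact (dataB_absurd hq hG h).elim

end Geo

open scoped Classical

/-! ## Exposed faces of polytopes -/

namespace Poly

theorem exposed_support {A F : Set E3} (hF : IsExposed ℝ A F) {ι : Type*} {s : Finset ι} {w : ι → ℝ}
    {z : ι → E3} (hw : ∀ i ∈ s, 0 < w i) (hw1 : ∑ i ∈ s, w i = 1) (hz : ∀ i ∈ s, z i ∈ A)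
    (hx : ∑ i ∈ s, w i • z i ∈ F) : ∀ i ∈ s, z i ∈ F := by
  obtain ⟨l, rfl⟩ := hF ⟨_, hx⟩
  set x := ∑ i ∈ s, w i • z i with hxd
  have h0 : ∑ i ∈ s, w i * (l x - l (z i)) = 0 := by
    simp only [mul_sub, Finset.sum_sub_distrib, ← Finset.sum_mul, hw1, one_mul]
    rw [hxd]
    simp [map_sum]
  have h1 := (Finset.sum_eq_zero_iff_of_nonneg (fun i hi =>
    mul_nonneg (hw i hi).le (sub_nonneg.2 (hx.2 _ (hz i hi))))).1 h0
  intro i hi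
  have h2 : l x = l (z i) := by
    have := (mul_eq_zero.1 (h1 i hi)).resolve_left (hw i hi).ne'
    linarith
  exact ⟨hz i hi, fun y hy => by rw [← h2]; exact hx.2 y hy⟩

theorem face_eq_hull {S : Finset E3} {F : Set E3} (hF : IsExposed ℝ (convexHull ℝ (S : Set E3)) F) :
    F = convexHull ℝ ((S : Set E3) ∩ F) := by
  apply Set.Subset.antisymm
  · intro x hx
    obtain ⟨w, hw0, hw1, hwx⟩ := Finset.mem_convexHull'.1 (hF.subset hx)
    have e1 : ∑ y ∈ S.filter (fun y => w y ≠ 0), w y = 1 := by rw [Finset.sum_filter_ne_zero, hw1]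
    have e2 : ∑ y ∈ S.filter (fun y => w y ≠ 0), w y • y = x := by
      rw [← hwx]
      apply Finset.sum_subset (Finset.filter_subset _ _)
      intro y hy hy'
      have : w y = 0 := by
        by_contra h
        exact hy' (Finset.mem_filter.2 ⟨hy, h⟩)
      rw [this, zero_smul]
    have h3 := exposed_support hF (s := S.filter (fun y => w y ≠ 0)) (w := w) (z := id)
      (fun i hi => lt_of_le_of_ne (hw0 i (Finset.mem_filter.1 hi).1) (Finset.mem_filter.1 hi).2.symm)
      e1 (fun i hi => subset_convexHull ℝ _ (Finset.mem_coe.2 (Finset.mem_filter.1 hi).1))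
      (by simpa [e2] using hx)
    rw [← e2]
    refine (convex_convexHull ℝ _).sum_mem (fun i hi => hw0 i (Finset.mem_filter.1 hi).1) e1
      (fun i hi => subset_convexHull ℝ _ ⟨Finset.mem_coe.2 (Finset.mem_filter.1 hi).1, h3 i hi⟩)
  · exact convexHull_min Set.inter_subset_right (hF.convex (convex_convexHull ℝ _))

theorem finite_faces (S : Finset E3) : {F | IsExposed ℝ (convexHull ℝ (S : Set E3)) F}.Finite := by
  refine ((S.finite_toSet.finite_subsets).image (fun A => convexHull ℝ A)).subset ?_
  intro F hF
  exact ⟨(S : Set E3) ∩ F, Set.inter_subset_left, (face_eq_hull hF).symm⟩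

theorem exposed_trans {S : Finset E3} {F K : Set E3} (hF : IsExposed ℝ (convexHull ℝ (S : Set E3)) F)
    (hK : IsExposed ℝ F K) : IsExposed ℝ (convexHull ℝ (S : Set E3)) K := by
  rintro ⟨k, hk⟩
  have hkF : k ∈ F := hK.subset hk
  obtain ⟨m, hm⟩ := hK ⟨k, hk⟩
  obtain ⟨l, hl⟩ := hF ⟨k, hkF⟩
  have hk' : ∀ y ∈ F, m y ≤ m k := by rw [hm] at hk; exact hk.2
  have hkl : ∀ y ∈ convexHull ℝ (S : Set E3), l y ≤ l k := by rw [hl] at hkF; exact hkF.2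
  have hFmem : ∀ y ∈ convexHull ℝ (S : Set E3), l k ≤ l y → y ∈ F := by
    intro y hy h
    rw [hl]
    exact ⟨hy, fun z hz => (hkl z hz).trans h⟩
  have hKmem : ∀ y ∈ F, m k ≤ m y → y ∈ K := by
    intro y hy h
    rw [hm]
    exact ⟨hy, fun z hz => (hk' z hz).trans h⟩
  obtain ⟨ε, hε0, hε⟩ : ∃ ε > 0, ∀ s ∈ S, s ∉ F → l s + ε * m s < l k + ε * m k := by
    have : ∀ᶠ ε : ℝ in nhdsWithin 0 (Set.Ioi 0), ∀ s ∈ S, s ∉ F → l s + ε * m s < l k + ε * m k := by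
      rw [Filter.eventually_all_finset]
      intro s hs
      by_cases hsF : s ∈ F
      · exact Filter.Eventually.of_forall fun _ h => absurd hsF h
      have hlt : l s < l k := by
        by_contra h
        exact hsF (hFmem s (subset_convexHull ℝ _ hs) (not_lt.1 h))
      have hc : ContinuousAt (fun ε : ℝ => l k + ε * m k - (l s + ε * m s)) 0 := by fun_prop
      have := hc.eventually (lt_mem_nhds (a := 0) (by simpa using hlt))
      filter_upwards [this.filter_mono nhdsWithin_le_nhds] with ε hε _
      linarith
    obtain ⟨ε, h1, h2⟩ := (this.and self_mem_nhdsWithin).exists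
    exact ⟨ε, h2, h1⟩
  set n : StrongDual ℝ E3 := l + ε • m with hn
  have hnv : ∀ y, n y = l y + ε * m y := fun y => by simp [hn]
  have hS : ∀ s ∈ S, n s ≤ n k := by
    intro s hs
    rw [hnv, hnv]
    by_cases hsF : s ∈ F
    · have := hk' s hsF
      have := hkl s (subset_convexHull ℝ _ hs)
      nlinarith
    · exact (hε s hs hsF).le
  have hS' : ∀ y ∈ convexHull ℝ (S : Set E3), n y ≤ n k := by
    intro y hy
    have : convexHull ℝ (S : Set E3) ⊆ {y | n y ≤ n k} :=
      convexHull_min (fun s hs => hS s hs) (convex_halfSpace_le n.toLinearMap.isLinear _)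
    exact this hy
  refine ⟨n, ?_⟩
  apply Set.Subset.antisymm
  · intro x hx
    have hxF := hK.subset hx
    refine ⟨hF.subset hxF, fun y hy => (hS' y hy).trans ?_⟩
    rw [hnv, hnv]
    have h1 : l k ≤ l x := by rw [hl] at hxF; exact hxF.2 k (hF.subset hkF)
    have h2 : m k ≤ m x := by rw [hm] at hx; exact hx.2 k hkF
    nlinarith
  · have hexp : IsExposed ℝ (convexHull ℝ (S : Set E3)) {x ∈ convexHull ℝ (S : Set E3) |
        ∀ y ∈ convexHull ℝ (S : Set E3), n y ≤ n x} := fun _ => ⟨n, rfl⟩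
    rw [face_eq_hull hexp]
    refine convexHull_min ?_ (hK.convex (hF.convex (convex_convexHull ℝ _)))
    rintro s ⟨hs, hs1, hs2⟩
    have h1 := hs2 k (hF.subset hkF)
    have hsF : s ∈ F := by
      by_contra h
      have := hε s hs h
      rw [hnv, hnv] at h1
      linarith
    apply hKmem s hsF
    rw [hnv, hnv] at h1
    have := hkl s hs1
    by_contra h
    push Not at h
    nlinarith

open Pointwise in
theorem extend_or {F : Set E3} (hF : Convex ℝ F) {b y : E3} (hb : b ∈ F) (hy : y ∈ F) :
    (∃ δ : ℝ, 0 < δ ∧ y + δ • (y - b) ∈ F) ∨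
      ∃ l : StrongDual ℝ E3, (∀ x ∈ F, l x ≤ l y) ∧ ∃ x ∈ F, l x < l y := by
  set V := (affineSpan ℝ F).direction with hV
  obtain ⟨W, hW⟩ := V.exists_isCompl
  set F' : Set E3 := F + (W : Set E3) with hF'
  have hconv : Convex ℝ F' := hF.add W.convex
  have hsub : F ⊆ F' := fun x hx => ⟨x, hx, 0, W.zero_mem, add_zero x⟩
  have hInter : (interior F').Nonempty := by
    rw [hconv.interior_nonempty_iff_affineSpan_eq_top]
    rw [← AffineSubspace.direction_eq_top_iff_of_nonempty
      ((affineSpan_nonempty ℝ).2 ⟨y, hsub hy⟩), eq_top_iff, ← hW.sup_eq_top]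
    refine sup_le (AffineSubspace.direction_le (affineSpan_mono ℝ hsub)) ?_
    intro w hw
    have h1 : y + w ∈ affineSpan ℝ F' := subset_affineSpan ℝ _ ⟨y, hy, w, hw, rfl⟩
    have h2 : y ∈ affineSpan ℝ F' := subset_affineSpan ℝ _ (hsub hy)
    simpa using AffineSubspace.vsub_mem_direction h1 h2
  by_cases hyi : y ∈ interior F'
  · left
    have hc : ContinuousAt (fun δ : ℝ => y + δ • (y - b)) 0 := by fun_prop
    have h1 : ∀ᶠ δ : ℝ in nhdsWithin 0 (Set.Ioi 0), y + δ • (y - b) ∈ F' :=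
      (hc.eventually (by simpa using mem_interior_iff_mem_nhds.1 hyi)).filter_mono nhdsWithin_le_nhds
    obtain ⟨δ, ⟨x, hx, w, hw, hxw⟩, hδ⟩ := (h1.and self_mem_nhdsWithin).exists
    refine ⟨δ, hδ, ?_⟩
    have hmem : ∀ {p q : E3}, p ∈ F → q ∈ F → p - q ∈ V := fun hp hq =>
      AffineSubspace.vsub_mem_direction (subset_affineSpan ℝ _ hp) (subset_affineSpan ℝ _ hq)
    have hwV : w ∈ V := by
      have : w = (y - x) + δ • (y - b) := by
        have : w = (x + w) - x := by simp
        rw [this]; simp only at hxw; rw [hxw]; abel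
      rw [this]
      exact V.add_mem (hmem hy hx) (V.smul_mem _ (hmem hy hb))
    have : w = 0 := by
      have := hW.inf_eq_bot
      rw [Submodule.eq_bot_iff] at this
      exact this w ⟨hwV, hw⟩
    simp only at hxw
    rw [← hxw, this, add_zero]
    exact hx
  · right
    obtain ⟨l, hl⟩ := geometric_hahn_banach_open_point hconv.interior isOpen_interior hyi
    have hle : ∀ x ∈ F', l x ≤ l y := by
      intro x hx
      have h1 : x ∈ closure (interior F') := by
        rw [hconv.closure_interior_eq_closure_of_nonempty_interior hInter]
        exact subset_closure hx
      have : closure (interior F') ⊆ {x | l x ≤ l y} :=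
        closure_minimal (fun x hx => (hl x hx).le) (isClosed_le l.continuous continuous_const)
      exact this h1
    have hlW : ∀ w ∈ W, l w = 0 := by
      intro w hw
      have h1 := hle _ ⟨y, hy, w, hw, rfl⟩
      have h2 := hle _ ⟨y, hy, -w, W.neg_mem hw, rfl⟩
      simp only [map_add, map_neg] at h1 h2
      linarith
    refine ⟨l, fun x hx => hle x (hsub hx), ?_⟩
    obtain ⟨z, hz⟩ := hInter
    obtain ⟨x, hx, w, hw, rfl⟩ := interior_subset hz
    refine ⟨x, hx, ?_⟩
    have := hl _ hz
    simpa [hlW w hw] using this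

end Poly

open scoped Classical

/-! ## The geometry of a tiling -/

namespace Tiling
variable {T : Set (Set E3)}

/-- Faces of a tiling. -/
def IsFace (T : Set (Set E3)) (F : Set E3) : Prop := ∃ t ∈ T, IsExposed ℝ t F

/-- Nonempty faces of a tiling. -/
def NF (T : Set (Set E3)) : Type := {F : Set E3 // F.Nonempty ∧ IsFace T F}

noncomputable instance : PartialOrder (NF T) := Subtype.partialOrder _

theorem NF.le_iff {p q : NF T} : p ≤ q ↔ p.1 ⊆ q.1 := Iff.rfl

theorem trans_tile (hT : IsLFCTiling T) {t F K : Set E3} (ht : t ∈ T) (hF : IsExposed ℝ t F)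
    (hK : IsExposed ℝ F K) : IsExposed ℝ t K := by
  obtain ⟨⟨S, rfl⟩, -⟩ := hT.polytope t ht
  exact Poly.exposed_trans hF hK

theorem inter_tile (hT : IsLFCTiling T) {t F K : Set E3} (ht : t ∈ T) (hF : IsExposed ℝ t F)
    (hK : IsFace T K) : IsExposed ℝ t (F ∩ K) := by
  obtain ⟨s, hs, hK⟩ := hK
  obtain ⟨h1, h2⟩ := hT.face_to_face t ht s hs
  have e1 : IsExposed ℝ (t ∩ s) (F ∩ s) := by
    have : IsExposed ℝ t (F ∩ s) := by
      have := hF.inter h1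
      rwa [← Set.inter_assoc, Set.inter_eq_left.2 hF.subset] at this
    exact this.mono Set.inter_subset_left (Set.inter_subset_inter_left _ hF.subset)
  have e2 : IsExposed ℝ (t ∩ s) (t ∩ K) := by
    have : IsExposed ℝ s (t ∩ K) := by
      have := h2.inter hK
      rwa [Set.inter_assoc, Set.inter_eq_right.2 hK.subset] at this
    exact this.mono Set.inter_subset_right (Set.inter_subset_inter_right _ hK.subset)
  have e3 := e1.inter e2
  have : F ∩ s ∩ (t ∩ K) = F ∩ K := by
    ext x
    constructor
    · rintro ⟨⟨h1, h2⟩, h3, h4⟩; exact ⟨h1, h4⟩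
    · rintro ⟨h1, h2⟩; exact ⟨⟨h1, hK.subset h2⟩, hF.subset h1, h2⟩
  rw [this] at e3
  exact trans_tile hT ht h1 e3

theorem inter_face (hT : IsLFCTiling T) {F K : Set E3} (hF : IsFace T F) (hK : IsFace T K) :
    IsFace T (F ∩ K) := by
  obtain ⟨t, ht, hF⟩ := hF
  exact ⟨t, ht, inter_tile hT ht hF hK⟩

theorem exposed_of_subset_tile (hT : IsLFCTiling T) {t F : Set E3} (ht : t ∈ T) (hF : IsFace T F)
    (h : F ⊆ t) : IsExposed ℝ t F := by
  have := inter_tile hT ht (IsExposed.refl t) hF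
  rwa [Set.inter_eq_right.2 h] at this

theorem exposed_of_subset (hT : IsLFCTiling T) {F K : Set E3} (hF : IsFace T F) (hK : IsFace T K)
    (h : F ⊆ K) : IsExposed ℝ K F := by
  obtain ⟨t, ht, hK⟩ := hK
  exact (exposed_of_subset_tile hT ht hF (h.trans hK.subset)).mono hK.subset h

theorem face_of_exposed (hT : IsLFCTiling T) {F K : Set E3} (hK : IsFace T K) (h : IsExposed ℝ K F) :
    IsFace T F := by
  obtain ⟨t, ht, hK⟩ := hK
  exact ⟨t, ht, trans_tile hT ht hK h⟩

theorem tile_convex (hT : IsLFCTiling T) {t : Set E3} (ht : t ∈ T) : Convex ℝ t := by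
  obtain ⟨⟨S, rfl⟩, -⟩ := hT.polytope t ht
  exact convex_convexHull ℝ _

theorem tile_compact (hT : IsLFCTiling T) {t : Set E3} (ht : t ∈ T) : IsCompact t := by
  obtain ⟨⟨S, rfl⟩, -⟩ := hT.polytope t ht
  exact S.finite_toSet.isCompact_convexHull (𝕜 := ℝ)

theorem face_convex (hT : IsLFCTiling T) {F : Set E3} (hF : IsFace T F) : Convex ℝ F := by
  obtain ⟨t, ht, hF⟩ := hF
  exact hF.convex (tile_convex hT ht)

theorem face_compact (hT : IsLFCTiling T) {F : Set E3} (hF : IsFace T F) : IsCompact F := by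
  obtain ⟨t, ht, hF⟩ := hF
  exact hF.isCompact (tile_compact hT ht)

theorem finite_meet (hT : IsLFCTiling T) {B : Set E3} (hB : Bornology.IsBounded B) :
    {F | ∃ K, IsFace T F ∧ F ⊆ K ∧ IsFace T K ∧ (K ∩ B).Nonempty}.Finite := by
  refine ((hT.locally_finite B hB).biUnion (t := fun t => {F | IsExposed ℝ t F}) ?_).subset ?_
  · rintro t ⟨ht, -⟩
    obtain ⟨⟨S, rfl⟩, -⟩ := hT.polytope t ht
    exact Poly.finite_faces S
  · rintro F ⟨K, hF, hFK, ⟨t, ht, hK⟩, hne⟩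
    simp only [Set.mem_iUnion]
    exact ⟨t, ⟨ht, hne.mono (Set.inter_subset_inter_left _ hK.subset)⟩,
      exposed_of_subset_tile hT ht hF (hFK.trans hK.subset)⟩

theorem exists_carrier (hT : IsLFCTiling T) (y : E3) :
    ∃ F, IsFace T F ∧ y ∈ F ∧ ∀ K, IsFace T K → y ∈ K → F ⊆ K := by
  have hfin : {F | IsFace T F ∧ y ∈ F}.Finite := by
    refine (finite_meet hT (B := {y}) Bornology.isBounded_singleton).subset ?_
    rintro F ⟨h1, h2⟩
    exact ⟨F, h1, subset_rfl, h1, y, h2, rfl⟩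
  have hne : {F | IsFace T F ∧ y ∈ F}.Nonempty := by
    have : y ∈ ⋃₀ T := by rw [hT.covers]; trivial
    obtain ⟨t, ht, hy⟩ := this
    exact ⟨t, ⟨t, ht, IsExposed.refl t⟩, hy⟩
  obtain ⟨F, hF⟩ := hfin.exists_minimal hne
  refine ⟨F, hF.1.1, hF.1.2, fun K hK hy => ?_⟩
  have := hF.2 ⟨inter_face hT hF.1.1 hK, hF.1.2, hy⟩ Set.inter_subset_left
  exact fun x hx => (this hx).2

/-- The smallest face containing a point. -/
noncomputable def car (hT : IsLFCTiling T) (y : E3) : NF T :=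
  ⟨(exists_carrier hT y).choose, ⟨y, (exists_carrier hT y).choose_spec.2.1⟩,
    (exists_carrier hT y).choose_spec.1⟩

theorem mem_car (hT : IsLFCTiling T) (y : E3) : y ∈ (car hT y).1 := (exists_carrier hT y).choose_spec.2.1

theorem car_subset (hT : IsLFCTiling T) {y : E3} {K : Set E3} (hK : IsFace T K) (h : y ∈ K) :
    (car hT y).1 ⊆ K := (exists_carrier hT y).choose_spec.2.2 K hK h

theorem car_le (hT : IsLFCTiling T) {y : E3} {K : NF T} (h : y ∈ K.1) : car hT y ≤ K :=
  car_subset hT K.2.2 h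

theorem exists_bary (hT : IsLFCTiling T) (F : NF T) : ∃ y, car hT y = F := by
  obtain ⟨F, hne, t, ht, hF⟩ := F
  obtain ⟨⟨S, rfl⟩, -⟩ := hT.polytope t ht
  have hface : IsFace T F := ⟨_, ht, hF⟩
  have hull := Poly.face_eq_hull hF
  set A := S.filter (· ∈ F) with hA
  have hAS : (S : Set E3) ∩ F = A := by ext x; simp [hA]
  have hAne : A.Nonempty := by
    by_contra h
    rw [Finset.not_nonempty_iff_eq_empty] at h
    rw [hAS, h] at hull
    simp only [Finset.coe_empty, convexHull_empty] at hull
    rw [hull] at hne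
    exact Set.not_nonempty_empty hne
  have hcard : (0 : ℝ) < A.card := by exact_mod_cast hAne.card_pos
  have hw1 : ∑ i ∈ A, (A.card : ℝ)⁻¹ = 1 := by
    rw [Finset.sum_const, nsmul_eq_mul, mul_inv_cancel₀ hcard.ne']
  have hAF : ∀ i ∈ A, i ∈ F := fun i hi => (Finset.mem_filter.1 hi).2
  refine ⟨∑ i ∈ A, (A.card : ℝ)⁻¹ • i, ?_⟩
  set y := ∑ i ∈ A, (A.card : ℝ)⁻¹ • i with hy
  have hyF : y ∈ F := (face_convex hT hface).sum_mem (fun _ _ => (inv_pos.2 hcard).le) hw1 hAF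
  have hle : (car hT y).1 ⊆ F := car_subset hT hface hyF
  apply Subtype.ext
  refine hle.antisymm ?_
  have h1 := Poly.exposed_support (exposed_of_subset hT (car hT y).2.2 hface hle) (s := A)
    (w := fun _ => (A.card : ℝ)⁻¹) (z := id) (fun _ _ => inv_pos.2 hcard) hw1 hAF (mem_car hT y)
  refine hull.subset.trans ?_
  rw [hAS]
  exact convexHull_min (fun i hi => h1 i hi) (face_convex hT (car hT y).2.2)

/-- A relative interior point of a face. -/
noncomputable def bary (hT : IsLFCTiling T) (F : NF T) : E3 := (exists_bary hT F).choose

theorem car_bary (hT : IsLFCTiling T) (F : NF T) : car hT (bary hT F) = F := (exists_bary hT F).choose_spec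

theorem bary_mem (hT : IsLFCTiling T) (F : NF T) : bary hT F ∈ F.1 := by
  have := mem_car hT (bary hT F)
  rwa [car_bary] at this

/-- The dimension of a face. -/
noncomputable def dim (F : NF T) : ℕ := Module.finrank ℝ (affineSpan ℝ F.1).direction

theorem dim_le (F : NF T) : dim F ≤ 3 := by
  have := Submodule.finrank_le (affineSpan ℝ F.1).direction
  simpa [dim] using this

theorem dim_lt (hT : IsLFCTiling T) {F K : NF T} (h : F < K) : dim F < dim K := by
  have hsub : F.1 ⊆ K.1 := h.le
  obtain ⟨l, hl⟩ := exposed_of_subset hT F.2.2 K.2.2 hsub F.2.1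
  obtain ⟨f, hf⟩ := F.2.1
  have hf' := hf
  rw [hl] at hf'
  apply Submodule.finrank_lt_finrank_of_lt
  apply lt_of_le_of_ne (AffineSubspace.direction_le (affineSpan_mono ℝ hsub))
  intro heq
  have haff : affineSpan ℝ F.1 = affineSpan ℝ K.1 :=
    AffineSubspace.eq_of_direction_eq_of_nonempty_of_le heq ((affineSpan_nonempty ℝ).2 F.2.1)
      (affineSpan_mono ℝ hsub)
  apply h.not_ge
  intro x hx
  rw [hl]
  refine ⟨hx, fun y hy => (hf'.2 y hy).trans ?_⟩
  have h1 : x -ᵥ f ∈ vectorSpan ℝ F.1 := by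
    rw [← direction_affineSpan, haff]
    exact AffineSubspace.vsub_mem_direction (subset_affineSpan ℝ _ hx) (subset_affineSpan ℝ _ (hsub hf))
  have h2 : vectorSpan ℝ F.1 ≤ LinearMap.ker l.toLinearMap := by
    rw [vectorSpan, Submodule.span_le]
    rintro v ⟨p, hp, q, hq, rfl⟩
    rw [hl] at hp hq
    have e1 := hp.2 q hq.1
    have e2 := hq.2 p hp.1
    show l (p - q) = 0
    rw [map_sub]; linarith
  have h3 : l (x - f) = 0 := h2 h1
  rw [map_sub] at h3
  linarith

theorem eq_of_dim (hT : IsLFCTiling T) {F K : NF T} (h : F ≤ K) (hd : dim K ≤ dim F) : F = K := by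
  by_contra hne
  have := dim_lt hT (lt_of_le_of_ne h hne)
  omega

theorem osimp_car (hT : IsLFCTiling T) {s : Finset (NF T)} {F : NF T} (hF : F ∈ s) (hs : ∀ p ∈ s, p ≤ F)
    {y : E3} (hy : y ∈ osimp (bary hT) s) : car hT y = F := by
  obtain ⟨w, hw, hw1, rfl⟩ := hy
  have hbF : ∀ p ∈ s, bary hT p ∈ F.1 := fun p hp => hs p hp (bary_mem hT p)
  have hyF := (face_convex hT F.2.2).sum_mem (fun p hp => (hw p hp).le) hw1 hbF
  have hle := car_le hT hyF
  refine le_antisymm hle ?_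
  have h1 := Poly.exposed_support (exposed_of_subset hT (car hT _).2.2 F.2.2 hle) hw hw1 hbF
    (mem_car hT _) F hF
  have := car_le hT h1
  rwa [car_bary] at this

theorem car_mem_of_openSegment (hT : IsLFCTiling T) {F : NF T} {x y z : E3} (hx : x ∈ F.1) (hy : y ∈ F.1)
    (hz : z ∈ openSegment ℝ x y) : x ∈ (car hT z).1 := by
  have hzF : z ∈ F.1 := (face_convex hT F.2.2).openSegment_subset hx hy hz
  have hle := car_le hT hzF
  have := (exposed_of_subset hT (car hT z).2.2 F.2.2 hle).isExtreme
  exact (this.2 hx hy (mem_car hT z) hz)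

theorem chain_max (hT : IsLFCTiling T) {s : Finset (NF T)} (hs : ∀ p ∈ s, ∀ q ∈ s, p ≤ q ∨ q ≤ p)
    (hne : s.Nonempty) : ∃ F ∈ s, ∀ p ∈ s, p ≤ F := by
  obtain ⟨F, hF, hmax⟩ := s.exists_max_image dim hne
  refine ⟨F, hF, fun p hp => ?_⟩
  rcases hs p hp F hF with h | h
  · exact h
  · exact (eq_of_dim hT h (hmax p hp)).ge

theorem osimp_ne (b : NF T → E3) {s : Finset (NF T)} {y : E3} (hy : y ∈ osimp b s) : s.Nonempty := by
  obtain ⟨w, -, h1, -⟩ := hy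
  by_contra h
  rw [Finset.not_nonempty_iff_eq_empty] at h
  rw [h] at h1
  simp at h1

/-- Removing a vertex from a simplex. -/
theorem osimp_erase {b : NF T → E3} {s : Finset (NF T)} {F : NF T} (hF : F ∈ s) {y : E3}
    (hy : y ∈ osimp b s) : (s = {F} ∧ y = b F) ∨
      ∃ y' ∈ osimp b (s.erase F), ∃ u : ℝ, 0 < u ∧ u < 1 ∧ y = b F + u • (y' - b F) := by
  obtain ⟨w, hw, hw1, rfl⟩ := hy
  rw [← Finset.add_sum_erase _ _ hF] at hw1
  have hFp := hw F hF
  by_cases he : s.erase F = ∅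
  · left
    have hs : s = {F} := by
      rw [← Finset.insert_erase hF, he]; rfl
    refine ⟨hs, ?_⟩
    rw [he, Finset.sum_empty, add_zero] at hw1
    rw [hs, Finset.sum_singleton, hw1, one_smul]
  · right
    have hpos : 0 < ∑ p ∈ s.erase F, w p :=
      Finset.sum_pos (fun p hp => hw p (Finset.mem_of_mem_erase hp)) (Finset.nonempty_iff_ne_empty.2 he)
    set u := ∑ p ∈ s.erase F, w p with hu
    refine ⟨∑ p ∈ s.erase F, (w p / u) • b p, ⟨fun p => w p / u, fun p hp =>
      div_pos (hw p (Finset.mem_of_mem_erase hp)) hpos, ?_, rfl⟩, u, hpos, by linarith, ?_⟩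
    · rw [← Finset.sum_div, ← hu, div_self hpos.ne']
    · rw [← Finset.add_sum_erase _ _ hF, smul_sub, Finset.smul_sum]
      have : ∀ p ∈ s.erase F, u • (w p / u) • b p = w p • b p := fun p _ => by
        rw [smul_smul, mul_div_cancel₀ _ hpos.ne']
      rw [Finset.sum_congr rfl this, show w F = 1 - u by linarith, sub_smul, one_smul]
      abel

theorem osimp_insert {b : NF T → E3} {s : Finset (NF T)} {F : NF T} (hF : F ∉ s) {y' : E3}
    (hy : y' ∈ osimp b s) {u : ℝ} (h0 : 0 < u) (h1 : u < 1) :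
    b F + u • (y' - b F) ∈ osimp b (insert F s) := by
  obtain ⟨w, hw, hw1, rfl⟩ := hy
  refine ⟨fun p => if p = F then 1 - u else u * w p, ?_, ?_, ?_⟩
  · intro p hp
    dsimp only
    split_ifs with h
    · linarith
    · exact mul_pos h0 (hw p ((Finset.mem_insert.1 hp).resolve_left h))
  · rw [Finset.sum_insert hF, if_pos rfl, Finset.sum_congr rfl (g := fun p => u * w p), ← Finset.mul_sum,
      hw1]
    · ring
    · intro p hp
      rw [if_neg]; rintro rfl; exact hF hp
  · have e : ∑ p ∈ s, (if p = F then 1 - u else u * w p) • b p = u • ∑ p ∈ s, w p • b p := by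
      rw [Finset.smul_sum]
      refine Finset.sum_congr rfl fun p hp => ?_
      rw [if_neg, smul_smul]; rintro rfl; exact hF hp
    rw [Finset.sum_insert hF]
    dsimp only
    rw [if_pos rfl, e, smul_sub, sub_smul, one_smul]; abel

theorem uniq_aux (hT : IsLFCTiling T) (n : ℕ) : ∀ y, ∀ s t : Finset (NF T), s.card = n →
    (∀ p ∈ s, ∀ q ∈ s, p ≤ q ∨ q ≤ p) → (∀ p ∈ t, ∀ q ∈ t, p ≤ q ∨ q ≤ p) →
    y ∈ osimp (bary hT) s → y ∈ osimp (bary hT) t → s = t := by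
  induction n with
  | zero =>
    intro y s t hn _ _ hs _
    rw [Finset.card_eq_zero] at hn
    exact absurd hn (osimp_ne _ hs).ne_empty
  | succ n ih =>
    intro y s t hn hs ht hys hyt
    obtain ⟨F, hF, hFm⟩ := chain_max hT hs (osimp_ne _ hys)
    obtain ⟨F', hF', hFm'⟩ := chain_max hT ht (osimp_ne _ hyt)
    have e1 := osimp_car hT hF hFm hys
    have e2 := osimp_car hT hF' hFm' hyt
    obtain rfl : F = F' := e1.symm.trans e2
    have hlt : ∀ (r : Finset (NF T)), (∀ p ∈ r, ∀ q ∈ r, p ≤ q ∨ q ≤ p) → (∀ p ∈ r, p ≤ F) →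
        ∀ z ∈ osimp (bary hT) (r.erase F), z ∈ F.1 ∧ bary hT F ∉ (car hT z).1 := by
      intro r hr hrF z hz
      obtain ⟨K, hK, hKm⟩ := chain_max hT (s := r.erase F) (fun p hp q hq =>
        hr p (Finset.mem_of_mem_erase hp) q (Finset.mem_of_mem_erase hq)) (osimp_ne _ hz)
      have e := osimp_car hT hK hKm hz
      have hKF := hrF K (Finset.mem_of_mem_erase hK)
      refine ⟨hKF (e ▸ mem_car hT z), fun hmem => ?_⟩
      have := car_le hT hmem
      rw [car_bary, e] at this
      exact Finset.ne_of_mem_erase hK (le_antisymm hKF this)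
    have key : ∀ y' y'' : E3, ∀ u v : ℝ, y' ∈ F.1 → y'' ∈ F.1 → bary hT F ∉ (car hT y'').1 → 0 < u → 0 < v →
        bary hT F + u • (y' - bary hT F) = bary hT F + v • (y'' - bary hT F) → v ≤ u := by
      intro y' y'' u v hy' hy'' hb hu hv h
      by_contra hlt
      push Not at hlt
      apply hb
      refine car_mem_of_openSegment hT (F := F) (bary_mem hT F) hy' ?_
      have h' := add_left_cancel h
      have : y'' = bary hT F + (u / v) • (y' - bary hT F) := by
        have : (u / v) • (y' - bary hT F) = y'' - bary hT F := by
          rw [div_eq_inv_mul, mul_smul, h', smul_smul, inv_mul_cancel₀ hv.ne', one_smul]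
        rw [this]; abel
      refine ⟨1 - u / v, u / v, ?_, by positivity, by ring, ?_⟩
      · rw [sub_pos, div_lt_one hv]; exact hlt
      · rw [this, sub_smul, smul_sub, one_smul]; abel
    rcases osimp_erase hF hys with ⟨hs1, hs2⟩ | ⟨y', hy', u, hu0, hu1, hu⟩ <;>
    rcases osimp_erase hF' hyt with ⟨ht1, ht2⟩ | ⟨y'', hy'', v, hv0, hv1, hv⟩
    · rw [hs1, ht1]
    · exfalso
      have hz := hlt t ht hFm' y'' hy''
      rw [hs2] at hv
      have h0 : v • (y'' - bary hT F) = 0 := by simpa using hv.symm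
      have h1 : y'' = bary hT F := sub_eq_zero.1 ((smul_eq_zero.1 h0).resolve_left hv0.ne')
      apply hz.2
      have := mem_car hT y''
      rwa [← h1]
    · exfalso
      have hz := hlt s hs hFm y' hy'
      rw [ht2] at hu
      have h0 : u • (y' - bary hT F) = 0 := by simpa using hu.symm
      have h1 : y' = bary hT F := sub_eq_zero.1 ((smul_eq_zero.1 h0).resolve_left hu0.ne')
      apply hz.2
      have := mem_car hT y'
      rwa [← h1]
    · have hz := hlt t ht hFm' y'' hy''
      have hz' := hlt s hs hFm y' hy'
      have h1 := key y' y'' u v hz'.1 hz.1 hz.2 hu0 hv0 (hu.symm.trans hv)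
      have h2 := key y'' y' v u hz.1 hz'.1 hz'.2 hv0 hu0 (hv.symm.trans hu)
      obtain rfl : u = v := le_antisymm h2 h1
      have h3 : y' = y'' := by
        have := add_left_cancel (hu.symm.trans hv)
        exact sub_left_injective (smul_right_injective _ hu0.ne' this)
      rw [← h3] at hy''
      have := ih y' (s.erase F) (t.erase F) (by rw [Finset.card_erase_of_mem hF, hn]; rfl)
        (fun p hp q hq => hs p (Finset.mem_of_mem_erase hp) q (Finset.mem_of_mem_erase hq))
        (fun p hp q hq => ht p (Finset.mem_of_mem_erase hp) q (Finset.mem_of_mem_erase hq)) hy' hy''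
      rw [← Finset.insert_erase hF, this, Finset.insert_erase hF']

theorem exit_point (hT : IsLFCTiling T) {F : NF T} {b y : E3} (hb : b ∈ F.1) (hy : y ∈ F.1) (hne : y ≠ b) :
    ∃ y' ∈ F.1, car hT y' ≠ F ∧ ∃ u : ℝ, 0 < u ∧ u ≤ 1 ∧ y = b + u • (y' - b) := by
  have hcomp := face_compact hT F.2.2
  set A : Set ℝ := {r | 1 ≤ r ∧ b + r • (y - b) ∈ F.1} with hA
  have hd : 0 < dist y b := dist_pos.2 hne
  have hA1 : (1 : ℝ) ∈ A := ⟨le_rfl, by simpa using hy⟩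
  have hAc : IsCompact A := by
    obtain ⟨R, hR⟩ := hcomp.isBounded.subset_closedBall b
    refine (isCompact_Icc (a := (1:ℝ)) (b := R / dist y b)).of_isClosed_subset ?_ ?_
    · exact isClosed_Ici.inter (hcomp.isClosed.preimage (by fun_prop))
    · rintro r ⟨h1, h2⟩
      refine ⟨h1, ?_⟩
      have := hR h2
      rw [Metric.mem_closedBall, dist_eq_norm, add_sub_cancel_left, norm_smul, Real.norm_eq_abs,
        abs_of_nonneg (by linarith), ← dist_eq_norm] at this
      rwa [le_div_iff₀ hd]
  obtain ⟨r, hr, hmax⟩ := hAc.exists_isMaxOn ⟨1, hA1⟩ continuousOn_id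
  have hr0 : 0 < r := by linarith [hr.1]
  refine ⟨b + r • (y - b), hr.2, ?_, r⁻¹, inv_pos.2 hr0, inv_le_one_of_one_le₀ hr.1, ?_⟩
  · intro hcar
    rcases Poly.extend_or (face_convex hT F.2.2) hb hr.2 with ⟨δ, hδ, hmem⟩ | ⟨l, hl1, x, hx, hl2⟩
    · have : b + (r + δ * r) • (y - b) ∈ F.1 := by
        convert hmem using 1
        rw [add_smul, mul_smul]; simp [add_assoc]
      have h2 := hmax (⟨by nlinarith [hr.1], this⟩ : r + δ * r ∈ A)
      simp only [id] at h2
      have : r + δ * r ≤ r := h2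
      nlinarith
    · have hK : IsFace T {x ∈ F.1 | ∀ y ∈ F.1, l y ≤ l x} :=
        face_of_exposed hT F.2.2 (fun _ => ⟨l, rfl⟩)
      have := car_subset hT hK
        (show b + r • (y - b) ∈ {x ∈ F.1 | ∀ y ∈ F.1, l y ≤ l x} from ⟨hr.2, hl1⟩)
      rw [hcar] at this
      have h3 := (this hx).2 _ hr.2
      linarith
  · rw [add_sub_cancel_left, smul_smul, inv_mul_cancel₀ hr0.ne', one_smul]; abel

theorem cover_aux (hT : IsLFCTiling T) (n : ℕ) : ∀ y, dim (car hT y) < n →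
    ∃ s : Finset (NF T), (∀ p ∈ s, ∀ q ∈ s, p ≤ q ∨ q ≤ p) ∧ y ∈ osimp (bary hT) s := by
  induction n with
  | zero => intro y h; omega
  | succ n ih =>
    intro y hn
    set F := car hT y with hF
    by_cases hy : y = bary hT F
    · refine ⟨{F}, ?_, fun _ => 1, by simp, by simp, by simpa using hy⟩
      intro p hp q hq
      rw [Finset.mem_singleton] at hp hq
      left; rw [hp, hq]
    · obtain ⟨y', hy', hcar, u, hu0, hu1, hu⟩ := exit_point hT (bary_mem hT F) (mem_car hT y) hy
      have hlt : car hT y' < F := lt_of_le_of_ne (car_le hT hy') hcar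
      have hu1' : u < 1 := by
        refine lt_of_le_of_ne hu1 ?_
        rintro rfl
        rw [one_smul, add_sub_cancel] at hu
        rw [← hu] at hcar
        exact hcar hF.symm
      obtain ⟨s, hs, hys⟩ := ih y' (by have := dim_lt hT hlt; omega)
      obtain ⟨K, hK, hKm⟩ := chain_max hT hs (osimp_ne _ hys)
      have hKe := osimp_car hT hK hKm hys
      rw [hKe] at hlt
      have hle : ∀ p ∈ s, p < F := fun p hp => (hKm p hp).trans_lt hlt
      refine ⟨insert F s, ?_, ?_⟩
      · intro p hp q hq
        rcases Finset.mem_insert.1 hp with rfl | hp <;> rcases Finset.mem_insert.1 hq with rfl | hq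
        · exact Or.inl le_rfl
        · exact Or.inr (hle q hq).le
        · exact Or.inl (hle p hp).le
        · exact hs p hp q hq
      · rw [hu]
        exact osimp_insert (fun h => (hle F h).ne rfl) hys hu0 hu1'

/-- The rank of a nonempty face. -/
noncomputable def rk4 (F : NF T) : Fin 4 := ⟨dim F, by have := dim_le F; omega⟩

/-- The geometry of nonempty faces of a tiling. -/
noncomputable def geo (hT : IsLFCTiling T) : Geo (NF T) where
  rk := rk4
  inc p q := p ≤ q ∨ q ≤ p
  inc_refl p := Or.inl le_rfl
  inc_symm p q h := h.symm
  inc_eq p q h hr := by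
    have hr : dim p = dim q := congrArg Fin.val hr
    rcases h with h | h
    · exact eq_of_dim hT h hr.ge
    · exact (eq_of_dim hT h hr.le).symm
  inc_trans p q r h1 h2 hr1 hr2 := by
    have hr1 : dim p < dim q := hr1
    have hr2 : dim q < dim r := hr2
    rcases h1 with h1 | h1
    · rcases h2 with h2 | h2
      · exact Or.inl (h1.trans h2)
      · rcases eq_or_lt_of_le h2 with rfl | h
        · omega
        · have := dim_lt hT h; omega
    · rcases eq_or_lt_of_le h1 with rfl | h
      · omega
      · have := dim_lt hT h; omega
  b := bary hT
  cover y := cover_aux hT _ y (Nat.lt_succ_self _)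
  uniq y s t hs ht h1 h2 := uniq_aux hT _ y s t rfl hs ht h1 h2
  locfin y := by
    refine ⟨1, one_pos, ?_⟩
    have hfin := finite_meet hT (B := Metric.ball y 1) Metric.isBounded_ball
    have hfin' : {F : NF T | ∃ K, IsFace T F.1 ∧ F.1 ⊆ K ∧ IsFace T K ∧ (K ∩ Metric.ball y 1).Nonempty}.Finite :=
      Set.Finite.preimage (f := fun F : NF T => F.1) (Subtype.val_injective.injOn) hfin
    refine (hfin'.finite_subsets.preimage (Finset.coe_injective.injOn)).subset ?_
    rintro s ⟨hs, z, hz, hzb⟩ p hp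
    obtain ⟨F, hF, hFm⟩ := chain_max hT hs (osimp_ne _ hz)
    have := osimp_car hT hF hFm hz
    exact ⟨F.1, p.2.2, hFm p hp, F.2.2, z, this ▸ mem_car hT z, hzb⟩
  nobf p p' q q' hp hq hpp hqq hpq hpq1 h1 h2 h3 h4 := by
    have hp : dim p = dim p' := congrArg Fin.val hp
    have hq : dim q = dim q' := congrArg Fin.val hq
    have hpq1 : dim q = dim p + 1 := hpq1
    have hle : ∀ {a b : NF T}, a ≤ b ∨ b ≤ a → dim a < dim b → a ≤ b := by
      intro a b h hd
      rcases h with h | h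
      · exact h
      · rcases eq_or_lt_of_le h with rfl | h
        · exact le_rfl
        · have := dim_lt hT h; omega
    have h1 := hle h1 (by omega)
    have h2 := hle h2 (by omega)
    have h3 := hle h3 (by omega)
    have h4 := hle h4 (by omega)
    obtain ⟨x, hx⟩ := p.2.1
    let m : NF T := ⟨q.1 ∩ q'.1, ⟨x, h1 hx, h2 hx⟩, inter_face hT q.2.2 q'.2.2⟩
    have hm1 : m ≤ q := Set.inter_subset_left
    have hm2 : m ≤ q' := Set.inter_subset_right
    have hmq : m < q := by
      refine lt_of_le_of_ne hm1 ?_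
      intro he
      exact hqq (eq_of_dim hT (he ▸ hm2) hq.ge)
    have := dim_lt hT hmq
    have e1 : p = m := eq_of_dim hT (Set.subset_inter h1 h2) (by omega)
    have e2 : p' = m := eq_of_dim hT (Set.subset_inter h3 h4) (by omega)
    exact hpp (e1.trans e2.symm)

end Tiling

open scoped Classical

/-! ## From flags of the face poset to chambers -/

namespace Tiling
variable {T T' : Set (Set E3)}

/-- The bounded completion of the poset of nonempty faces. -/
abbrev BC (T : Set (Set E3)) : Type := WithTop (WithBot (NF T))

/-- A face as an element of the poset of nonempty faces with a bottom added. -/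
noncomputable def ofFace (F : TFace T) : WithBot (NF T) :=
  if hF : F.1.Nonempty then WithBot.some (show NF T from ⟨F.1, hF, F.2⟩) else ⊥

/-- The inverse of `ofFace`. -/
noncomputable def toFace (h : T.Nonempty) (x : WithBot (NF T)) : TFace T :=
  WithBot.recBotCoe (C := fun _ => TFace T) ⟨∅, h.some, h.some_mem, isExposed_empty⟩
    (fun F => ⟨F.1, F.2.2⟩) x

theorem ofFace_pos (F : TFace T) (hF : F.1.Nonempty) :
    ofFace F = WithBot.some (show NF T from ⟨F.1, hF, F.2⟩) := dif_pos hF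

theorem ofFace_neg (F : TFace T) (hF : ¬ F.1.Nonempty) : ofFace F = ⊥ := dif_neg hF

/-- The faces of a tiling are the nonempty ones and the empty one. -/
noncomputable def tfaceIso (h : T.Nonempty) : TFace T ≃o WithBot (NF T) where
  toFun := ofFace
  invFun := toFace h
  left_inv F := by
    by_cases hF : F.1.Nonempty
    · rw [ofFace_pos F hF]; rfl
    · rw [ofFace_neg F hF]
      apply Subtype.ext
      exact (Set.not_nonempty_iff_eq_empty.1 hF).symm
  right_inv x := by
    rcases x with _ | F
    · exact ofFace_neg _ Set.not_nonempty_empty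
    · exact ofFace_pos (⟨F.1, F.2.2⟩ : TFace T) F.2.1
  map_rel_iff' {F K} := by
    show ofFace F ≤ ofFace K ↔ F.1 ⊆ K.1
    by_cases hF : F.1.Nonempty
    · by_cases hK : K.1.Nonempty
      · rw [ofFace_pos F hF, ofFace_pos K hK]
        exact WithBot.coe_le_coe
      · rw [ofFace_pos F hF, ofFace_neg K hK]
        constructor
        · intro h; exact absurd (le_bot_iff.1 h) (WithBot.coe_ne_bot)
        · intro h; exact absurd (hF.mono h) hK
    · rw [ofFace_neg F hF]
      rw [Set.not_nonempty_iff_eq_empty] at hF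
      simp [hF]

/-- The face poset is the bounded completion of the poset of nonempty faces. -/
noncomputable def tposetIso (h : T.Nonempty) : TPoset T ≃o BC T := (tfaceIso h).withTopCongr

/-- Isomorphisms of posets of nonempty faces extend to face posets. -/
noncomputable def tposetCongr (h : T.Nonempty) (h' : T'.Nonempty) (e : NF T ≃o NF T') :
    TPoset T ≃o TPoset T' :=
  ((tposetIso h).trans e.withBotCongr.withTopCongr).trans (tposetIso h').symm

theorem sameFlagOrbit_map {α β : Type*} [PartialOrder α] [PartialOrder β] (e : α ≃o β) (Φ Ψ : Flag α) :
    SameFlagOrbit (Flag.map e Φ) (Flag.map e Ψ) ↔ SameFlagOrbit Φ Ψ := by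
  constructor
  · rintro ⟨γ, h⟩
    refine ⟨(e.trans γ).trans e.symm, ?_⟩
    have h2 : (e.symm '' (γ '' (e '' (Φ : Set α)))) = e.symm '' (e '' (Ψ : Set α)) := congrArg _ h
    rw [e.symm_image_image] at h2
    rw [← h2, Set.image_image, Set.image_image]
    rfl
  · rintro ⟨γ, h⟩
    refine ⟨(e.symm.trans γ).trans e, ?_⟩
    rw [Flag.coe_map, Flag.coe_map, ← h, Set.image_image, Set.image_image]
    refine Set.image_congr fun x _ => ?_
    simp

theorem twoFlagOrbits_congr {α β : Type*} [PartialOrder α] [PartialOrder β] (e : α ≃o β)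
    (h : TwoFlagOrbits α) : TwoFlagOrbits β := by
  obtain ⟨Φ, Ψ, h1, h2⟩ := h
  refine ⟨Flag.map e Φ, Flag.map e Ψ, by rwa [sameFlagOrbit_map], fun Ω => ?_⟩
  obtain ⟨Ω, rfl⟩ := (Flag.map e).surjective Ω
  rw [sameFlagOrbit_map, sameFlagOrbit_map]
  exact h2 Ω

theorem SameFlagOrbit.symm' {α : Type*} [PartialOrder α] {Φ Ψ : Flag α} (h : SameFlagOrbit Φ Ψ) :
    SameFlagOrbit Ψ Φ := by
  obtain ⟨γ, h⟩ := h
  exact ⟨γ.symm, by rw [← h, γ.symm_image_image]⟩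

theorem SameFlagOrbit.trans' {α : Type*} [PartialOrder α] {Φ Ψ Ω : Flag α} (h : SameFlagOrbit Φ Ψ)
    (h' : SameFlagOrbit Ψ Ω) : SameFlagOrbit Φ Ω := by
  obtain ⟨γ, h⟩ := h
  obtain ⟨δ, h'⟩ := h'
  refine ⟨γ.trans δ, ?_⟩
  rw [← h', ← h, Set.image_image]
  rfl

/-- The inclusion of nonempty faces. -/
def emb (p : NF T) : BC T := ((p : WithBot (NF T)) : WithTop (WithBot (NF T)))

theorem emb_le {p q : NF T} : emb p ≤ emb q ↔ p ≤ q := by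
  simp [emb]

theorem emb_inj {p q : NF T} : emb p = emb q ↔ p = q := by
  simp [emb]

theorem emb_ne_top (p : NF T) : emb p ≠ ⊤ := by simp [emb]

theorem emb_ne_bot (p : NF T) : emb p ≠ ⊥ := by
  intro h
  have : ((p : WithBot (NF T)) : WithTop (WithBot (NF T))) = ((⊥ : WithBot (NF T)) : WithTop (WithBot (NF T))) := h
  simp at this

theorem bc_cases (x : BC T) : x = ⊤ ∨ x = ⊥ ∨ ∃ p, x = emb p := by
  rcases x with _ | _ | p
  · exact Or.inl rfl
  · exact Or.inr (Or.inl rfl)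
  · exact Or.inr (Or.inr ⟨p, rfl⟩)

theorem rk_lt {hT : IsLFCTiling T} {p q : NF T} (h : p < q) : (geo hT).rk p < (geo hT).rk q := dim_lt hT h

theorem le_of_inc {hT : IsLFCTiling T} {p q : NF T} (h : (geo hT).inc p q)
    (hr : (geo hT).rk p ≤ (geo hT).rk q) : p ≤ q := by
  rcases h with h | h
  · exact h
  · rcases eq_or_lt_of_le h with rfl | h
    · exact le_rfl
    · exact absurd (rk_lt (hT := hT) h) (not_lt.2 hr)

theorem rk_mono {hT : IsLFCTiling T} {p q : NF T} (h : p ≤ q) : (geo hT).rk p ≤ (geo hT).rk q := by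
  rcases eq_or_lt_of_le h with rfl | h
  · exact le_rfl
  · exact (rk_lt h).le

/-- The flag of a chamber. -/
def flagOf {hT : IsLFCTiling T} (Φ : (geo hT).Cham) : Flag (BC T) where
  carrier := {x | x = ⊤ ∨ x = ⊥ ∨ ∃ p ∈ Φ.fs, x = emb p}
  Chain' := by
    rintro x hx y hy -
    rcases hx with rfl | rfl | ⟨p, hp, rfl⟩
    · exact Or.inr le_top
    · exact Or.inl bot_le
    · rcases hy with rfl | rfl | ⟨q, hq, rfl⟩
      · exact Or.inl le_top
      · exact Or.inr bot_le
      · show emb p ≤ emb q ∨ emb q ≤ emb p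
        rw [emb_le, emb_le]
        exact Φ.isCh p hp q hq
  max_chain' := by
    intro s hs hsub
    refine hsub.antisymm ?_
    intro x hx
    rcases bc_cases x with rfl | rfl | ⟨p, rfl⟩
    · exact Or.inl rfl
    · exact Or.inr (Or.inl rfl)
    · refine Or.inr (Or.inr ⟨p, ?_, rfl⟩)
      rw [Geo.Cham.mem_fs]
      have h1 : emb (Φ.1 ((geo hT).rk p)) ∈ s := hsub (Or.inr (Or.inr ⟨_, Φ.app_mem _, rfl⟩))
      refine (geo hT).inc_eq _ _ ?_ (Φ.rk _)
      have := hs.total h1 hx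
      rwa [emb_le, emb_le] at this

theorem mem_flagOf {hT : IsLFCTiling T} {Φ : (geo hT).Cham} {p : NF T} : emb p ∈ (flagOf Φ : Set (BC T)) ↔ p ∈ Φ.fs := by
  constructor
  · rintro (h | h | ⟨q, hq, h⟩)
    · exact absurd h (emb_ne_top p)
    · exact absurd h (emb_ne_bot p)
    · rw [emb_inj] at h; rwa [h]
  · exact fun h => Or.inr (Or.inr ⟨p, h, rfl⟩)

theorem flagOf_surj (hT : IsLFCTiling T) (Ω : Flag (BC T)) : ∃ Φ : (geo hT).Cham, flagOf Φ = Ω := by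
  have hch : ∀ p q : NF T, emb p ∈ Ω → emb q ∈ Ω → (geo hT).inc p q := by
    intro p q hp hq
    have := Ω.le_or_le hp hq
    rwa [emb_le, emb_le] at this
  have hfin : {p : NF T | emb p ∈ Ω}.Finite :=
    Set.Finite.of_injOn (f := (geo hT).rk) (t := Set.univ) (fun _ _ => trivial)
      (fun p hp q hq h => (geo hT).inc_eq _ _ (hch p q hp hq) h) Set.finite_univ
  obtain ⟨Φ, hΦ⟩ := Geo.exists_cham_ge (G := geo hT) (s := hfin.toFinset) (by
    intro p hp q hq
    exact hch p q (by simpa using hp) (by simpa using hq))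
  refine ⟨Φ, Flag.ext ?_⟩
  refine (Ω.maxChain.2 (flagOf Φ).chain_le ?_).symm
  intro x hx
  rcases bc_cases x with rfl | rfl | ⟨p, rfl⟩
  · exact Or.inl rfl
  · exact Or.inr (Or.inl rfl)
  · exact mem_flagOf.2 (hΦ (by simpa using hx))

/-- Automorphisms of the bounded completion restrict. -/
theorem exists_restrict (γ : BC T ≃o BC T) : ∃ f : NF T ≃o NF T, ∀ p, γ (emb p) = emb (f p) := by
  have key : ∀ (γ : BC T ≃o BC T) (p : NF T), ∃ q, γ (emb p) = emb q := by
    intro γ p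
    rcases bc_cases (γ (emb p)) with h | h | h
    · rw [map_eq_top_iff] at h; exact absurd h (emb_ne_top p)
    · rw [map_eq_bot_iff] at h; exact absurd h (emb_ne_bot p)
    · exact h
  choose f hf using key γ
  choose g hg using key γ.symm
  refine ⟨⟨⟨f, g, fun p => ?_, fun p => ?_⟩, ?_⟩, hf⟩
  · rw [← emb_inj, ← hg, ← hf, γ.symm_apply_apply]
  · rw [← emb_inj, ← hf, ← hg, γ.apply_symm_apply]
  · intro p q
    show f p ≤ f q ↔ p ≤ q
    rw [← emb_le, ← hf, ← hf, γ.le_iff_le, emb_le]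

/-- Order isomorphisms preserve rank. -/
def gisoOf {hT : IsLFCTiling T} {hT' : IsLFCTiling T'} (f : NF T ≃o NF T') :
    Geo.GIso (geo hT) (geo hT') where
  e := f.toEquiv
  rk p := by
    obtain ⟨Φ, hΦ⟩ := Geo.exists_cham_mem (geo hT) p
    have hmono : StrictMono fun i => (geo hT').rk (f (Φ.1 i)) := by
      intro i j hij
      apply rk_lt
      rw [f.lt_iff_lt]
      refine lt_of_le_of_ne (le_of_inc (Φ.inc i j) ?_) (fun h => hij.ne (Φ.inj h))
      rw [Φ.rk, Φ.rk]; exact hij.le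
    have key : ∀ g : Fin 4 → Fin 4, StrictMono g → ∀ i, g i = i := by
      intro g hg i
      have h0 : (g 0 : ℕ) < g 1 := @hg 0 1 (by decide)
      have h1 : (g 1 : ℕ) < g 2 := @hg 1 2 (by decide)
      have h2 : (g 2 : ℕ) < g 3 := @hg 2 3 (by decide)
      have h3 := (g 3).isLt
      apply Fin.ext
      have h4 : i = 0 ∨ i = 1 ∨ i = 2 ∨ i = 3 := by revert i; decide
      rcases h4 with rfl | rfl | rfl | rfl
      · show (g 0 : ℕ) = 0; omega
      · show (g 1 : ℕ) = 1; omega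
      · show (g 2 : ℕ) = 2; omega
      · show (g 3 : ℕ) = 3; omega
    have := key _ hmono ((geo hT).rk p)
    rwa [hΦ] at this
  inc p q := by
    show f p ≤ f q ∨ f q ≤ f p ↔ p ≤ q ∨ q ≤ p
    rw [f.le_iff_le, f.le_iff_le]

/-- Isomorphisms of geometries are order isomorphisms. -/
def orderOf {hT : IsLFCTiling T} {hT' : IsLFCTiling T'} (f : Geo.GIso (geo hT) (geo hT')) :
    NF T ≃o NF T' where
  toEquiv := f.e
  map_rel_iff' {p q} := by
    constructor
    · intro h
      refine le_of_inc ((f.inc p q).1 (Or.inl h)) ?_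
      rw [← f.rk, ← f.rk]; exact rk_mono h
    · intro h
      refine le_of_inc (hT := hT') ((f.inc p q).2 (Or.inl h)) ?_
      rw [f.rk, f.rk]; exact rk_mono h

theorem cham_of_sameOrbit {hT : IsLFCTiling T} {Φ Ψ : (geo hT).Cham} (h : SameFlagOrbit (flagOf Φ) (flagOf Ψ)) :
    ∃ f : Geo.GIso (geo hT) (geo hT), f.cham Φ = Ψ := by
  obtain ⟨γ, hγ⟩ := h
  obtain ⟨f, hf⟩ := exists_restrict γ
  refine ⟨gisoOf f, ?_⟩
  apply Geo.Cham.ext_fs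
  intro p hp
  obtain ⟨q, hq⟩ := f.surjective p
  rw [← mem_flagOf, ← hγ]
  refine ⟨emb q, ?_, by rw [hf, hq]⟩
  rw [mem_flagOf]
  rw [Geo.Cham.mem_fs] at hp ⊢
  apply f.injective
  rw [hq]
  refine Eq.trans ?_ hp
  show f (Φ.1 _) = f (Φ.1 _)
  rw [← hq]
  congr 2
  refine congrArg Φ.1 ?_
  exact ((gisoOf (hT := hT) (hT' := hT) f).rk q).symm

theorem sameOrbit_cham {hT : IsLFCTiling T} (f : Geo.GIso (geo hT) (geo hT)) (Φ : (geo hT).Cham) :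
    SameFlagOrbit (flagOf (f.cham Φ)) (flagOf Φ) := by
  apply SameFlagOrbit.symm'
  refine ⟨(orderOf f).withBotCongr.withTopCongr, ?_⟩
  have hc : ∀ p : NF T, (orderOf f).withBotCongr.withTopCongr (emb p) = emb (f.e p) := fun p => rfl
  ext x
  constructor
  · rintro ⟨y, hy | hy | ⟨p, hp, hy⟩, rfl⟩
    · subst hy; rw [map_top]; exact Or.inl rfl
    · subst hy; rw [map_bot]; exact Or.inr (Or.inl rfl)
    · subst hy
      rw [hc, mem_flagOf]
      rw [Geo.Cham.mem_fs] at hp ⊢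
      rw [f.cham_app, f.rk, hp]
  · rintro (rfl | rfl | ⟨p, hp, rfl⟩)
    · exact ⟨⊤, Or.inl rfl, map_top _⟩
    · exact ⟨⊥, Or.inr (Or.inl rfl), map_bot _⟩
    · rw [Geo.Cham.mem_fs, f.cham_app] at hp
      refine ⟨emb (Φ.1 ((geo hT).rk p)), mem_flagOf.2 (Φ.app_mem _), ?_⟩
      rw [hc, hp]

theorem tiles_nonempty (hT : IsLFCTiling T) : T.Nonempty := by
  by_contra h
  rw [Set.not_nonempty_iff_eq_empty] at h
  have := hT.covers
  rw [h, Set.sUnion_empty] at this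
  exact Set.empty_ne_univ this

theorem exists_twoOrb (hT : IsLFCTiling T) (h : TwoFlagOrbits (TPoset T)) :
    ∃ typ, Geo.TwoOrb (geo hT) typ := by
  obtain ⟨A, B, h1, h2⟩ := twoFlagOrbits_congr (tposetIso (tiles_nonempty hT)) h
  refine ⟨fun Φ => decide (SameFlagOrbit (flagOf Φ) A), ?_, ?_, ?_⟩
  · intro Φ Ψ he
    rw [decide_eq_decide] at he
    apply cham_of_sameOrbit
    by_cases ha : SameFlagOrbit (flagOf Φ) A
    · exact SameFlagOrbit.trans' ha (SameFlagOrbit.symm' (he.1 ha))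
    · exact SameFlagOrbit.trans' ((h2 _).resolve_left ha)
        (SameFlagOrbit.symm' ((h2 _).resolve_left (fun h => ha (he.2 h))))
  · intro f Φ
    rw [decide_eq_decide]
    exact ⟨fun h => SameFlagOrbit.trans' (SameFlagOrbit.symm' (sameOrbit_cham f Φ)) h,
      fun h => SameFlagOrbit.trans' (sameOrbit_cham f Φ) h⟩
  · obtain ⟨Φ, rfl⟩ := flagOf_surj hT A
    obtain ⟨Ψ, rfl⟩ := flagOf_surj hT B
    refine ⟨Φ, Ψ, fun h => ?_⟩
    rw [decide_eq_decide] at h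
    exact h1 (SameFlagOrbit.symm' (h.1 ⟨OrderIso.refl _, by simp⟩))

end Tiling

open scoped Classical

/-! ## Normality implies polynomial growth -/

namespace Tiling
variable {T : Set (Set E3)}

theorem dim_of_interior {F : NF T} (h : (interior F.1).Nonempty) : dim F = 3 := by
  have : affineSpan ℝ F.1 = ⊤ := by
    apply top_unique
    rw [← isOpen_interior.affineSpan_eq_top h]
    exact affineSpan_mono ℝ interior_subset
  rw [dim, this, AffineSubspace.direction_top, finrank_top]
  simp

/-- A tile as a nonempty face. -/
def tileNF (hT : IsLFCTiling T) {t : Set E3} (ht : t ∈ T) : NF T :=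
  ⟨t, (hT.polytope t ht).2.mono interior_subset, t, ht, IsExposed.refl t⟩

theorem mem_of_dim (hT : IsLFCTiling T) {F : NF T} (h : dim F = 3) : F.1 ∈ T := by
  obtain ⟨t, ht, hF⟩ := F.2.2
  have h1 : F ≤ tileNF hT ht := hF.subset
  have h2 := eq_of_dim hT h1 (by rw [h]; exact dim_le _)
  rw [h2]
  exact ht

theorem tile_eq (hT : IsLFCTiling T) {F K : NF T} (hF : dim F = 3) (hK : dim K = 3) {O : Set E3} (hO : IsOpen O)
    (hne : O.Nonempty) (h1 : O ⊆ F.1) (h2 : O ⊆ K.1) : F = K := by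
  let m : NF T := ⟨F.1 ∩ K.1, hne.mono (Set.subset_inter h1 h2), inter_face hT F.2.2 K.2.2⟩
  have hm : dim m = 3 := dim_of_interior (hne.mono (interior_maximal (Set.subset_inter h1 h2) hO))
  have e1 : m = F := eq_of_dim hT Set.inter_subset_left (by omega)
  have e2 : m = K := eq_of_dim hT Set.inter_subset_right (by omega)
  rw [← e1, e2]

theorem tile_count (hT : IsLFCTiling T) {u R : ℝ} (hu : 0 < u) (hR : 0 < R) (x0 : E3) (S : Finset (NF T))
    (h1 : ∀ F ∈ S, dim F = 3) (h2 : ∀ F ∈ S, ∃ x, Metric.closedBall x u ⊆ F.1)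
    (h3 : ∀ F ∈ S, F.1 ⊆ Metric.closedBall x0 R) : (S.card : ℝ) ≤ (R / u) ^ 3 := by
  have h2' : ∀ F : NF T, ∃ x, F ∈ S → Metric.closedBall x u ⊆ F.1 := by
    intro F
    by_cases hF : F ∈ S
    · obtain ⟨x, hx⟩ := h2 F hF
      exact ⟨x, fun _ => hx⟩
    · exact ⟨x0, fun h => absurd h hF⟩
  choose c hc using h2'
  have hdis : (S : Set (NF T)).PairwiseDisjoint (fun F => Metric.ball (c F) u) := by
    intro F hF K hK hne
    by_contra hnd
    rw [Function.onFun, Set.not_disjoint_iff_nonempty_inter] at hnd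
    exact hne (tile_eq hT (h1 F hF) (h1 K hK) (Metric.isOpen_ball.inter Metric.isOpen_ball) hnd
      (Set.inter_subset_left.trans (Metric.ball_subset_closedBall.trans (hc F hF)))
      (Set.inter_subset_right.trans (Metric.ball_subset_closedBall.trans (hc K hK))))
  have hvol := MeasureTheory.measure_biUnion_finset (μ := MeasureTheory.volume) hdis
    (fun F _ => Metric.isOpen_ball.measurableSet)
  have hle : MeasureTheory.volume (⋃ F ∈ S, Metric.ball (c F) u) ≤
      MeasureTheory.volume (Metric.closedBall x0 R) := by
    apply MeasureTheory.measure_mono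
    intro y hy
    simp only [Set.mem_iUnion] at hy
    obtain ⟨F, hF, hy⟩ := hy
    exact h3 F hF (hc F hF (Metric.ball_subset_closedBall hy))
  rw [hvol, Finset.sum_congr rfl (fun F _ => MeasureTheory.Measure.addHaar_ball _ (c F) hu.le),
    Finset.sum_const, MeasureTheory.Measure.addHaar_closedBall _ x0 hR.le, nsmul_eq_mul, ← mul_assoc] at hle
  have hpos : MeasureTheory.volume (Metric.ball (0 : E3) 1) ≠ 0 :=
    (Metric.measure_ball_pos _ _ one_pos).ne'
  have hfin : MeasureTheory.volume (Metric.ball (0 : E3) 1) ≠ ⊤ := MeasureTheory.measure_ball_lt_top.ne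
  rw [ENNReal.mul_le_mul_iff_left hpos hfin] at hle
  have hd : Module.finrank ℝ E3 = 3 := by simp
  rw [hd, ← ENNReal.ofReal_natCast, ← ENNReal.ofReal_mul (by positivity), ENNReal.ofReal_le_ofReal_iff (by positivity)] at hle
  rw [div_pow, le_div_iff₀ (by positivity)]
  exact hle

theorem polyGrowth (hT : IsLFCTiling T) (hn : IsNormalTiling T) {typ : (geo hT).Cham → Bool}
    (h : Geo.TwoOrb (geo hT) typ) : Geo.PolyGrowth (geo hT) := by
  obtain ⟨u, U, hu, hU, hn⟩ := hn
  intro Φ0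
  -- the number of chambers in a tile is bounded
  obtain ⟨M, hM⟩ : ∃ M : ℕ, ∀ Φ : (geo hT).Cham, {Ψ : (geo hT).Cham | Φ.1 3 ∈ Ψ.fs}.ncard ≤ M := by
    have hinv : ∀ (f : Geo.GIso (geo hT) (geo hT)) (Φ : (geo hT).Cham),
        {Ψ : (geo hT).Cham | (f.cham Φ).1 3 ∈ Ψ.fs}.ncard ≤ {Ψ : (geo hT).Cham | Φ.1 3 ∈ Ψ.fs}.ncard := by
      intro f Φ
      have hsub : {Ψ : (geo hT).Cham | (f.cham Φ).1 3 ∈ Ψ.fs} ⊆ f.cham '' {Ψ : (geo hT).Cham | Φ.1 3 ∈ Ψ.fs} := by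
        intro Ψ hΨ
        have hΨ : Ψ.1 ((geo hT).rk ((f.cham Φ).1 3)) = (f.cham Φ).1 3 := Geo.Cham.mem_fs.1 hΨ
        rw [(f.cham Φ).rk] at hΨ
        refine ⟨⟨fun i => f.e.symm (Ψ.1 i), fun i => ?_, fun i j => ?_⟩, ?_, ?_⟩
        · rw [← f.rk, f.e.apply_symm_apply, Ψ.rk]
        · rw [← f.inc, f.e.apply_symm_apply, f.e.apply_symm_apply]; exact Ψ.inc i j
        · refine Geo.Cham.mem_fs.2 ?_
          rw [Φ.rk]
          show f.e.symm (Ψ.1 3) = Φ.1 3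
          rw [hΨ, f.cham_app, f.e.symm_apply_apply]
        · apply Subtype.ext
          funext i
          exact f.e.apply_symm_apply _
      exact (Set.ncard_le_ncard hsub ((Geo.star_finite _).image _)).trans (Set.ncard_image_le (Geo.star_finite _))
    obtain ⟨Φ1, Φ2, hne⟩ := h.two
    refine ⟨{Ψ : (geo hT).Cham | Φ1.1 3 ∈ Ψ.fs}.ncard + {Ψ : (geo hT).Cham | Φ2.1 3 ∈ Ψ.fs}.ncard, fun Φ => ?_⟩
    have : typ Φ1 = typ Φ ∨ typ Φ2 = typ Φ := by
      revert hne; cases typ Φ1 <;> cases typ Φ2 <;> cases typ Φ <;> simp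
    rcases this with he | he
    · obtain ⟨f, rfl⟩ := h.trans _ _ he
      have := hinv f Φ1; omega
    · obtain ⟨f, rfl⟩ := h.trans _ _ he
      have := hinv f Φ2; omega
  have hdim : ∀ Φ : (geo hT).Cham, dim (Φ.1 3) = 3 := fun Φ => congrArg Fin.val (Φ.rk 3)
  have hmem : ∀ Φ : (geo hT).Cham, (Φ.1 3).1 ∈ T := fun Φ => mem_of_dim hT (hdim Φ)
  have hle : ∀ (Φ : (geo hT).Cham) i, (Φ.1 i).1 ⊆ (Φ.1 3).1 := by
    intro Φ i
    refine le_of_inc (hT := hT) (Φ.inc i 3) ?_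
    rw [Φ.rk, Φ.rk]; exact Fin.le_last i
  have hdiam : ∀ (Φ : (geo hT).Cham), ∀ x ∈ (Φ.1 3).1, ∀ y ∈ (Φ.1 3).1, dist x y ≤ 2 * U := by
    intro Φ x hx y hy
    obtain ⟨z, hz⟩ := (hn _ (hmem Φ)).2
    have h1 := hz hx
    have h2 := hz hy
    rw [Metric.mem_closedBall] at h1 h2
    have := dist_triangle_right x y z
    linarith
  obtain ⟨x0, hx0⟩ := (Φ0.1 3).2.1
  have hball : ∀ l : List (Fin 4), ((l.foldr (fun i Φ => Geo.ρ i Φ) Φ0).1 3).1 ⊆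
      Metric.closedBall x0 (2 * U * (l.length + 1)) := by
    intro l
    induction l with
    | nil =>
      intro y hy
      have := hdiam Φ0 y hy x0 hx0
      simpa using this
    | cons i l ih =>
      intro y hy
      rw [List.foldr_cons] at hy
      set Φ := l.foldr (fun i Φ => Geo.ρ i Φ) Φ0
      obtain ⟨j, hj⟩ : ∃ j, j ≠ i := (by decide : ∀ i : Fin 4, ∃ j, j ≠ i) i
      obtain ⟨z, hz⟩ := (Φ.1 j).2.1
      have hz1 := ih (hle Φ j hz)
      have hz2 : z ∈ ((Geo.ρ i Φ).1 3).1 := hle _ j (by rw [Geo.ρ_app hj]; exact hz)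
      have := hdiam _ y hy z hz2
      rw [Metric.mem_closedBall] at hz1 ⊢
      have h3 := dist_triangle y z x0
      push_cast [List.length_cons]
      linarith
  refine ⟨M * ⌈(2 * U / u) ^ 3⌉₊, ?_⟩
  intro n S hS hinj
  let c : List (Fin 4) → (geo hT).Cham := fun l => l.foldr (fun i Φ => Geo.ρ i Φ) Φ0
  let A : Finset (geo hT).Cham := S.image c
  have hA : A.card = S.card := Finset.card_image_of_injOn hinj
  let B : Finset (NF T) := A.image (fun Φ => Φ.1 3)
  have hAB : A.card ≤ M * B.card := by
    apply Finset.card_le_mul_card_image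
    intro F hF
    obtain ⟨Φ, hΦ, rfl⟩ := Finset.mem_image.1 hF
    refine le_trans ?_ (hM Φ)
    rw [← Set.ncard_coe_finset]
    refine Set.ncard_le_ncard ?_ (Geo.star_finite _)
    intro Ψ hΨ
    have hΨ := (Finset.mem_filter.1 (Finset.mem_coe.1 hΨ)).2
    show Φ.1 3 ∈ Ψ.fs
    rw [← hΨ]
    exact Ψ.app_mem 3
  have hBc : ∀ F ∈ B, ∃ l ∈ S, F = (c l).1 3 := by
    intro F hF
    obtain ⟨Φ, hΦ, rfl⟩ := Finset.mem_image.1 hF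
    obtain ⟨l, hl, rfl⟩ := Finset.mem_image.1 hΦ
    exact ⟨l, hl, rfl⟩
  have hB := tile_count hT hu (R := 2 * U * (n + 1)) (by positivity) x0 B
    (fun F hF => by obtain ⟨l, hl, rfl⟩ := hBc F hF; exact hdim _)
    (fun F hF => by obtain ⟨l, hl, rfl⟩ := hBc F hF; exact (hn _ (hmem _)).1)
    (fun F hF => by
      obtain ⟨l, hl, rfl⟩ := hBc F hF
      refine (hball l).trans (Metric.closedBall_subset_closedBall ?_)
      have : (l.length : ℝ) ≤ n := by exact_mod_cast hS l hl
      gcongr)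
  have hB' : B.card ≤ ⌈(2 * U / u) ^ 3⌉₊ * (n + 1) ^ 3 := by
    have h1 : (2 * U * (n + 1) / u) ^ 3 = (2 * U / u) ^ 3 * (n + 1 : ℝ) ^ 3 := by
      rw [← mul_pow]; congr 1; ring
    rw [h1] at hB
    have h2 := Nat.le_ceil ((2 * U / u) ^ 3)
    have h3 : (B.card : ℝ) ≤ (⌈(2 * U / u) ^ 3⌉₊ : ℝ) * (n + 1 : ℝ) ^ 3 :=
      hB.trans (mul_le_mul_of_nonneg_right h2 (by positivity))
    exact_mod_cast h3
  rw [← hA, mul_assoc]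
  exact hAB.trans (Nat.mul_le_mul_left _ hB')

end Tiling

open scoped Classical

/-! ## The face-centered cubic lattice -/

namespace Fcc

/-- Squared distance. -/
noncomputable def sq (x p : E3) : ℝ := (x 0 - p 0) ^ 2 + (x 1 - p 1) ^ 2 + (x 2 - p 2) ^ 2

theorem sq_eq (x p : E3) : sq x p = dist x p ^ 2 := by
  rw [EuclideanSpace.dist_eq, Real.sq_sqrt (by positivity), Fin.sum_univ_three, Real.dist_eq, Real.dist_eq,
    Real.dist_eq, sq_abs, sq_abs, sq_abs, sq]

theorem dist_le_iff (x y p q : E3) : dist x p ≤ dist y q ↔ sq x p ≤ sq y q := by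
  rw [sq_eq, sq_eq, sq_le_sq₀ dist_nonneg dist_nonneg]

theorem sq_nonneg' (x p : E3) : 0 ≤ sq x p := by rw [sq]; positivity

theorem sq_comm (x p : E3) : sq x p = sq p x := by rw [sq, sq]; ring

theorem ext3 {x y : E3} (h0 : x 0 = y 0) (h1 : x 1 = y 1) (h2 : x 2 = y 2) : x = y := by
  ext i
  fin_cases i
  · exact h0
  · exact h1
  · exact h2

theorem sq_eq_zero {x p : E3} : sq x p = 0 ↔ x = p := by
  rw [sq_eq, pow_eq_zero_iff two_ne_zero, dist_eq_zero]

@[simp] theorem pt3_0 (a b c : ℝ) : pt3 a b c 0 = a := rfl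
@[simp] theorem pt3_1 (a b c : ℝ) : pt3 a b c 1 = b := rfl
@[simp] theorem pt3_2 (a b c : ℝ) : pt3 a b c 2 = c := rfl

/-- Integer points. -/
noncomputable def zp (a : ℤ × ℤ × ℤ) : E3 := pt3 a.1 a.2.1 a.2.2

@[simp] theorem zp_0 (a : ℤ × ℤ × ℤ) : zp a 0 = a.1 := rfl
@[simp] theorem zp_1 (a : ℤ × ℤ × ℤ) : zp a 1 = a.2.1 := rfl
@[simp] theorem zp_2 (a : ℤ × ℤ × ℤ) : zp a 2 = a.2.2 := rfl

theorem zp_inj {a b : ℤ × ℤ × ℤ} (h : zp a = zp b) : a = b := by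
  have h0 : (a.1 : ℝ) = b.1 := congrArg (fun x : E3 => x 0) h
  have h1 : (a.2.1 : ℝ) = b.2.1 := congrArg (fun x : E3 => x 1) h
  have h2 : (a.2.2 : ℝ) = b.2.2 := congrArg (fun x : E3 => x 2) h
  norm_cast at h0 h1 h2
  ext <;> assumption

/-- Squared distance of integer points. -/
def zsq (a b : ℤ × ℤ × ℤ) : ℤ := (a.1 - b.1) ^ 2 + (a.2.1 - b.2.1) ^ 2 + (a.2.2 - b.2.2) ^ 2

theorem sq_zp (a b : ℤ × ℤ × ℤ) : sq (zp a) (zp b) = zsq a b := by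
  simp [sq, zsq]

/-- Parity of integer points. -/
def ev (a : ℤ × ℤ × ℤ) : Prop := (a.1 + a.2.1 + a.2.2) % 2 = 0

theorem mem_L {p : E3} : p ∈ fccLattice ↔ ∃ a, p = zp a ∧ ev a := by
  constructor
  · rintro ⟨a, b, c, h, he⟩
    exact ⟨(a, b, c), h, Int.even_iff.1 he⟩
  · rintro ⟨a, h, he⟩
    exact ⟨a.1, a.2.1, a.2.2, h, Int.even_iff.2 he⟩

theorem zp_mem {a : ℤ × ℤ × ℤ} (h : ev a) : zp a ∈ fccLattice := mem_L.2 ⟨a, rfl, h⟩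

theorem sq_mod (a : ℤ) : a ^ 2 % 2 = a % 2 := by
  rcases Int.emod_two_eq_zero_or_one a with h | h <;> simp [pow_two, Int.mul_emod, h]

theorem zsq_mod (a b : ℤ × ℤ × ℤ) :
    zsq a b % 2 = ((a.1 + a.2.1 + a.2.2) + (b.1 + b.2.1 + b.2.2)) % 2 := by
  have h0 := sq_mod (a.1 - b.1)
  have h1 := sq_mod (a.2.1 - b.2.1)
  have h2 := sq_mod (a.2.2 - b.2.2)
  unfold zsq
  omega

theorem zsq_nonneg (a b : ℤ × ℤ × ℤ) : 0 ≤ zsq a b := by unfold zsq; positivity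

theorem sep {p q : E3} (hp : p ∈ fccLattice) (hq : q ∈ fccLattice) (hne : p ≠ q) : 2 ≤ sq p q := by
  obtain ⟨a, rfl, ha⟩ := mem_L.1 hp
  obtain ⟨b, rfl, hb⟩ := mem_L.1 hq
  have h1 : sq (zp a) (zp b) ≠ 0 := fun h => hne (sq_eq_zero.1 h)
  rw [sq_zp] at h1 ⊢
  have h2 := zsq_mod a b
  have h3 := zsq_nonneg a b
  unfold ev at ha hb
  have h4 : zsq a b ≠ 0 := by exact_mod_cast h1
  have : 2 ≤ zsq a b := by omega
  exact_mod_cast this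

theorem sep4 {p q : E3} (hp : p ∈ fccLattice) (hq : q ∈ fccLattice) (hne : p ≠ q) (h : sq p q < 4) :
    sq p q = 2 := by
  have h0 := sep hp hq hne
  obtain ⟨a, rfl, ha⟩ := mem_L.1 hp
  obtain ⟨b, rfl, hb⟩ := mem_L.1 hq
  rw [sq_zp] at h h0 ⊢
  have h2 := zsq_mod a b
  unfold ev at ha hb
  have h3 : zsq a b < 4 := by exact_mod_cast h
  have h4 : 2 ≤ zsq a b := by exact_mod_cast h0
  have : zsq a b = 2 := by omega
  exact_mod_cast this

/-- The covering radius of the lattice is one, attained only at odd integer points. -/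
theorem covering (x : E3) : (∃ q ∈ fccLattice, sq x q < 1) ∨ ∃ a, x = zp a ∧ ¬ ev a := by
  obtain ⟨a, ha⟩ : ∃ a : ℤ, a = round (x 0) := ⟨_, rfl⟩
  obtain ⟨b, hb⟩ : ∃ a : ℤ, a = round (x 1) := ⟨_, rfl⟩
  obtain ⟨c, hc⟩ : ∃ a : ℤ, a = round (x 2) := ⟨_, rfl⟩
  have ha' := abs_sub_round (x 0)
  have hb' := abs_sub_round (x 1)
  have hc' := abs_sub_round (x 2)
  rw [← ha] at ha'
  rw [← hb] at hb'
  rw [← hc] at hc'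
  obtain ⟨d, hd⟩ : ∃ d, d = x 0 - a := ⟨_, rfl⟩
  obtain ⟨e, he⟩ : ∃ d, d = x 1 - b := ⟨_, rfl⟩
  obtain ⟨f, hf⟩ : ∃ d, d = x 2 - c := ⟨_, rfl⟩
  have hx0 : x 0 = a + d := by linarith
  have hx1 : x 1 = b + e := by linarith
  have hx2 : x 2 = c + f := by linarith
  rw [← hd] at ha'
  rw [← he] at hb'
  rw [← hf] at hc'
  rw [abs_le] at ha' hb' hc'
  by_cases hev : ev (a, b, c)
  · refine Or.inl ⟨zp (a, b, c), zp_mem hev, ?_⟩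
    rw [sq]
    simp only [zp_0, zp_1, zp_2, hx0, hx1, hx2]
    nlinarith
  by_cases h0 : d = 0 ∧ e = 0 ∧ f = 0
  · refine Or.inr ⟨(a, b, c), ext3 ?_ ?_ ?_, hev⟩
    · rw [hx0, h0.1]; simp
    · rw [hx1, h0.2.1]; simp
    · rw [hx2, h0.2.2]; simp
  left
  have key : ∀ {d e f : ℝ}, |d| ≤ 1 / 2 → |e| ≤ |d| → |f| ≤ |d| → ¬ (d = 0) →
      ∃ s : ℤ, s % 2 = 1 ∧ (d - s) ^ 2 + e ^ 2 + f ^ 2 < 1 := by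
    intro d e f h1 h2 h3 h4
    have h5 : 0 < |d| := abs_pos.2 h4
    have he2 : e ^ 2 ≤ |d| ^ 2 := by rw [← sq_abs e]; gcongr
    have hf2 : f ^ 2 ≤ |d| ^ 2 := by rw [← sq_abs f]; gcongr
    rcases le_total 0 d with h | h
    · rw [abs_of_nonneg h] at *
      refine ⟨1, by norm_num, ?_⟩
      push_cast
      nlinarith
    · rw [abs_of_nonpos h] at *
      refine ⟨-1, by norm_num, ?_⟩
      push_cast
      nlinarith
  unfold ev at hev
  dsimp only at hev
  rw [← abs_le] at ha' hb' hc'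
  rcases le_total |e| |d| with h1 | h1
  · rcases le_total |f| |d| with h2 | h2
    · obtain ⟨s, hs, hlt⟩ := key ha' h1 h2 (by
        rintro rfl
        simp only [abs_zero, abs_nonpos_iff] at h1 h2
        exact h0 ⟨rfl, h1, h2⟩)
      refine ⟨zp (a + s, b, c), zp_mem (by unfold ev; dsimp only; omega), ?_⟩
      rw [sq]
      simp only [zp_0, zp_1, zp_2, hx0, hx1, hx2]
      push_cast
      nlinarith
    · obtain ⟨s, hs, hlt⟩ := key hc' h2 (h1.trans h2) (by
        rintro rfl
        have h3 := h1.trans h2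
        simp only [abs_zero, abs_nonpos_iff] at h2 h3
        exact h0 ⟨h2, h3, rfl⟩)
      refine ⟨zp (a, b, c + s), zp_mem (by unfold ev; dsimp only; omega), ?_⟩
      rw [sq]
      simp only [zp_0, zp_1, zp_2, hx0, hx1, hx2]
      push_cast
      nlinarith
  · rcases le_total |f| |e| with h2 | h2
    · obtain ⟨s, hs, hlt⟩ := key hb' h1 h2 (by
        rintro rfl
        simp only [abs_zero, abs_nonpos_iff] at h1 h2
        exact h0 ⟨h1, rfl, h2⟩)
      refine ⟨zp (a, b + s, c), zp_mem (by unfold ev; dsimp only; omega), ?_⟩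
      rw [sq]
      simp only [zp_0, zp_1, zp_2, hx0, hx1, hx2]
      push_cast
      nlinarith
    · obtain ⟨s, hs, hlt⟩ := key hc' h2 (h1.trans h2) (by
        rintro rfl
        have h3 := h1.trans h2
        simp only [abs_zero, abs_nonpos_iff] at h2 h3
        exact h0 ⟨h3, h2, rfl⟩)
      refine ⟨zp (a, b, c + s), zp_mem (by unfold ev; dsimp only; omega), ?_⟩
      rw [sq]
      simp only [zp_0, zp_1, zp_2, hx0, hx1, hx2]
      push_cast
      nlinarith

theorem covering' (x : E3) : ∃ q ∈ fccLattice, sq x q ≤ 1 := by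
  rcases covering x with ⟨q, hq, h⟩ | ⟨a, rfl, ha⟩
  · exact ⟨q, hq, h.le⟩
  · refine ⟨zp (a.1 + 1, a.2.1, a.2.2), zp_mem (by unfold ev at *; dsimp only at *; omega), ?_⟩
    rw [sq_zp]
    simp [zsq]

theorem finite_ball (x : E3) (R : ℝ) : {p ∈ fccLattice | sq x p ≤ R}.Finite := by
  have hfin : ∀ y : ℝ, {a : ℤ | (y - a) ^ 2 ≤ R}.Finite := by
    intro y
    refine (Set.finite_Icc ⌊y - |R| - 1⌋ ⌈y + |R| + 1⌉).subset ?_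
    intro a ha
    have ha : (y - a) ^ 2 ≤ R := ha
    have h1 := le_abs_self R
    have h2 := abs_nonneg R
    constructor
    · have h3 : y - |R| - 1 ≤ a := by nlinarith
      have := Int.floor_le (y - |R| - 1)
      exact_mod_cast this.trans h3
    · have h3 : a ≤ y + |R| + 1 := by nlinarith
      have := Int.le_ceil (y + |R| + 1)
      exact_mod_cast h3.trans this
  refine (((hfin (x 0)).prod ((hfin (x 1)).prod (hfin (x 2)))).image zp).subset ?_
  rintro p ⟨hp, hle⟩
  obtain ⟨a, rfl, -⟩ := mem_L.1 hp
  rw [sq] at hle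
  simp only [zp_0, zp_1, zp_2] at hle
  refine ⟨a, ⟨?_, ?_, ?_⟩, rfl⟩
  · show (x 0 - (a.1 : ℝ)) ^ 2 ≤ R
    nlinarith [sq_nonneg (x 1 - a.2.1), sq_nonneg (x 2 - a.2.2)]
  · show (x 1 - (a.2.1 : ℝ)) ^ 2 ≤ R
    nlinarith [sq_nonneg (x 0 - a.1), sq_nonneg (x 2 - a.2.2)]
  · show (x 2 - (a.2.2 : ℝ)) ^ 2 ≤ R
    nlinarith [sq_nonneg (x 0 - a.1), sq_nonneg (x 1 - a.2.1)]

/-! ### Nearest lattice points -/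

theorem mem_N {x p : E3} : p ∈ nearestLatticePts x ↔ p ∈ fccLattice ∧ ∀ q ∈ fccLattice, sq x p ≤ sq x q := by
  refine and_congr_right fun _ => forall_congr' fun q => imp_congr_right fun _ => ?_
  exact dist_le_iff _ _ _ _

theorem mem_cell {x p : E3} : x ∈ voronoiCell p ↔ ∀ q ∈ fccLattice, sq x p ≤ sq x q := by
  refine forall_congr' fun q => imp_congr_right fun _ => ?_
  exact dist_le_iff _ _ _ _

theorem mem_N_iff {x p : E3} : p ∈ nearestLatticePts x ↔ p ∈ fccLattice ∧ x ∈ voronoiCell p := by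
  rw [mem_N, mem_cell]

theorem N_eq {x p q : E3} (hp : p ∈ nearestLatticePts x) (hq : q ∈ nearestLatticePts x) : sq x p = sq x q :=
  le_antisymm ((mem_N.1 hp).2 q (mem_N.1 hq).1) ((mem_N.1 hq).2 p (mem_N.1 hp).1)

theorem N_of_le {x p q : E3} (hp : p ∈ nearestLatticePts x) (hq : q ∈ fccLattice) (h : sq x q ≤ sq x p) :
    q ∈ nearestLatticePts x :=
  mem_N.2 ⟨hq, fun r hr => h.trans ((mem_N.1 hp).2 r hr)⟩

theorem N_le_one {x p : E3} (hp : p ∈ nearestLatticePts x) : sq x p ≤ 1 := by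
  obtain ⟨q, hq, h⟩ := covering' x
  exact ((mem_N.1 hp).2 q hq).trans h

theorem N_finite (x : E3) : (nearestLatticePts x).Finite :=
  (finite_ball x 1).subset fun _ hp => ⟨(mem_N.1 hp).1, N_le_one hp⟩

theorem N_nonempty (x : E3) : (nearestLatticePts x).Nonempty := by
  obtain ⟨q, hq, h⟩ := covering' x
  obtain ⟨p, hp, hmin⟩ := Set.exists_min_image _ (sq x) (finite_ball x 1) ⟨q, hq, h⟩
  refine ⟨p, mem_N.2 ⟨hp.1, fun r hr => ?_⟩⟩
  by_cases hr1 : sq x r ≤ 1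
  · exact hmin r ⟨hr, hr1⟩
  · exact hp.2.trans (le_of_not_ge hr1)

theorem sq_continuous (p : E3) : Continuous fun x => sq x p := by
  unfold sq
  fun_prop

/-- Upper semicontinuity of the set of nearest points. -/
theorem N_usc (x : E3) : ∀ᶠ y in nhds x, nearestLatticePts y ⊆ nearestLatticePts x := by
  obtain ⟨p, hp⟩ := N_nonempty x
  have h1 : ∀ᶠ y in nhds x, ∀ q ∈ {q ∈ fccLattice | sq x q ≤ 9} \ nearestLatticePts x, sq y p < sq y q := by
    rw [Filter.eventually_all_finite ((finite_ball x 9).sdiff)]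
    rintro q ⟨hq, hqN⟩
    refine ((sq_continuous p).continuousAt.eventually_lt (sq_continuous q).continuousAt ?_)
    by_contra h
    exact hqN (N_of_le hp hq.1 (not_lt.1 h))
  filter_upwards [h1, Metric.ball_mem_nhds x one_pos] with y hy hyb
  intro q hq
  by_contra hqN
  have hq9 : sq x q ≤ 9 := by
    have h2 := N_le_one hq
    rw [sq_eq] at h2 ⊢
    have h3 := dist_triangle x y q
    rw [Metric.mem_ball, dist_comm] at hyb
    have h4 : dist y q ≤ 1 := by nlinarith [dist_nonneg (x := y) (y := q)]
    nlinarith [dist_nonneg (x := x) (y := q)]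
  have := hy q ⟨⟨(mem_N.1 hq).1, hq9⟩, hqN⟩
  exact absurd ((mem_N.1 hq).2 p (mem_N.1 hp).1) (not_le.2 this)

/-- Along a line, nearest points do not increase for small parameters. -/
theorem N_line (x v : E3) : ∃ ε : ℝ, 0 < ε ∧ ∀ t : ℝ, |t| ≤ ε → nearestLatticePts (x + t • v) ⊆ nearestLatticePts x := by
  have hc : Filter.Tendsto (fun t : ℝ => x + t • v) (nhds 0) (nhds x) := by
    have : Continuous fun t : ℝ => x + t • v := by fun_prop
    simpa using this.tendsto 0
  have := hc.eventually (N_usc x)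
  obtain ⟨ε, hε, h⟩ := Metric.eventually_nhds_iff.1 this
  refine ⟨ε / 2, half_pos hε, fun t ht => h ?_⟩
  rw [Real.dist_eq, sub_zero]
  linarith

end Fcc

open scoped Classical

/-! ## The Voronoi tessellation is an LFC tiling -/

namespace Fcc

/-- The functional `⟨v, ·⟩`. -/
noncomputable def dot (v : E3) : StrongDual ℝ E3 := innerSL ℝ v

theorem dot_apply (v x : E3) : dot v x = v 0 * x 0 + v 1 * x 1 + v 2 * x 2 := by
  show inner ℝ v x = _
  rw [PiLp.inner_apply, Fin.sum_univ_three]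
  simp only [RCLike.inner_apply, conj_trivial]
  ring

theorem dot_comm (v x : E3) : dot v x = dot x v := by
  rw [dot_apply, dot_apply]; ring

theorem dot_sub_left (u v x : E3) : dot (u - v) x = dot u x - dot v x := by
  rw [dot_apply, dot_apply, dot_apply]
  simp only [PiLp.sub_apply]
  ring

theorem sq_diff (x y p q : E3) : sq y q - sq y p = sq x q - sq x p - 2 * (dot (q - p) y - dot (q - p) x) := by
  simp only [dot_apply, sq, PiLp.sub_apply]
  ring

theorem sq_line (x v p q : E3) (t : ℝ) :
    sq (x + t • v) q - sq (x + t • v) p = sq x q - sq x p - 2 * (t * dot q v - t * dot p v) := by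
  simp only [dot_apply, sq, PiLp.add_apply, PiLp.smul_apply, smul_eq_mul]
  ring

theorem N_line' (x v : E3) : ∃ ε : ℝ, 0 < ε ∧ ∀ t : ℝ, |t| ≤ ε → ∀ p, p ∈ nearestLatticePts (x + t • v) ↔
    p ∈ nearestLatticePts x ∧ ∀ r ∈ nearestLatticePts x, t * dot r v ≤ t * dot p v := by
  obtain ⟨ε, hε, h⟩ := N_line x v
  refine ⟨ε, hε, fun t ht p => ⟨fun hp => ⟨h t ht hp, fun r hr => ?_⟩, fun ⟨hp, hmax⟩ => ?_⟩⟩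
  · have h1 := sq_line x v p r t
    have h2 := N_eq hr (h t ht hp)
    have h3 := (mem_N.1 hp).2 r (mem_N.1 hr).1
    linarith
  · obtain ⟨r, hr⟩ := N_nonempty (x + t • v)
    have hr' := h t ht hr
    refine N_of_le hr (mem_N.1 hp).1 ?_
    have h1 := sq_line x v p r t
    have h2 := N_eq hr' hp
    have h3 := hmax r hr'
    linarith

theorem N_line_const {x v : E3} (hv : ∀ p ∈ nearestLatticePts x, ∀ q ∈ nearestLatticePts x, dot p v = dot q v) :
    ∃ ε : ℝ, 0 < ε ∧ ∀ t : ℝ, |t| ≤ ε → nearestLatticePts (x + t • v) = nearestLatticePts x := by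
  obtain ⟨ε, hε, h⟩ := N_line' x v
  refine ⟨ε, hε, fun t ht => Set.ext fun p => ?_⟩
  rw [h t ht p]
  exact ⟨fun h => h.1, fun hp => ⟨hp, fun r hr => by rw [hv r hr p hp]⟩⟩

/-- Points whose nearest lattice points contain `K`. -/
def VK (K : Set E3) : Set E3 := {y | K ⊆ nearestLatticePts y}

theorem VK_exposed {K : Set E3} (hK : K.Finite) {p : E3} (hp : p ∈ K) :
    IsExposed ℝ (voronoiCell p) (VK K) := by
  rintro ⟨x, hx⟩
  have hx : K ⊆ nearestLatticePts x := hx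
  lift K to Finset E3 using hK
  have hpL : p ∈ fccLattice := (mem_N.1 (hx hp)).1
  have key : ∀ y ∈ voronoiCell p, ∀ q ∈ K, dot (q - p) y ≤ dot (q - p) x := by
    intro y hy q hq
    have h1 := sq_diff x y p q
    have h2 := mem_cell.1 hy q (mem_N.1 (hx hq)).1
    have h3 := N_eq (hx hq) (hx hp)
    linarith
  have hsum : ∀ y, (∑ q ∈ K, dot (q - p)) y = ∑ q ∈ K, dot (q - p) y := by
    intro y
    simp
  refine ⟨∑ q ∈ K, dot (q - p), Set.ext fun y => ⟨fun hy => ?_, fun ⟨hy, hmax⟩ => ?_⟩⟩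
  · have hy : (K : Set E3) ⊆ nearestLatticePts y := hy
    refine ⟨(mem_N_iff.1 (hy hp)).2, fun z hz => ?_⟩
    rw [hsum, hsum]
    refine Finset.sum_le_sum fun q hq => ?_
    have h1 := sq_diff x y p q
    have h2 := N_eq (hy hq) (hy hp)
    have h3 := N_eq (hx hq) (hx hp)
    have h4 := key z hz q hq
    linarith
  · intro q hq
    have h5 := hmax x (mem_N_iff.1 (hx hp)).2
    rw [hsum, hsum] at h5
    have h6 := (Finset.sum_eq_sum_iff_of_le (key y hy)).1 (le_antisymm (Finset.sum_le_sum (key y hy)) h5) q hq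
    have h1 := sq_diff x y p q
    have h3 := N_eq (hx hq) (hx hp)
    exact N_of_le (mem_N_iff.2 ⟨hpL, hy⟩) (mem_N.1 (hx hq)).1 (by linarith)

theorem cell_eq (p : E3) (hp : p ∈ fccLattice) : voronoiCell p = VK {p} := by
  ext x
  show _ ↔ {p} ⊆ nearestLatticePts x
  rw [Set.singleton_subset_iff, mem_N_iff]
  exact ⟨fun h => ⟨hp, h⟩, fun h => h.2⟩

theorem cell_inter (p q : E3) (hp : p ∈ fccLattice) (hq : q ∈ fccLattice) :
    voronoiCell p ∩ voronoiCell q = VK {p, q} := by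
  ext x
  show _ ↔ {p, q} ⊆ nearestLatticePts x
  rw [Set.insert_subset_iff, Set.singleton_subset_iff, mem_N_iff, mem_N_iff]
  exact ⟨fun h => ⟨⟨hp, h.1⟩, ⟨hq, h.2⟩⟩, fun h => ⟨h.1.2, h.2.2⟩⟩

theorem cell_convex (p : E3) : Convex ℝ (voronoiCell p) := by
  intro x hx y hy a b ha hb hab
  rw [mem_cell] at *
  intro q hq
  have h1 := hx q hq
  have h2 := hy q hq
  have h3 : sq (a • x + b • y) q - sq (a • x + b • y) p = a * (sq x q - sq x p) + b * (sq y q - sq y p) := by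
    obtain rfl : b = 1 - a := by linarith
    simp only [sq, PiLp.add_apply, PiLp.smul_apply, smul_eq_mul]
    ring
  nlinarith [mul_nonneg ha (sub_nonneg.2 h1), mul_nonneg hb (sub_nonneg.2 h2)]

theorem cell_closed (p : E3) : IsClosed (voronoiCell p) := by
  have : voronoiCell p = ⋂ q ∈ fccLattice, {x | sq x p ≤ sq x q} := by
    ext x
    simp only [Set.mem_iInter]
    exact mem_cell
  rw [this]
  exact isClosed_biInter fun q _ => isClosed_le (sq_continuous p) (sq_continuous q)

theorem cell_subset {p : E3} (hp : p ∈ fccLattice) : voronoiCell p ⊆ Metric.closedBall p 1 := by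
  intro x hx
  have h := N_le_one (mem_N_iff.2 ⟨hp, hx⟩)
  rw [sq_eq] at h
  rw [Metric.mem_closedBall]
  nlinarith [dist_nonneg (x := x) (y := p)]

theorem cell_compact {p : E3} (hp : p ∈ fccLattice) : IsCompact (voronoiCell p) :=
  Metric.isCompact_of_isClosed_isBounded (cell_closed p) (Metric.isBounded_closedBall.subset (cell_subset hp))

theorem cell_ball {p : E3} (hp : p ∈ fccLattice) : Metric.ball p (1 / 2) ⊆ voronoiCell p := by
  intro x hx
  rw [mem_cell]
  intro q hq
  by_cases hpq : p = q
  · rw [hpq]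
  have h := sep hp hq hpq
  rw [Metric.mem_ball] at hx
  rw [sq_eq] at *
  rw [sq_eq]
  have h1 := dist_triangle p x q
  rw [dist_comm p x] at h1
  have h2 : 1 ≤ dist p q := by nlinarith [dist_nonneg (x := p) (y := q)]
  have h3 : dist x p ≤ dist x q := by linarith
  nlinarith [dist_nonneg (x := x) (y := p)]

theorem ext_finite {p : E3} (hp : p ∈ fccLattice) : ((voronoiCell p).extremePoints ℝ).Finite := by
  have hfin : {p' ∈ fccLattice | sq p p' ≤ 4}.Finite := finite_ball p 4
  refine Set.Finite.of_finite_image (f := nearestLatticePts) (hfin.finite_subsets.subset ?_) ?_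
  · rintro _ ⟨x, hx, rfl⟩
    intro q hq
    refine ⟨(mem_N.1 hq).1, ?_⟩
    have h1 := N_le_one hq
    have h2 := N_le_one (mem_N_iff.2 ⟨hp, hx.1⟩)
    rw [sq_eq] at *
    have h3 := dist_triangle p x q
    rw [dist_comm p x] at h3
    have h4 : dist x p ≤ 1 := by nlinarith [dist_nonneg (x := x) (y := p)]
    have h5 : dist x q ≤ 1 := by nlinarith [dist_nonneg (x := x) (y := q)]
    nlinarith [dist_nonneg (x := p) (y := q)]
  · intro x hx y hy hxy
    have hxy : nearestLatticePts x = nearestLatticePts y := hxy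
    obtain ⟨ε, hε, h⟩ := N_line_const (x := x) (v := y - x) (by
      intro q hq r hr
      have h1 := sq_diff x y r q
      have h2 := N_eq hq hr
      rw [hxy] at hq hr
      have h3 := N_eq hq hr
      rw [dot_sub_left, dot_sub_left] at h1
      rw [map_sub, map_sub]
      linarith)
    have hm : ∀ t : ℝ, |t| ≤ ε → x + t • (y - x) ∈ voronoiCell p := by
      intro t ht
      have : p ∈ nearestLatticePts (x + t • (y - x)) := by
        rw [h t ht]
        exact mem_N_iff.2 ⟨hp, hx.1⟩
      exact (mem_N_iff.1 this).2
    have h1 := hx.2 (hm ε (abs_of_pos hε).le) (hm (-ε) (by rw [abs_neg]; exact (abs_of_pos hε).le)) ⟨1 / 2, 1 / 2,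
      by norm_num, by norm_num, by norm_num, by module⟩
    have h2 : ε • (y - x) = 0 := by simpa using h1
    rcases smul_eq_zero.1 h2 with h3 | h3
    · exact absurd h3 hε.ne'
    · exact (sub_eq_zero.1 h3).symm

theorem hV : IsLFCTiling RhombicDodecahedralHoneycomb where
  polytope := by
    rintro _ ⟨p, hp, rfl⟩
    refine ⟨⟨(ext_finite hp).toFinset, ?_⟩, ⟨p, ?_⟩⟩
    · rw [Set.Finite.coe_toFinset]
      have h := closure_convexHull_extremePoints (cell_compact hp) (cell_convex p)
      rw [((ext_finite hp).isCompact_convexHull (𝕜 := ℝ)).isClosed.closure_eq] at h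
      exact h.symm
    · exact interior_mono (cell_ball hp) (by rw [Metric.isOpen_ball.interior_eq]; simp)
  covers := by
    refine Set.eq_univ_of_forall fun x => ?_
    obtain ⟨p, hp⟩ := N_nonempty x
    obtain ⟨h1, h2⟩ := mem_N_iff.1 hp
    exact ⟨_, ⟨p, h1, rfl⟩, h2⟩
  face_to_face := by
    rintro _ ⟨p, hp, rfl⟩ _ ⟨q, hq, rfl⟩
    rw [cell_inter p q hp hq]
    exact ⟨VK_exposed (by simp) (by simp), VK_exposed (by simp) (by simp)⟩
  locally_finite := by
    intro B hB
    obtain ⟨R, hR⟩ := hB.subset_closedBall 0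
    refine ((finite_ball 0 ((R + 1) ^ 2)).image voronoiCell).subset ?_
    rintro _ ⟨⟨p, hp, rfl⟩, x, hx, hxB⟩
    refine ⟨p, ⟨hp, ?_⟩, rfl⟩
    have h1 := cell_subset hp hx
    have h2 := hR hxB
    rw [Metric.mem_closedBall] at h1 h2
    rw [sq_eq]
    have h3 := dist_triangle 0 x p
    rw [dist_comm] at h2
    have h4 : dist 0 p ≤ R + 1 := by linarith
    gcongr

end Fcc

open scoped Classical

/-! ## Faces of the Voronoi and Delaunay tessellations -/

namespace Fcc

open Tiling

theorem isFace_VK (x : E3) : IsFace RhombicDodecahedralHoneycomb (VK (nearestLatticePts x)) := by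
  obtain ⟨p, hp⟩ := N_nonempty x
  exact ⟨_, ⟨p, (mem_N.1 hp).1, rfl⟩, VK_exposed (N_finite x) hp⟩

theorem mem_VK_self (x : E3) : x ∈ VK (nearestLatticePts x) := fun _ h => h

theorem car_VK (x : E3) : (car hV x).1 = VK (nearestLatticePts x) := by
  refine Set.Subset.antisymm (car_subset hV (isFace_VK x) (mem_VK_self x)) fun y hy => ?_
  have hy : nearestLatticePts x ⊆ nearestLatticePts y := hy
  obtain ⟨_, ⟨p, hp, rfl⟩, hexp⟩ := (car hV x).2.2
  have hxF := mem_car hV x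
  obtain ⟨l, hl⟩ := hexp ⟨x, hxF⟩
  rw [hl] at hxF ⊢
  have hpx : p ∈ nearestLatticePts x := mem_N_iff.2 ⟨hp, hxF.1⟩
  refine ⟨(mem_N_iff.1 (hy hpx)).2, fun z hz => (hxF.2 z hz).trans ?_⟩
  obtain ⟨ε, hε, h⟩ := N_line_const (x := x) (v := y - x) (by
    intro q hq r hr
    have h1 := sq_diff x y r q
    have h2 := N_eq hq hr
    have h3 := N_eq (hy hq) (hy hr)
    rw [dot_sub_left, dot_sub_left] at h1
    rw [map_sub, map_sub]
    linarith)
  have h1 : x + (-ε) • (y - x) ∈ voronoiCell p := by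
    have : p ∈ nearestLatticePts (x + (-ε) • (y - x)) := by
      rw [h (-ε) (by rw [abs_neg]; exact (abs_of_pos hε).le)]
      exact hpx
    exact (mem_N_iff.1 this).2
  have h2 := hxF.2 _ h1
  rw [map_add, map_smul, map_sub, smul_eq_mul] at h2
  nlinarith

/-- The lattice points nearest to a relative interior point of a Voronoi face. -/
noncomputable def lab (F : NF RhombicDodecahedralHoneycomb) : Set E3 := nearestLatticePts (bary hV F)

theorem eq_VK (F : NF RhombicDodecahedralHoneycomb) : F.1 = VK (lab F) := by
  have h := car_VK (bary hV F)
  rw [car_bary] at h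
  exact h

theorem lab_le {F G : NF RhombicDodecahedralHoneycomb} : F ≤ G ↔ lab G ⊆ lab F := by
  constructor
  · intro h
    have h1 : bary hV F ∈ G.1 := h (bary_mem hV F)
    rw [eq_VK] at h1
    exact h1
  · intro h
    rw [NF.le_iff, eq_VK, eq_VK]
    intro y hy
    exact h.trans hy

theorem lab_inj {F G : NF RhombicDodecahedralHoneycomb} (h : lab F = lab G) : F = G :=
  le_antisymm (lab_le.2 h.ge) (lab_le.2 h.le)

theorem lab_surj (x : E3) : ∃ F, lab F = nearestLatticePts x := by
  refine ⟨car hV x, Set.Subset.antisymm ?_ ?_⟩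
  · have h1 := mem_car hV x
    rw [eq_VK] at h1
    exact h1
  · have h1 := bary_mem hV (car hV x)
    rw [car_VK] at h1
    exact h1

theorem exists_full (F : NF RhombicDodecahedralHoneycomb) :
    ∃ c, lab F ⊆ nearestLatticePts c ∧ affineSpan ℝ (nearestLatticePts c) = ⊤ := by
  obtain ⟨Φ, hΦ⟩ := (geo hV).exists_cham_mem F
  have hle : Φ.1 0 ≤ F := by
    refine le_of_inc (hT := hV) ?_ ?_
    · have := Φ.2.2 0 ((geo hV).rk F)
      rw [hΦ] at this
      exact this
    · rw [Φ.2.1 0]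
      exact Fin.zero_le _
  have hd : dim (Φ.1 0) = 0 := congrArg Fin.val (Φ.2.1 0)
  obtain ⟨F0, hF0⟩ : ∃ F0, F0 = Φ.1 0 := ⟨_, rfl⟩
  rw [← hF0] at hle hd
  refine ⟨bary hV F0, lab_le.1 hle, ?_⟩
  obtain ⟨c, hc⟩ : ∃ c, c = bary hV F0 := ⟨_, rfl⟩
  have hN : F0.1 = VK (nearestLatticePts c) := by rw [hc]; exact eq_VK F0
  rw [← hc]
  by_contra hne
  have hne' : vectorSpan ℝ (nearestLatticePts c) ≠ ⊤ := fun h =>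
    hne ((AffineSubspace.affineSpan_eq_top_iff_vectorSpan_eq_top_of_nonempty ℝ E3 E3 (N_nonempty c)).2 h)
  have h1 : (vectorSpan ℝ (nearestLatticePts c))ᗮ ≠ ⊥ := fun h => hne' (Submodule.orthogonal_eq_bot_iff.1 h)
  obtain ⟨v, hv, hv0⟩ := Submodule.exists_mem_ne_zero_of_ne_bot h1
  obtain ⟨ε, hε, h⟩ := N_line_const (x := c) (v := v) (by
    intro p hp q hq
    have h2 := (Submodule.mem_orthogonal _ _).1 hv (p -ᵥ q) (vsub_mem_vectorSpan ℝ hp hq)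
    have h3 : dot (p - q) v = 0 := h2
    rw [dot_sub_left] at h3
    linarith)
  have hm1 : c ∈ F0.1 := by rw [hN]; exact mem_VK_self c
  have hm2 : c + ε • v ∈ F0.1 := by
    rw [hN]
    exact (h ε (abs_of_pos hε).le).ge
  have h2 : (affineSpan ℝ F0.1).direction = ⊥ := Submodule.finrank_eq_zero.1 hd
  have h3 : (c + ε • v) -ᵥ c ∈ (affineSpan ℝ F0.1).direction := by
    rw [direction_affineSpan]
    exact vsub_mem_vectorSpan ℝ hm2 hm1
  rw [h2, Submodule.mem_bot] at h3
  have h4 : ε • v = 0 := by simpa using h3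
  rcases smul_eq_zero.1 h4 with h5 | h5
  · exact hε.ne' h5
  · exact hv0 h5

theorem le_on_hull (l : StrongDual ℝ E3) {S : Set E3} {a : ℝ} (h : ∀ q ∈ S, l q ≤ a) :
    ∀ y ∈ convexHull ℝ S, l y ≤ a := by
  intro y hy
  exact convexHull_min (fun q hq => h q hq) (convex_halfSpace_le l.isLinear a) hy

theorem face_eq_hull' {S : Set E3} (hS : S.Finite) {F : Set E3} (hF : IsExposed ℝ (convexHull ℝ S) F) :
    F = convexHull ℝ (S ∩ F) := by
  lift S to Finset E3 using hS
  exact Poly.face_eq_hull hF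

theorem hull_exposed {x c : E3} (h : nearestLatticePts x ⊆ nearestLatticePts c) :
    IsExposed ℝ (convexHull ℝ (nearestLatticePts c)) (convexHull ℝ (nearestLatticePts x)) := by
  intro _
  obtain ⟨p, hp⟩ := N_nonempty x
  obtain ⟨F, hFdef⟩ : ∃ F, F = {z ∈ convexHull ℝ (nearestLatticePts c) |
    ∀ y ∈ convexHull ℝ (nearestLatticePts c), dot (x - c) y ≤ dot (x - c) z} := ⟨_, rfl⟩
  have hF : IsExposed ℝ (convexHull ℝ (nearestLatticePts c)) F := fun _ => ⟨_, hFdef⟩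
  have key : ∀ q r, q ∈ nearestLatticePts c → r ∈ nearestLatticePts c →
      sq x q - sq x r = - 2 * (dot (x - c) q - dot (x - c) r) := by
    intro q r hq hr
    have h1 := sq_diff c x r q
    have h2 := N_eq hq hr
    rw [dot_comm _ x, dot_comm _ c, map_sub, map_sub] at h1
    rw [dot_sub_left, dot_sub_left]
    linarith
  have hI : nearestLatticePts c ∩ F = nearestLatticePts x := by
    ext q
    constructor
    · rintro ⟨hq, hqF⟩
      rw [hFdef] at hqF
      have h1 := hqF.2 p (subset_convexHull ℝ _ (h hp))
      have h2 := key q p hq (h hp)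
      exact N_of_le hp (mem_N.1 hq).1 (by linarith)
    · intro hq
      refine ⟨h hq, ?_⟩
      rw [hFdef]
      refine ⟨subset_convexHull ℝ _ (h hq), le_on_hull _ fun r hr => ?_⟩
      have h1 := key r q hr (h hq)
      have h2 := (mem_N.1 hq).2 r (mem_N.1 hr).1
      linarith
  have := face_eq_hull' (N_finite c) hF
  rw [hI] at this
  rw [← this]
  exact ⟨_, hFdef⟩

theorem hull_subset {x c : E3} :
    convexHull ℝ (nearestLatticePts x) ⊆ convexHull ℝ (nearestLatticePts c) ↔
      nearestLatticePts x ⊆ nearestLatticePts c := by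
  refine ⟨fun h p hp => ?_, fun h => convexHull_mono h⟩
  obtain ⟨q, hq⟩ := N_nonempty c
  have h1 : p ∈ Metric.closedBall c (dist c q) := by
    refine convexHull_min (fun r hr => ?_) (convex_closedBall c _) (h (subset_convexHull ℝ _ hp))
    rw [Metric.mem_closedBall, dist_comm, dist_le_iff]
    exact (N_eq hr hq).le
  rw [Metric.mem_closedBall, dist_comm, dist_le_iff] at h1
  exact N_of_le hq (mem_N.1 hp).1 h1

theorem exposed_hull {c : E3} {F : Set E3} (hF : IsExposed ℝ (convexHull ℝ (nearestLatticePts c)) F)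
    (hne : F.Nonempty) : ∃ x, F = convexHull ℝ (nearestLatticePts x) := by
  obtain ⟨l, hl⟩ := hF hne
  have h0 := face_eq_hull' (N_finite c) hF
  obtain ⟨v, hv⟩ : ∃ v : E3, ∀ x, dot x v = l x := by
    refine ⟨(InnerProductSpace.toDual ℝ E3).symm l, fun x => ?_⟩
    rw [dot_comm]
    exact InnerProductSpace.toDual_symm_apply (𝕜 := ℝ) (E := E3)
  obtain ⟨ε, hε, h⟩ := N_line' c v
  refine ⟨c + ε • v, h0.trans ?_⟩
  congr 1
  ext p
  rw [h ε (abs_of_pos hε).le p]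
  refine and_congr_right fun hp => ?_
  rw [hl]
  constructor
  · rintro ⟨-, h1⟩ r hr
    rw [hv, hv]
    exact mul_le_mul_of_nonneg_left (h1 r (subset_convexHull ℝ _ hr)) hε.le
  · intro h1
    refine ⟨subset_convexHull ℝ _ hp, le_on_hull _ fun r hr => ?_⟩
    have h2 := h1 r hr
    rw [hv, hv] at h2
    exact le_of_mul_le_mul_left h2 hε

theorem hull_isFace (F : NF RhombicDodecahedralHoneycomb) :
    IsFace TetrahedralOctahedralHoneycomb (convexHull ℝ (lab F)) := by
  obtain ⟨c, h1, h2⟩ := exists_full F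
  exact ⟨_, ⟨c, h2, rfl⟩, hull_exposed h1⟩

/-- The Delaunay face dual to a Voronoi face. -/
noncomputable def delFace (F : NF RhombicDodecahedralHoneycomb) : NF TetrahedralOctahedralHoneycomb :=
  ⟨convexHull ℝ (lab F), (N_nonempty _).convexHull, hull_isFace F⟩

theorem delFace_le {F G : NF RhombicDodecahedralHoneycomb} : delFace F ≤ delFace G ↔ G ≤ F := by
  rw [lab_le]
  exact hull_subset

theorem delFace_bij : Function.Bijective delFace := by
  constructor
  · intro F G h
    exact le_antisymm (delFace_le.1 h.ge) (delFace_le.1 h.le)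
  · rintro ⟨F, hne, _, ⟨c, hc, rfl⟩, hF⟩
    obtain ⟨x, rfl⟩ := exposed_hull hF hne
    obtain ⟨G, hG⟩ := lab_surj x
    exact ⟨G, Subtype.ext (congrArg (convexHull ℝ) hG)⟩

theorem del_nonempty : (TetrahedralOctahedralHoneycomb).Nonempty := by
  obtain ⟨F, -⟩ := lab_surj 0
  obtain ⟨c, -, h⟩ := exists_full F
  exact ⟨_, c, h, rfl⟩

end Fcc

open scoped Classical

/-! ## Local structure of the lattice -/

namespace Fcc

/-- The twelve minimal vectors. -/
def Dv : Finset (ℤ × ℤ × ℤ) := {(1, 1, 0), (1, -1, 0), (-1, 1, 0), (-1, -1, 0), (1, 0, 1), (1, 0, -1), (-1, 0, 1),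
  (-1, 0, -1), (0, 1, 1), (0, 1, -1), (0, -1, 1), (0, -1, -1)}

/-- The six unit vectors. -/
def Uv : Finset (ℤ × ℤ × ℤ) := {(1, 0, 0), (-1, 0, 0), (0, 1, 0), (0, -1, 0), (0, 0, 1), (0, 0, -1)}

theorem mem_Dv {a b : ℤ × ℤ × ℤ} : b - a ∈ Dv ↔ zsq a b = 2 := by
  obtain ⟨a0, a1, a2⟩ := a
  obtain ⟨b0, b1, b2⟩ := b
  obtain ⟨x, hx⟩ : ∃ x, x = b0 - a0 := ⟨_, rfl⟩
  obtain ⟨y, hy⟩ : ∃ x, x = b1 - a1 := ⟨_, rfl⟩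
  obtain ⟨z, hz⟩ : ∃ x, x = b2 - a2 := ⟨_, rfl⟩
  have h1 : ((b0, b1, b2) : ℤ × ℤ × ℤ) - (a0, a1, a2) = (x, y, z) := by rw [hx, hy, hz]; rfl
  have h2 : zsq (a0, a1, a2) (b0, b1, b2) = x ^ 2 + y ^ 2 + z ^ 2 := by
    rw [hx, hy, hz]; unfold zsq; ring
  rw [h1, h2]
  constructor
  · intro h
    simp only [Dv, Finset.mem_insert, Finset.mem_singleton, Prod.mk.injEq] at h
    rcases h with h | h | h | h | h | h | h | h | h | h | h | h <;> obtain ⟨rfl, rfl, rfl⟩ := h <;> norm_num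
  · intro h
    clear h1 h2 hx hy hz
    have hx1 : -1 ≤ x := by nlinarith [sq_nonneg y, sq_nonneg z]
    have hx2 : x ≤ 1 := by nlinarith [sq_nonneg y, sq_nonneg z]
    have hy1 : -1 ≤ y := by nlinarith [sq_nonneg x, sq_nonneg z]
    have hy2 : y ≤ 1 := by nlinarith [sq_nonneg x, sq_nonneg z]
    have hz1 : -1 ≤ z := by nlinarith [sq_nonneg y, sq_nonneg x]
    have hz2 : z ≤ 1 := by nlinarith [sq_nonneg y, sq_nonneg x]
    interval_cases x <;> interval_cases y <;> interval_cases z <;> first | (exfalso; revert h; norm_num; done) | decide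

theorem mem_Uv {a b : ℤ × ℤ × ℤ} : b - a ∈ Uv ↔ zsq a b = 1 := by
  obtain ⟨a0, a1, a2⟩ := a
  obtain ⟨b0, b1, b2⟩ := b
  obtain ⟨x, hx⟩ : ∃ x, x = b0 - a0 := ⟨_, rfl⟩
  obtain ⟨y, hy⟩ : ∃ x, x = b1 - a1 := ⟨_, rfl⟩
  obtain ⟨z, hz⟩ : ∃ x, x = b2 - a2 := ⟨_, rfl⟩
  have h1 : ((b0, b1, b2) : ℤ × ℤ × ℤ) - (a0, a1, a2) = (x, y, z) := by rw [hx, hy, hz]; rfl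
  have h2 : zsq (a0, a1, a2) (b0, b1, b2) = x ^ 2 + y ^ 2 + z ^ 2 := by
    rw [hx, hy, hz]; unfold zsq; ring
  rw [h1, h2]
  constructor
  · intro h
    simp only [Uv, Finset.mem_insert, Finset.mem_singleton, Prod.mk.injEq] at h
    rcases h with h | h | h | h | h | h <;> obtain ⟨rfl, rfl, rfl⟩ := h <;> norm_num
  · intro h
    clear h1 h2 hx hy hz
    have hx1 : -1 ≤ x := by nlinarith [sq_nonneg y, sq_nonneg z]
    have hx2 : x ≤ 1 := by nlinarith [sq_nonneg y, sq_nonneg z]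
    have hy1 : -1 ≤ y := by nlinarith [sq_nonneg x, sq_nonneg z]
    have hy2 : y ≤ 1 := by nlinarith [sq_nonneg x, sq_nonneg z]
    have hz1 : -1 ≤ z := by nlinarith [sq_nonneg y, sq_nonneg x]
    have hz2 : z ≤ 1 := by nlinarith [sq_nonneg y, sq_nonneg x]
    interval_cases x <;> interval_cases y <;> interval_cases z <;> first | (exfalso; revert h; norm_num; done) | decide

theorem sq_zp_eq {a b : ℤ × ℤ × ℤ} {n : ℤ} : sq (zp a) (zp b) = (n : ℝ) ↔ zsq a b = n := by
  rw [sq_zp]; norm_cast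

theorem sq_two {a b : ℤ × ℤ × ℤ} : sq (zp a) (zp b) = 2 ↔ b - a ∈ Dv := by
  rw [mem_Dv, ← sq_zp_eq]; norm_num

theorem sq_one {a b : ℤ × ℤ × ℤ} : sq (zp a) (zp b) = 1 ↔ b - a ∈ Uv := by
  rw [mem_Uv, ← sq_zp_eq]; norm_num

theorem ev_of_two {a b : ℤ × ℤ × ℤ} (ha : ev a) (h : b - a ∈ Dv) : ev b := by
  rw [mem_Dv] at h
  have := zsq_mod a b
  unfold ev at *
  omega

theorem ev_of_one {a b : ℤ × ℤ × ℤ} (h : b - a ∈ Uv) : ev b ↔ ¬ ev a := by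
  rw [mem_Uv] at h
  have := zsq_mod a b
  unfold ev at *
  omega

theorem dec_common : ∀ e ∈ Dv, (Dv.filter fun d => d - e ∈ Dv).card = 4 := by decide

theorem dec_tet : ∀ e ∈ Dv, ∀ f ∈ Dv, f - e ∈ Dv → ∃ d ∈ Dv, d - e ∈ Dv ∧ d - f ∈ Dv := by decide

theorem dec_oct : ∀ e ∈ Dv, ∀ f ∈ Dv, f - e ∈ Dv → ∃ u ∈ Uv, e - u ∈ Uv ∧ f - u ∈ Uv := by decide

theorem dec_octn : ∀ e ∈ Uv, (Uv.filter fun d => d - e ∈ Dv).card = 4 := by decide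

theorem neg_Uv : ∀ e ∈ Uv, -e ∈ Uv := by decide

/-- Counting lattice points by a translated finite set. -/
theorem ncard_translate (a : ℤ × ℤ × ℤ) (s : Finset (ℤ × ℤ × ℤ)) :
    ((fun d => zp (d + a)) '' (s : Set (ℤ × ℤ × ℤ))).ncard = s.card := by
  rw [Set.ncard_image_of_injective _ fun x y h => add_right_cancel (zp_inj h), Set.ncard_coe_finset]

theorem common {p q : E3} (hp : p ∈ fccLattice) (hq : q ∈ fccLattice) (h : sq p q = 2) :
    {w ∈ fccLattice | sq p w = 2 ∧ sq q w = 2}.ncard = 4 := by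
  obtain ⟨a, rfl, ha⟩ := mem_L.1 hp
  obtain ⟨b, rfl, hb⟩ := mem_L.1 hq
  rw [sq_two] at h
  rw [← dec_common _ h, ← ncard_translate a]
  congr 1
  ext w
  simp only [Set.mem_image, Finset.mem_coe, Finset.mem_filter]
  constructor
  · rintro ⟨hw, h1, h2⟩
    obtain ⟨c, rfl, hc⟩ := mem_L.1 hw
    rw [sq_two] at h1 h2
    exact ⟨c - a, ⟨h1, by convert h2 using 1; abel⟩, by rw [sub_add_cancel]⟩
  · rintro ⟨d, ⟨h1, h2⟩, rfl⟩
    have h3 : sq (zp a) (zp (d + a)) = 2 := sq_two.2 (by rwa [add_sub_cancel_right])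
    refine ⟨zp_mem (ev_of_two ha (sq_two.1 h3)), h3, sq_two.2 ?_⟩
    convert h2 using 1
    abel

theorem exists_tet {p q r : E3} (hp : p ∈ fccLattice) (hq : q ∈ fccLattice) (hr : r ∈ fccLattice) (h1 : sq p q = 2)
    (h2 : sq p r = 2) (h3 : sq q r = 2) : ∃ w ∈ fccLattice, sq p w = 2 ∧ sq q w = 2 ∧ sq r w = 2 := by
  obtain ⟨a, rfl, ha⟩ := mem_L.1 hp
  obtain ⟨b, rfl, hb⟩ := mem_L.1 hq
  obtain ⟨c, rfl, hc⟩ := mem_L.1 hr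
  rw [sq_two] at h1 h2 h3
  obtain ⟨d, e1, e2, e3⟩ := dec_tet _ h1 _ h2 (by convert h3 using 1; abel)
  have h4 : d + a - a ∈ Dv := by rwa [add_sub_cancel_right]
  refine ⟨zp (d + a), zp_mem (ev_of_two ha h4), sq_two.2 h4, sq_two.2 ?_, sq_two.2 ?_⟩
  · convert e2 using 1; abel
  · convert e3 using 1; abel

/-- The six lattice points around an odd point. -/
def Oct (a : ℤ × ℤ × ℤ) : Set E3 := {p | p ∈ fccLattice ∧ sq (zp a) p = 1}

theorem exists_oct {p q r : E3} (hp : p ∈ fccLattice) (hq : q ∈ fccLattice) (hr : r ∈ fccLattice) (h1 : sq p q = 2)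
    (h2 : sq p r = 2) (h3 : sq q r = 2) : ∃ a, ¬ ev a ∧ p ∈ Oct a ∧ q ∈ Oct a ∧ r ∈ Oct a := by
  obtain ⟨a, rfl, ha⟩ := mem_L.1 hp
  obtain ⟨b, rfl, hb⟩ := mem_L.1 hq
  obtain ⟨c, rfl, hc⟩ := mem_L.1 hr
  rw [sq_two] at h1 h2 h3
  obtain ⟨d, e1, e2, e3⟩ := dec_oct _ h1 _ h2 (by convert h3 using 1; abel)
  have h4 : a - (d + a) ∈ Uv := by
    convert neg_Uv d e1 using 1
    abel
  refine ⟨d + a, (ev_of_one h4).1 ha, ⟨hp, sq_one.2 h4⟩, ⟨hq, sq_one.2 ?_⟩, ⟨hr, sq_one.2 ?_⟩⟩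
  · convert e2 using 1; abel
  · convert e3 using 1; abel

theorem oct_count {a : ℤ × ℤ × ℤ} (ha : ¬ ev a) {v : E3} (hv : v ∈ Oct a) :
    {w ∈ Oct a | sq v w = 2}.ncard = 4 := by
  obtain ⟨hv, h⟩ := hv
  obtain ⟨b, rfl, hb⟩ := mem_L.1 hv
  rw [sq_one] at h
  rw [← dec_octn _ h, ← ncard_translate a]
  congr 1
  ext w
  simp only [Set.mem_image, Finset.mem_coe, Finset.mem_filter]
  constructor
  · rintro ⟨⟨hw, h1⟩, h2⟩
    obtain ⟨c, rfl, hc⟩ := mem_L.1 hw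
    rw [sq_one] at h1
    rw [sq_two] at h2
    exact ⟨c - a, ⟨h1, by convert h2 using 1; abel⟩, by rw [sub_add_cancel]⟩
  · rintro ⟨d, ⟨h1, h2⟩, rfl⟩
    have h3 : d + a - a ∈ Uv := by rwa [add_sub_cancel_right]
    refine ⟨⟨zp_mem ((ev_of_one h3).2 ha), sq_one.2 h3⟩, sq_two.2 ?_⟩
    convert h2 using 1
    abel

theorem oct_mem {a u : ℤ × ℤ × ℤ} (ha : ¬ ev a) (hu : u ∈ Uv) : zp (u + a) ∈ Oct a := by
  have h3 : u + a - a ∈ Uv := by rwa [add_sub_cancel_right]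
  exact ⟨zp_mem ((ev_of_one h3).2 ha), sq_one.2 h3⟩

theorem oct_N {a : ℤ × ℤ × ℤ} (ha : ¬ ev a) : nearestLatticePts (zp a) = Oct a := by
  have key : ∀ q ∈ fccLattice, 1 ≤ sq (zp a) q := by
    intro q hq
    obtain ⟨b, rfl, hb⟩ := mem_L.1 hq
    rw [sq_zp]
    have h1 := zsq_mod a b
    have h2 := zsq_nonneg a b
    unfold ev at *
    have : 1 ≤ zsq a b := by omega
    exact_mod_cast this
  ext p
  rw [mem_N]
  constructor
  · rintro ⟨hp, h⟩
    exact ⟨hp, le_antisymm (N_le_one (mem_N.2 ⟨hp, h⟩)) (key p hp)⟩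
  · rintro ⟨hp, h⟩
    exact ⟨hp, fun q hq => by rw [h]; exact key q hq⟩

theorem oct_max {a : ℤ × ℤ × ℤ} (ha : ¬ ev a) {x : E3} (h : Oct a ⊆ nearestLatticePts x) : x = zp a := by
  have h0 := N_eq (h (oct_mem ha (u := (1, 0, 0)) (by decide))) (h (oct_mem ha (u := (-1, 0, 0)) (by decide)))
  have h1 := N_eq (h (oct_mem ha (u := (0, 1, 0)) (by decide))) (h (oct_mem ha (u := (0, -1, 0)) (by decide)))
  have h2 := N_eq (h (oct_mem ha (u := (0, 0, 1)) (by decide))) (h (oct_mem ha (u := (0, 0, -1)) (by decide)))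
  simp only [sq, zp_0, zp_1, zp_2, Prod.fst_add, Prod.snd_add] at h0 h1 h2
  push_cast at h0 h1 h2
  refine ext3 ?_ ?_ ?_
  · rw [zp_0]; linarith
  · rw [zp_1]; linarith
  · rw [zp_2]; linarith

/-- Cliques of the minimal distance graph. -/
def Clique (K : Set E3) : Prop :=
  K ⊆ fccLattice ∧ K.Finite ∧ K.Nonempty ∧ ∀ p ∈ K, ∀ q ∈ K, p ≠ q → sq p q = 2

theorem Clique.mono {K K' : Set E3} (h : Clique K) (hs : K' ⊆ K) (hne : K'.Nonempty) : Clique K' :=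
  ⟨hs.trans h.1, h.2.1.subset hs, hne, fun p hp q hq => h.2.2.2 p (hs hp) q (hs hq)⟩

theorem Clique.insert {K : Set E3} (h : Clique K) {w : E3} (hw : w ∈ fccLattice) (hs : ∀ p ∈ K, sq p w = 2) :
    Clique (Insert.insert w K) := by
  refine ⟨Set.insert_subset hw h.1, h.2.1.insert w, Set.insert_nonempty _ _, ?_⟩
  rintro p (rfl | hp) q (rfl | hq) hne
  · exact absurd rfl hne
  · rw [sq_comm]; exact hs q hq
  · exact hs p hp
  · exact h.2.2.2 p hp q hq hne

theorem clique_singleton {p : E3} (hp : p ∈ fccLattice) : Clique {p} := by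
  refine ⟨by simpa using hp, Set.finite_singleton p, Set.singleton_nonempty p, ?_⟩
  rintro p rfl q rfl h
  exact absurd rfl h

theorem oct_not_clique {a : ℤ × ℤ × ℤ} (ha : ¬ ev a) : ¬ Clique (Oct a) := by
  intro h
  have h1 := oct_mem ha (u := (1, 0, 0)) (by decide)
  have h2 := oct_mem ha (u := (-1, 0, 0)) (by decide)
  have h4 : sq (zp ((1, 0, 0) + a)) (zp ((-1, 0, 0) + a)) = 4 := by
    simp only [sq, zp_0, zp_1, zp_2, Prod.fst_add, Prod.snd_add]
    push_cast
    ring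
  have hne : zp ((1, 0, 0) + a) ≠ zp ((-1, 0, 0) + a) := by
    intro h
    rw [← sq_eq_zero, h4] at h
    norm_num at h
  have := h.2.2.2 _ h1 _ h2 hne
  rw [h4] at this
  norm_num at this

theorem clique_or_oct (x : E3) : Clique (nearestLatticePts x) ∨ ∃ a, ¬ ev a ∧ nearestLatticePts x = Oct a := by
  rcases covering x with ⟨c, hc, h⟩ | ⟨a, rfl, ha⟩
  · left
    refine ⟨fun p hp => (mem_N.1 hp).1, N_finite x, N_nonempty x, fun p hp q hq hne => ?_⟩
    refine sep4 (mem_N.1 hp).1 (mem_N.1 hq).1 hne ?_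
    have h1 := ((mem_N.1 hp).2 c hc).trans_lt h
    have h2 := ((mem_N.1 hq).2 c hc).trans_lt h
    have h3 : sq p q ≤ 2 * (sq x p + sq x q) := by
      unfold sq
      nlinarith [sq_nonneg (x 0 - p 0 + (x 0 - q 0)), sq_nonneg (x 1 - p 1 + (x 1 - q 1)),
        sq_nonneg (x 2 - p 2 + (x 2 - q 2))]
    linarith
  · exact Or.inr ⟨a, ha, oct_N ha⟩

theorem clique_N {K : Set E3} (h : Clique K) : ∃ x, nearestLatticePts x = K := by
  obtain ⟨hL, hfin, hne, h2⟩ := h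
  lift K to Finset E3 using hfin
  obtain ⟨k, hk⟩ : ∃ k : ℝ, k = K.card := ⟨_, rfl⟩
  have hk0 : 0 < k := by
    rw [hk]
    exact_mod_cast Finset.card_pos.2 (by simpa using hne)
  obtain ⟨x, hx⟩ : ∃ x : E3, k • x = ∑ p ∈ K, p := ⟨k⁻¹ • ∑ p ∈ K, p, by rw [smul_inv_smul₀ hk0.ne']⟩
  have hc : ∀ i, k * x i = ∑ p ∈ K, p i := by
    intro i
    have := congrArg (fun y : E3 => y i) hx
    simpa using this
  have key : ∀ q, k * sq x q = ∑ p ∈ K, sq q p - ∑ p ∈ K, sq x p := by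
    intro q
    have e : ∀ p, sq q p - sq x p = (q 0 ^ 2 - x 0 ^ 2 + (q 1 ^ 2 - x 1 ^ 2) + (q 2 ^ 2 - x 2 ^ 2)) -
        (2 * (q 0 - x 0) * p 0 + 2 * (q 1 - x 1) * p 1 + 2 * (q 2 - x 2) * p 2) := by
      intro p; unfold sq; ring
    rw [← Finset.sum_sub_distrib, Finset.sum_congr rfl fun p _ => e p, Finset.sum_sub_distrib, Finset.sum_const,
      Finset.sum_add_distrib, Finset.sum_add_distrib, ← Finset.mul_sum, ← Finset.mul_sum, ← Finset.mul_sum,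
      ← hc, ← hc, ← hc, nsmul_eq_mul, ← hk]
    unfold sq
    ring
  have hin : ∀ q ∈ K, ∑ p ∈ K, sq q p = 2 * k - 2 := by
    intro q hq
    rw [← Finset.add_sum_erase K _ hq, Finset.sum_congr rfl fun p hp =>
      h2 q hq p (Finset.mem_of_mem_erase hp) (Finset.ne_of_mem_erase hp).symm, Finset.sum_const, nsmul_eq_mul,
      sq_eq_zero.2 rfl, Finset.cast_card_erase_of_mem hq, hk]
    ring
  have hout : ∀ q ∈ fccLattice, q ∉ K → 2 * k ≤ ∑ p ∈ K, sq q p := by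
    intro q hq hqK
    have := Finset.card_nsmul_le_sum K (fun p => sq q p) 2 fun p hp =>
      sep hq (hL hp) (fun h => hqK (h ▸ hp))
    rw [nsmul_eq_mul, ← hk] at this
    linarith
  have hle : ∀ q ∈ K, ∀ r ∈ fccLattice, sq x q ≤ sq x r := by
    intro q hq r hr
    have h3 := key q
    have h4 := key r
    rw [hin q hq] at h3
    refine le_of_mul_le_mul_left ?_ hk0
    by_cases hrK : r ∈ K
    · rw [hin r hrK] at h4
      linarith
    · have := hout r hr hrK
      linarith
  refine ⟨x, Set.ext fun q => ⟨fun hq => ?_, fun hq => mem_N.2 ⟨hL hq, hle q hq⟩⟩⟩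
  obtain ⟨p, hp⟩ := hne
  by_contra hqK
  have h3 := key q
  have h4 := key p
  have h5 := (mem_N.1 hq).2 p (hL hp)
  have h6 := hout q (mem_N.1 hq).1 hqK
  rw [hin p hp] at h4
  nlinarith

end Fcc

open scoped Classical

/-! ## Combinatorial data of the dual of the Voronoi tessellation -/

namespace Fcc

open Tiling Geo

/-- The Delaunay geometry. -/
noncomputable def DG : Geo (NF RhombicDodecahedralHoneycomb) := (geo hV).dual

theorem DG_inc {F K : NF RhombicDodecahedralHoneycomb} : DG.inc F K ↔ lab F ⊆ lab K ∨ lab K ⊆ lab F := by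
  rw [← lab_le, ← lab_le]
  exact or_comm

theorem DG_lt {F K : NF RhombicDodecahedralHoneycomb} (h : lab F ⊆ lab K) (hne : F ≠ K) : DG.rk F < DG.rk K := by
  have h1 : K < F := lt_of_le_of_ne (lab_le.2 h) hne.symm
  exact Fin.rev_lt_rev.2 (rk_lt (hT := hV) h1)

theorem DG_sub {F K : NF RhombicDodecahedralHoneycomb} (h : DG.inc F K) (hr : DG.rk F ≤ DG.rk K) : lab F ⊆ lab K := by
  rcases DG_inc.1 h with h1 | h1
  · exact h1
  · by_cases hne : K = F
    · rw [hne]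
    · exact absurd (DG_lt h1 hne) (not_lt.2 hr)

theorem lab_cham (Φ : DG.Cham) {i j : Fin 4} (h : i ≤ j) : lab (Φ.1 i) ⊆ lab (Φ.1 j) :=
  DG_sub (Φ.inc i j) (by rw [Φ.rk, Φ.rk]; exact h)

theorem lab_cham_ne (Φ : DG.Cham) {i j : Fin 4} (h : i ≠ j) : lab (Φ.1 i) ≠ lab (Φ.1 j) := by
  intro h1
  have h2 := congrArg DG.rk (lab_inj h1)
  rw [Φ.rk, Φ.rk] at h2
  exact h h2

theorem lab_finite (F : NF RhombicDodecahedralHoneycomb) : (lab F).Finite := N_finite _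

theorem lab_clique_or (F : NF RhombicDodecahedralHoneycomb) : Clique (lab F) ∨ ∃ a, ¬ ev a ∧ lab F = Oct a :=
  clique_or_oct _

theorem oct_rk {F : NF RhombicDodecahedralHoneycomb} {a : ℤ × ℤ × ℤ} (ha : ¬ ev a) (h : lab F = Oct a) :
    DG.rk F = 3 := by
  obtain ⟨Φ, hΦ⟩ := DG.exists_cham_mem F
  have h1 : lab F ⊆ lab (Φ.1 3) := by
    have := lab_cham Φ (i := DG.rk F) (j := 3) (Fin.le_last _)
    rwa [hΦ] at this
  have h2 : lab (Φ.1 3) = lab F := by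
    rw [h] at h1
    have h3 := oct_max ha h1
    rw [h, ← oct_N ha, ← h3]
    rfl
  rw [← lab_inj h2]
  exact Φ.rk 3

theorem clique_rk_ge (F : NF RhombicDodecahedralHoneycomb) : (DG.rk F : ℕ) + 1 ≤ (lab F).ncard := by
  obtain ⟨Φ, hΦ⟩ := DG.exists_cham_mem F
  have key : ∀ n : ℕ, ∀ hn : n < 4, n + 1 ≤ (lab (Φ.1 ⟨n, hn⟩)).ncard := by
    intro n
    induction n with
    | zero =>
      intro hn
      exact (Set.ncard_pos (lab_finite _)).2 (N_nonempty _)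
    | succ n ih =>
      intro hn
      have h1 := ih (by omega)
      have h2 : (lab (Φ.1 ⟨n, by omega⟩)).ncard < (lab (Φ.1 ⟨n + 1, hn⟩)).ncard := by
        refine Set.ncard_lt_ncard ?_ (lab_finite _)
        refine (lab_cham Φ ?_).ssubset_of_ne (lab_cham_ne Φ ?_)
        · exact Fin.mk_le_mk.2 (by omega)
        · intro h
          have := congrArg Fin.val h
          simp at this
      omega
  have := key (DG.rk F) (DG.rk F).2
  rwa [Fin.eta, hΦ] at this

theorem clique_rk_le (n : ℕ) : ∀ F : NF RhombicDodecahedralHoneycomb, Clique (lab F) → (lab F).ncard = n + 1 →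
    n ≤ (DG.rk F : ℕ) := by
  induction n with
  | zero => intro F _ _; exact Nat.zero_le _
  | succ n ih =>
    intro F hF hn
    obtain ⟨p, hp⟩ := hF.2.2.1
    have h1 : (lab F \ {p}).ncard = n + 1 := by
      rw [Set.ncard_sdiff_singleton_of_mem hp, hn]
      rfl
    have hne : (lab F \ {p}).Nonempty := by
      rw [← Set.ncard_pos (hF.2.1.subset Set.sdiff_subset)]
      omega
    have hc := hF.mono Set.sdiff_subset hne
    obtain ⟨x, hx⟩ := clique_N hc
    obtain ⟨K, hK⟩ := lab_surj x
    rw [hx] at hK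
    have h2 := ih K (by rw [hK]; exact hc) (by rw [hK]; exact h1)
    have h3 : DG.rk K < DG.rk F := by
      refine DG_lt (by rw [hK]; exact Set.sdiff_subset) ?_
      rintro rfl
      rw [hK] at hp
      exact hp.2 rfl
    have : (DG.rk K : ℕ) < DG.rk F := h3
    omega

theorem clique_rk {F : NF RhombicDodecahedralHoneycomb} (hF : Clique (lab F)) :
    (lab F).ncard = (DG.rk F : ℕ) + 1 := by
  have h1 := clique_rk_ge F
  have h2 := clique_rk_le ((lab F).ncard - 1) F hF (by omega)
  omega

theorem clique_of_rk {F : NF RhombicDodecahedralHoneycomb} (h : DG.rk F ≠ 3) : Clique (lab F) := by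
  rcases lab_clique_or F with h1 | ⟨a, ha, h1⟩
  · exact h1
  · exact absurd (oct_rk ha h1) h

theorem exists_face {K : Set E3} (h : Clique K) :
    ∃ F, lab F = K ∧ K.ncard = (DG.rk F : ℕ) + 1 := by
  obtain ⟨x, hx⟩ := clique_N h
  obtain ⟨F, hF⟩ := lab_surj x
  rw [hx] at hF
  exact ⟨F, hF, by rw [← hF]; exact clique_rk (by rw [hF]; exact h)⟩

theorem exists_rk {K : Set E3} (h : Clique K) (i : Fin 4) (hi : K.ncard = (i : ℕ) + 1) :
    ∃ F, lab F = K ∧ DG.rk F = i := by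
  obtain ⟨F, h1, h2⟩ := exists_face h
  exact ⟨F, h1, Fin.ext (by omega)⟩

theorem lab_cham_clique (Φ : DG.Cham) {i : Fin 4} (h : i ≠ 3) : Clique (lab (Φ.1 i)) :=
  clique_of_rk (by rw [Φ.rk]; exact h)

theorem lab_cham_card (Φ : DG.Cham) {i : Fin 4} (h : i ≠ 3) : (lab (Φ.1 i)).ncard = (i : ℕ) + 1 := by
  have := clique_rk (lab_cham_clique Φ h)
  rwa [Φ.rk] at this

theorem lab_ncard (S : Set (NF RhombicDodecahedralHoneycomb)) : S.ncard = (lab '' S).ncard :=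
  (Set.ncard_image_of_injective S fun _ _ h => lab_inj h).symm

/-- Whether the top element is an octahedron. -/
noncomputable def octType (Φ : DG.Cham) : Bool := decide (∃ a, ¬ ev a ∧ lab (Φ.1 3) = Oct a)

theorem octType_flip (Φ : DG.Cham) : octType (ρ 3 Φ) = !octType Φ := by
  obtain ⟨K, hK⟩ : ∃ K, K = lab (Φ.1 2) := ⟨_, rfl⟩
  have hc : Clique K := by rw [hK]; exact lab_cham_clique Φ (by decide)
  have hcard : K.ncard = 3 := by rw [hK]; exact lab_cham_card Φ (by decide)
  obtain ⟨p, q, r, hpq, hpr, hqr, hKe⟩ := Set.ncard_eq_three.1 hcard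
  have hp : p ∈ K := by rw [hKe]; simp
  have hq : q ∈ K := by rw [hKe]; simp
  have hr : r ∈ K := by rw [hKe]; simp
  have e1 := hc.2.2.2 p hp q hq hpq
  have e2 := hc.2.2.2 p hp r hr hpr
  have e3 := hc.2.2.2 q hq r hr hqr
  obtain ⟨w, hw, w1, w2, w3⟩ := exists_tet (hc.1 hp) (hc.1 hq) (hc.1 hr) e1 e2 e3
  obtain ⟨a, ha, a1, a2, a3⟩ := exists_oct (hc.1 hp) (hc.1 hq) (hc.1 hr) e1 e2 e3
  have hall : ∀ z ∈ K, sq z w = 2 := by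
    rw [hKe]
    rintro z (rfl | rfl | rfl)
    · exact w1
    · exact w2
    · exact w3
  have hwK : w ∉ K := by
    intro h
    have := hall w h
    rw [sq_eq_zero.2 rfl] at this
    norm_num at this
  have hct := hc.insert hw hall
  obtain ⟨Ft, hFt, hrt⟩ := exists_rk hct 3 (by rw [Set.ncard_insert_of_notMem hwK hc.2.1, hcard]; rfl)
  obtain ⟨Fo, hFo⟩ := lab_surj (zp a)
  rw [oct_N ha] at hFo
  have hro := oct_rk ha hFo
  have hKo : K ⊆ Oct a := by
    rw [hKe]
    rintro z (rfl | rfl | rfl)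
    · exact a1
    · exact a2
    · exact a3
  have hinc : ∀ F, K ⊆ lab F → ∀ j, j ≠ (3 : Fin 4) → DG.inc F (Φ.1 j) := by
    intro F hF j hj
    have hj2 : j ≤ 2 := by
      have := (by decide : ∀ j : Fin 4, j ≠ 3 → j ≤ 2) j
      exact this hj
    have := lab_cham Φ hj2
    rw [← hK] at this
    exact DG_inc.2 (Or.inr (this.trans hF))
  have ht := eq_or_eq_of_inc Φ Ft (by rw [hrt]; exact hinc Ft (by rw [hFt]; exact Set.subset_insert _ _))
  have ho := eq_or_eq_of_inc Φ Fo (by rw [hro]; exact hinc Fo (by rw [hFo]; exact hKo))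
  rw [hrt] at ht
  rw [hro] at ho
  have hneq : Ft ≠ Fo := by
    rintro rfl
    rw [hFt] at hFo
    rw [hFo] at hct
    exact oct_not_clique ha hct
  have hTo : ∃ a, ¬ ev a ∧ lab Fo = Oct a := ⟨a, ha, hFo⟩
  have hTt : ¬ ∃ a, ¬ ev a ∧ lab Ft = Oct a := by
    rintro ⟨b, hb, h⟩
    rw [hFt] at h
    rw [h] at hct
    exact oct_not_clique hb hct
  unfold octType
  rcases ht with ht | ht <;> rcases ho with ho | ho
  · exact absurd (ht.trans ho.symm) hneq
  · rw [← ht, ← ho, decide_eq_true hTo, decide_eq_false hTt]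
    rfl
  · rw [← ht, ← ho, decide_eq_true hTo, decide_eq_false hTt]
    rfl
  · exact absurd (ht.trans ho.symm) hneq

theorem per01 (Φ : DG.Cham) : per 0 1 Φ = 3 := by
  rw [← per_symm 0 1, per_eq_ncard (by decide), lab_ncard]
  have hc : Clique (lab (Φ.1 2)) := lab_cham_clique Φ (by decide)
  have hcard : (lab (Φ.1 2)).ncard = 3 := lab_cham_card Φ (by decide)
  refine Eq.trans ?_ hcard
  rw [← Set.ncard_image_of_injective (lab (Φ.1 2)) (Set.singleton_injective (α := E3))]
  congr 1
  ext K
  constructor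
  · rintro ⟨F, ⟨hrk, hinc⟩, rfl⟩
    have h1 := hinc 2 (by decide) (by decide)
    have h2 := DG_sub h1 (by rw [hrk]; exact Fin.zero_le _)
    have h3 := clique_rk (clique_of_rk (F := F) (by rw [hrk]; decide))
    rw [hrk] at h3
    obtain ⟨p, hp⟩ := Set.ncard_eq_one.1 h3
    refine ⟨p, h2 (by rw [hp]; rfl), hp.symm⟩
  · rintro ⟨p, hp, rfl⟩
    obtain ⟨F, h1, h2⟩ := exists_rk (clique_singleton (hc.1 hp)) 0 (by simp)
    refine ⟨F, ⟨h2, fun k hk1 hk0 => DG_inc.2 (Or.inl ?_)⟩, h1⟩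
    rw [h1, Set.singleton_subset_iff]
    exact lab_cham Φ ((by decide : ∀ k : Fin 4, k ≠ 1 → k ≠ 0 → 2 ≤ k) k hk1 hk0) hp

theorem pair_inj (v : E3) : Set.InjOn (fun w : E3 => ({v, w} : Set E3)) {w | sq v w = 2} := by
  intro w hw z hz h
  have h : ({v, w} : Set E3) = {v, z} := h
  have h1 : w ∈ ({v, z} : Set E3) := by rw [← h]; simp
  rcases h1 with h1 | h1
  · have hw : sq v w = 2 := hw
    rw [sq_eq_zero.2 h1.symm] at hw
    norm_num at hw
  · exact h1

theorem per12 (Φ : DG.Cham) : per 1 2 Φ = if octType Φ then 4 else 3 := by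
  obtain ⟨v, hv⟩ := Set.ncard_eq_one.1 (lab_cham_card Φ (i := 0) (by decide))
  have hv3 : v ∈ lab (Φ.1 3) := lab_cham Φ (i := 0) (by decide) (by rw [hv]; rfl)
  have hL : ∀ w ∈ lab (Φ.1 3), w ∈ fccLattice := fun w hw => (mem_N.1 hw).1
  have h0 : per 1 2 Φ = {w ∈ lab (Φ.1 3) | sq v w = 2}.ncard := by
    rw [← per_symm 1 2, per_eq_ncard (by decide), lab_ncard]
    rw [← Set.InjOn.ncard_image ((pair_inj v).mono (fun w hw => hw.2 : {w ∈ lab (Φ.1 3) | sq v w = 2} ⊆ _))]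
    congr 1
    ext K
    constructor
    · rintro ⟨F, ⟨hrk, hinc⟩, rfl⟩
      have h1 := DG_sub (hinc 3 (by decide) (by decide)) (by rw [hrk, Φ.rk]; decide)
      have h2 := DG_sub (DG.inc_symm _ _ (hinc 0 (by decide) (by decide))) (by rw [hrk, Φ.rk]; decide)
      have hc := clique_of_rk (F := F) (by rw [hrk]; decide)
      have h3 := clique_rk hc
      rw [hrk] at h3
      have hvF : v ∈ lab F := h2 (by rw [hv]; rfl)
      obtain ⟨x, y, hxy, he⟩ := Set.ncard_eq_two.1 h3
      have hx : x ∈ lab F := by rw [he]; simp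
      have hy : y ∈ lab F := by rw [he]; simp
      have hvF' := hvF
      rw [he] at hvF'
      rcases hvF' with h4 | h4
      · refine ⟨y, ⟨h1 hy, hc.2.2.2 v hvF y hy (by rw [h4]; exact hxy)⟩, ?_⟩
        show ({v, y} : Set E3) = _
        rw [he, h4]
      · have h4 : v = y := h4
        refine ⟨x, ⟨h1 hx, hc.2.2.2 v hvF x hx (by rw [h4]; exact hxy.symm)⟩, ?_⟩
        show ({v, x} : Set E3) = _
        rw [he, h4, Set.pair_comm]
    · rintro ⟨w, ⟨hw, hvw⟩, rfl⟩
      show ({v, w} : Set E3) ∈ _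
      have hne : v ≠ w := by
        rintro rfl
        rw [sq_eq_zero.2 rfl] at hvw
        norm_num at hvw
      have hc : Clique {v, w} := (clique_singleton (hL w hw)).insert (hL v hv3) (by
        rintro p rfl
        rw [sq_comm]
        exact hvw)
      obtain ⟨F, h1, h2⟩ := exists_rk hc 1 (by rw [Set.ncard_pair hne]; rfl)
      refine ⟨F, ⟨h2, fun k hk1 hk0 => ?_⟩, h1⟩
      rcases (by decide : ∀ k : Fin 4, k ≠ 2 → k ≠ 1 → k = 0 ∨ k = 3) k hk1 hk0 with rfl | rfl
      · refine DG_inc.2 (Or.inr ?_)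
        rw [h1, hv]
        simp
      · refine DG_inc.2 (Or.inl ?_)
        rw [h1]
        rintro z (rfl | rfl)
        · exact hv3
        · exact hw
  rw [h0]
  unfold octType
  by_cases ho : ∃ a, ¬ ev a ∧ lab (Φ.1 3) = Oct a
  · rw [decide_eq_true ho, if_pos rfl]
    obtain ⟨a, ha, h⟩ := ho
    rw [h] at hv3 ⊢
    exact oct_count ha hv3
  · rw [decide_eq_false ho, if_neg (by decide)]
    have hc := (lab_clique_or (Φ.1 3)).resolve_right ho
    have h4 := clique_rk hc
    rw [Φ.rk] at h4
    have : {w ∈ lab (Φ.1 3) | sq v w = 2} = lab (Φ.1 3) \ {v} := by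
      ext w
      constructor
      · rintro ⟨hw, h⟩
        refine ⟨hw, ?_⟩
        rintro rfl
        rw [sq_eq_zero.2 rfl] at h
        norm_num at h
      · rintro ⟨hw, h⟩
        exact ⟨hw, hc.2.2.2 v hv3 w hw fun h' => h h'.symm⟩
    rw [this, Set.ncard_sdiff_singleton_of_mem hv3, h4]
    rfl

theorem per23 (Φ : DG.Cham) : per 2 3 Φ = 4 := by
  have hc1 : Clique (lab (Φ.1 1)) := lab_cham_clique Φ (by decide)
  obtain ⟨u, v, huv, hE⟩ := Set.ncard_eq_two.1 (lab_cham_card Φ (i := 1) (by decide))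
  have hu : u ∈ lab (Φ.1 1) := by rw [hE]; simp
  have hv : v ∈ lab (Φ.1 1) := by rw [hE]; simp
  rw [← per_symm 2 3, per_eq_ncard (by decide), lab_ncard]
  refine Eq.trans ?_ (common (hc1.1 hu) (hc1.1 hv) (hc1.2.2.2 u hu v hv huv))
  have hnot : ∀ w, sq u w = 2 ∧ sq v w = 2 → w ∉ lab (Φ.1 1) := by
    rintro w ⟨h1, h2⟩ h
    rw [hE] at h
    rcases h with h | h
    · rw [sq_eq_zero.2 h.symm] at h1
      norm_num at h1
    · have h : w = v := h
      rw [sq_eq_zero.2 h.symm] at h2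
      norm_num at h2
  have hinj : Set.InjOn (fun w : E3 => insert w (lab (Φ.1 1))) {w ∈ fccLattice | sq u w = 2 ∧ sq v w = 2} := by
    intro w hw z hz h
    have h : insert w (lab (Φ.1 1)) = insert z (lab (Φ.1 1)) := h
    have h1 : w ∈ insert z (lab (Φ.1 1)) := by rw [← h]; exact Set.mem_insert _ _
    rcases h1 with h1 | h1
    · exact h1
    · exact absurd h1 (hnot w hw.2)
  rw [← Set.InjOn.ncard_image hinj]
  congr 1
  ext K
  constructor
  · rintro ⟨F, ⟨hrk, hinc⟩, rfl⟩
    have h2 := DG_sub (DG.inc_symm _ _ (hinc 1 (by decide) (by decide))) (by rw [hrk, Φ.rk]; decide)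
    have hc := clique_of_rk (F := F) (by rw [hrk]; decide)
    have h3 := clique_rk hc
    rw [hrk] at h3
    have h4 : (lab F \ lab (Φ.1 1)).ncard = 1 := by
      rw [Set.ncard_sdiff h2 (lab_finite _), h3, lab_cham_card Φ (by decide)]
      rfl
    obtain ⟨w, hw⟩ := Set.ncard_eq_one.1 h4
    have hwm : w ∈ lab F \ lab (Φ.1 1) := by rw [hw]; rfl
    refine ⟨w, ⟨hc.1 hwm.1, hc.2.2.2 u (h2 hu) w hwm.1 ?_, hc.2.2.2 v (h2 hv) w hwm.1 ?_⟩, ?_⟩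
    · rintro rfl
      exact hwm.2 hu
    · rintro rfl
      exact hwm.2 hv
    · show insert w (lab (Φ.1 1)) = lab F
      rw [Set.insert_eq, ← hw, Set.sdiff_union_of_subset h2]
  · rintro ⟨w, ⟨hw, h⟩, rfl⟩
    show insert w (lab (Φ.1 1)) ∈ _
    have hc : Clique (insert w (lab (Φ.1 1))) := hc1.insert hw (by
      rw [hE]
      rintro p (rfl | rfl)
      · exact h.1
      · exact h.2)
    obtain ⟨F, h1, h2⟩ := exists_rk hc 2 (by
      rw [Set.ncard_insert_of_notMem (hnot w h) (lab_finite _), lab_cham_card Φ (by decide)]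
      rfl)
    refine ⟨F, ⟨h2, fun k hk1 hk0 => DG_inc.2 (Or.inr ?_)⟩, h1⟩
    rw [h1]
    exact (lab_cham Φ ((by decide : ∀ k : Fin 4, k ≠ 3 → k ≠ 2 → k ≤ 1) k hk1 hk0)).trans (Set.subset_insert _ _)

theorem dataA_del : DataA 4 DG := by
  refine ⟨octType, fun i hi Φ => ?_, octType_flip, per01, per23, per12⟩
  unfold octType
  rw [ρ_app hi.symm]

end Fcc

open scoped Classical

/-! ## The classification -/

namespace Fcc

open Tiling Geo

variable {T : Set (Set E3)}

/-- A geometry isomorphism to the Delaunay geometry yields an order isomorphism. -/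
noncomputable def toDel (hT : IsLFCTiling T) (f : GIso (geo hT) DG) : NF T ≃o NF TetrahedralOctahedralHoneycomb where
  toEquiv := f.e.trans (Equiv.ofBijective _ delFace_bij)
  map_rel_iff' {p q} := by
    show delFace (f.e p) ≤ delFace (f.e q) ↔ p ≤ q
    rw [delFace_le]
    constructor
    · intro h
      refine le_of_inc (hT := hT) ((f.inc p q).1 (Or.inr h)) ?_
      rw [← f.rk, ← f.rk]
      exact Fin.rev_le_rev.2 (rk_mono (hT := hV) h)
    · intro h
      refine le_of_inc (hT := hV) ((f.inc q p).2 (Or.inr h)) ?_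
      refine Fin.rev_le_rev.1 ?_
      show DG.rk (f.e p) ≤ DG.rk (f.e q)
      rw [f.rk, f.rk]
      exact rk_mono (hT := hT) h

/-- An isomorphism of the duals is an isomorphism. -/
def undual (hT : IsLFCTiling T) (f : GIso (geo hT).dual DG) : GIso (geo hT) (geo hV) where
  e := f.e
  rk p := Fin.rev_injective (f.rk p)
  inc := f.inc

theorem main (T : Set (Set (EucSp 3)))
    (hT : IsLFCTiling T) (hnorm : IsNormalTiling T) (h2 : TwoFlagOrbits (TPoset T)) :
    Nonempty (TPoset T ≃o TPoset TetrahedralOctahedralHoneycomb) ∨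
    Nonempty (TPoset T ≃o TPoset RhombicDodecahedralHoneycomb) := by
  obtain ⟨typ, h⟩ := exists_twoOrb hT h2
  rcases h.classify' (polyGrowth hT hnorm h) with hd | hd
  · obtain ⟨f⟩ := hd.iso dataA_del
    exact Or.inl ⟨tposetCongr (tiles_nonempty hT) del_nonempty (toDel hT f)⟩
  · obtain ⟨f⟩ := hd.iso dataA_del
    exact Or.inr ⟨tposetCongr (tiles_nonempty hT) (tiles_nonempty hV) (orderOf (undual hT f))⟩

end Fcc

/-- Every normal combinatorially two-orbit LFC tiling of `ℝ³` has face
poset order-isomorphic to that of the tetrahedral–octahedral honeycomb or that of the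
rhombic dodecahedral honeycomb. -/
theorem normal_two_orbit_spatial_tiling_classification (T : Set (Set (EucSp 3)))
    (hT : IsLFCTiling T) (hnorm : IsNormalTiling T) (h2 : TwoFlagOrbits (TPoset T)) :
    Nonempty (TPoset T ≃o TPoset TetrahedralOctahedralHoneycomb) ∨
    Nonempty (TPoset T ≃o TPoset RhombicDodecahedralHoneycomb) := by
  exact Fcc.main T hT hnorm h2
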